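/- arXiv:1107.4754 — 3 statements merged into one kernel-verified Lean document; each statement's English description precedes it below -/
import Mathlib

section
/- Assume the weight sequence b satisfies conditions (M1) and (M2). Then there exists a sequence of real numbers (L_k)_{k≥1} with lim_{k→∞} L_k = 0 such that L₁ = b₁ − A and, for every k ≥ 2, b_k = (L_k − L_{k−1}) k^{ρ} + (A + L_{k−1}) k^{ρ−1}. -/
open Filter Topology Asymptotics MeasureTheory Real

noncomputable section

/-- `F_b(x) = -∑_{k≥1} b_k log(1 - x^k)` (so that `f_b = exp F_b`). -/
def Fb (b : ℕ → ℝ) (x : ℝ) : ℝ := -∑' k : ℕ, b (k + 1) * Real.log (1 - x ^ (k + 1))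

/-- Complex version of `log f_b` (principal branch). -/
def FbC (b : ℕ → ℝ) (x : ℂ) : ℂ := -∑' k : ℕ, (b (k + 1) : ℂ) * Complex.log (1 - x ^ (k + 1))

/-- `f_b(x) = ∏_{k≥1} (1 - x^k)^{-b_k}`. -/
def fb (b : ℕ → ℝ) (x : ℝ) : ℝ := Real.exp (Fb b x)

/-- Complex version of `f_b`. -/
def fbC (b : ℕ → ℝ) (x : ℂ) : ℂ := Complex.exp (FbC b x)

/-- `F_{m,b}(x) = -∑_{k=1}^m b_k log(1 - x^k)`. -/
def Fmb (b : ℕ → ℝ) (m : ℕ) (x : ℝ) : ℝ := -∑ k ∈ Finset.Icc 1 m, b k * Real.log (1 - x ^ k)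

/-- `f_{m,b}(x) = ∏_{k=1}^m (1 - x^k)^{-b_k}`. -/
def fmb (b : ℕ → ℝ) (m : ℕ) (x : ℝ) : ℝ := Real.exp (Fmb b m x)

/-- `𝒜_b(r) = r F_b'(r)`. -/
def Abf (b : ℕ → ℝ) (r : ℝ) : ℝ := r * deriv (Fb b) r

/-- `ℬ_b(r) = r² F_b''(r) + r F_b'(r)`. -/
def Bbf (b : ℕ → ℝ) (r : ℝ) : ℝ :=
  r ^ 2 * iteratedDeriv 2 (Fb b) r + r * deriv (Fb b) r

/-- Meinardus condition (M1): the Dirichlet series `D(s) = ∑_{k≥1} b_k k^{-s}` converges for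
`Re s > ρ` and `Dc` is its analytic continuation to `{Re s ≥ -C₀}`, analytic there except for a
simple pole at `s = ρ` with residue `A > 0`. -/
def M1 (b : ℕ → ℝ) (ρ C₀ A : ℝ) (Dc : ℂ → ℂ) : Prop :=
  0 < ρ ∧ 0 < C₀ ∧ C₀ < 1 ∧ 0 < A ∧
  (∀ s : ℂ, ρ < s.re →
    HasSum (fun k : ℕ => (b (k + 1) : ℂ) * ((k + 1 : ℕ) : ℂ) ^ (-s)) (Dc s)) ∧
  (∀ s : ℂ, -C₀ ≤ s.re → s ≠ (ρ : ℂ) → DifferentiableAt ℂ Dc s) ∧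
  (∃ φ : ℂ → ℂ, (∀ s : ℂ, -C₀ ≤ s.re → DifferentiableAt ℂ φ s) ∧
    ∀ s : ℂ, -C₀ ≤ s.re → s ≠ (ρ : ℂ) → Dc s = (A : ℂ) / (s - (ρ : ℂ)) + φ s)

/-- Meinardus condition (M2): the continuation `Dc` is of finite order `C₁` in `{Re s ≥ -C₀}`,
i.e. `Dc s = O(|Im s|^{C₁})` as `|Im s| → ∞`, uniformly in `Re s ≥ -C₀`. -/
def M2 (C₀ C₁ : ℝ) (Dc : ℂ → ℂ) : Prop :=
  0 < C₁ ∧ ∃ K y₀ : ℝ, ∀ s : ℂ, -C₀ ≤ s.re → y₀ ≤ |s.im| → ‖Dc s‖ ≤ K * |s.im| ^ C₁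

/-- Meinardus condition (M3): `∑_{k≥1} b_k e^{-kα} sin²(πku) ≥ C₂ α^{-ε}` for all small `α > 0`
and all `u` with `α/(2π) < |u| ≤ 1/2`. -/
def M3 (b : ℕ → ℝ) : Prop :=
  ∃ ε C₂ : ℝ, 0 < ε ∧ 0 < C₂ ∧ ∃ α₀ : ℝ, 0 < α₀ ∧ ∀ α : ℝ, 0 < α → α ≤ α₀ →
    ∀ u : ℝ, α / (2 * π) < |u| → |u| ≤ 1 / 2 →
      C₂ * α ^ (-ε) ≤
        ∑' k : ℕ, b (k + 1) * Real.exp (-((k : ℝ) + 1) * α) * Real.sin (π * ((k : ℝ) + 1) * u) ^ 2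

/-- `h = A Γ(ρ+1) ζ(ρ+1)`. -/
def hMein (ρ A : ℝ) : ℝ := A * Real.Gamma (ρ + 1) * (riemannZeta ((ρ : ℂ) + 1)).re

/-- The normalizing constant `a(n) = (A Γ(ρ+1) ζ(ρ+1) / n)^{1/(ρ+1)}`. -/
def aM (ρ A : ℝ) (n : ℕ) : ℝ := (hMein ρ A / n) ^ ((1 : ℝ) / (ρ + 1))


lemma conv_ident (H : ℝ → ℝ) (hHm : Measurable H)
    (hH : ∀ ε > 0, ∃ C, ∀ v > 0, |H v| ≤ C * Real.exp (ε * v))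
    (Q : ℂ → ℂ)
    (hL : ∀ z : ℂ, 0 < z.re → ∫ v in Set.Ioi (0:ℝ), (H v : ℂ) * Complex.exp (-z * v) = Q z)
    (lam : ℝ) (hlam : 0 < lam) (u ε : ℝ) (hε : 0 < ε) :
    ∫ t : ℝ, Q (ε + t * Complex.I) *
        (Complex.exp (Complex.I * u * t) * Complex.exp (-(lam : ℂ) * t ^ 2)) =
      ((π : ℂ) / lam) ^ (1 / 2 : ℂ) * ∫ v in Set.Ioi (0:ℝ), (H v : ℂ) * Complex.exp (-ε * v) *
        Complex.exp (-((u : ℂ) - v) ^ 2 / (4 * lam)) := by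
  obtain ⟨C, hC⟩ := hH (ε / 2) (by positivity)
  have hint : IntegrableOn (fun v => |H v| * Real.exp (-ε * v)) (Set.Ioi (0:ℝ)) := by
    refine Integrable.mono' ((integrableOn_exp_mul_Ioi (a := -(ε / 2)) (by linarith) 0).const_mul C)
      (by fun_prop) ?_
    refine (ae_restrict_iff' measurableSet_Ioi).2 (ae_of_all _ fun v hv => ?_)
    rw [Real.norm_eq_abs, abs_mul, abs_abs, Real.abs_exp]
    calc |H v| * Real.exp (-ε * v) ≤ C * Real.exp (ε / 2 * v) * Real.exp (-ε * v) := by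
          gcongr; exact hC v hv
      _ = _ := by rw [mul_assoc, ← Real.exp_add]; congr 2; ring
  have hgi := integrable_exp_neg_mul_sq hlam
  have hswap : Integrable (Function.uncurry fun (t v : ℝ) =>
      (H v : ℂ) * Complex.exp (-((ε : ℂ) + t * Complex.I) * v) *
        (Complex.exp (Complex.I * u * t) * Complex.exp (-(lam : ℂ) * t ^ 2)))
      (volume.prod (volume.restrict (Set.Ioi (0:ℝ)))) := by
    refine Integrable.mono' (hgi.mul_prod hint) ?_ (ae_of_all _ ?_)
    · apply Measurable.aestronglyMeasurable
      unfold Function.uncurry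
      fun_prop
    · rintro ⟨t, v⟩
      simp only [Function.uncurry, norm_mul, Complex.norm_exp, Complex.norm_real, Real.norm_eq_abs]
      have e1 : (-((ε : ℂ) + t * Complex.I) * v).re = -ε * v := by simp
      have e2 : (Complex.I * u * t).re = 0 := by simp
      have e3 : (-(lam : ℂ) * t ^ 2).re = -lam * t ^ 2 := by
        rw [← Complex.ofReal_pow]; simp [-Complex.ofReal_pow]
      rw [e1, e2, e3, Real.exp_zero]
      apply le_of_eq; ring
  have step : ∀ t : ℝ, Q (ε + t * Complex.I) *
        (Complex.exp (Complex.I * u * t) * Complex.exp (-(lam : ℂ) * t ^ 2)) =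
      ∫ v in Set.Ioi (0:ℝ), (H v : ℂ) * Complex.exp (-((ε : ℂ) + t * Complex.I) * v) *
        (Complex.exp (Complex.I * u * t) * Complex.exp (-(lam : ℂ) * t ^ 2)) := by
    intro t
    rw [integral_mul_const, hL _ (by simpa using hε)]
  simp_rw [step]
  rw [integral_integral_swap hswap, ← integral_const_mul]
  refine integral_congr_ae (ae_of_all _ fun v => ?_)
  simp only
  have := fourierIntegral_gaussian (b := lam) (by simpa using hlam) ((u : ℂ) - v)
  calc _ = ∫ t : ℝ, ((H v : ℂ) * Complex.exp (-ε * v)) *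
        (Complex.exp (Complex.I * ((u : ℂ) - v) * t) * Complex.exp (-(lam : ℂ) * t ^ 2)) := by
        refine integral_congr_ae (ae_of_all _ fun t => ?_)
        simp only [← mul_assoc]
        congr 1
        rw [mul_assoc (H v : ℂ), mul_assoc (H v : ℂ)]
        congr 1
        have e : ∀ x y : ℂ, Complex.exp x * Complex.exp y = Complex.exp (x + y) :=
          fun x y => (Complex.exp_add x y).symm
        rw [e, e]
        congr 1; ring
    _ = _ := by
        rw [integral_const_mul, this]; ring

lemma int_poly_gauss (lam : ℝ) (hlam : 0 < lam) (m : ℕ) (K : ℝ) :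
    Integrable (fun t : ℝ => K * (1 + t ^ (2 * m)) * Real.exp (-lam * t ^ 2)) := by
  have h1 := integrable_exp_neg_mul_sq hlam
  have h2 := integrable_rpow_mul_exp_neg_mul_sq hlam (s := ((2 * m : ℕ) : ℝ))
    (by have : (0:ℝ) ≤ ((2 * m : ℕ) : ℝ) := Nat.cast_nonneg _
        linarith)
  simp_rw [Real.rpow_natCast] at h2
  convert! (h1.add h2).const_mul K using 2 with t
  simp; ring

lemma int_exp_gauss (u lam : ℝ) (hlam : 0 < lam) (C : ℝ) :
    Integrable (fun v : ℝ => C * Real.exp v * Real.exp (-(u - v) ^ 2 / (4 * lam))) := by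
  have h := integrable_exp_neg_mul_sq (b := 1 / (4 * lam)) (by positivity)
  have h2 := (h.comp_sub_right (u + 2 * lam)).const_mul (C * Real.exp (u + lam))
  convert! h2 using 2 with v
  rw [mul_assoc, mul_assoc, ← Real.exp_add, ← Real.exp_add]
  congr 2
  field_simp
  ring

lemma conv_tendsto (H : ℝ → ℝ) (hHm : Measurable H)
    (hH : ∀ ε > 0, ∃ C, ∀ v > 0, |H v| ≤ C * Real.exp (ε * v))
    (Q : ℂ → ℂ) (hQc : ContinuousOn Q {z | 0 ≤ z.re}) (K : ℝ) (m : ℕ)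
    (hQb : ∀ z : ℂ, 0 ≤ z.re → z.re ≤ 1 → ‖Q z‖ ≤ K * (1 + z.im ^ (2 * m)))
    (hL : ∀ z : ℂ, 0 < z.re → ∫ v in Set.Ioi (0:ℝ), (H v : ℂ) * Complex.exp (-z * v) = Q z)
    (lam : ℝ) (hlam : 0 < lam) :
    Tendsto (fun u : ℝ => ∫ v in Set.Ioi (0:ℝ), H v * Real.exp (-(u - v) ^ 2 / (4 * lam)))
      atTop (𝓝 0) := by
  have hline : ∀ ε : ℝ, 0 ≤ ε → Continuous fun t : ℝ => Q (ε + t * Complex.I) := by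
    intro ε hε
    refine hQc.comp_continuous (by fun_prop) fun t => ?_
    simpa using hε
  -- the identity on the boundary
  have hid : ∀ u : ℝ, ∫ t : ℝ, Q (t * Complex.I) *
        (Complex.exp (Complex.I * u * t) * Complex.exp (-(lam : ℂ) * t ^ 2)) =
      ((π : ℂ) / lam) ^ (1 / 2 : ℂ) * ∫ v in Set.Ioi (0:ℝ), (H v : ℂ) *
        Complex.exp (-((u : ℂ) - v) ^ 2 / (4 * lam)) := by
    intro u
    have t1 : Tendsto (fun ε : ℝ => ∫ t : ℝ, Q (ε + t * Complex.I) *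
        (Complex.exp (Complex.I * u * t) * Complex.exp (-(lam : ℂ) * t ^ 2))) (𝓝[>] 0)
        (𝓝 (∫ t : ℝ, Q (t * Complex.I) *
        (Complex.exp (Complex.I * u * t) * Complex.exp (-(lam : ℂ) * t ^ 2)))) := by
      refine tendsto_integral_filter_of_dominated_convergence _ ?_ ?_
        (int_poly_gauss lam hlam m K) ?_
      · filter_upwards [self_mem_nhdsWithin] with ε hε
        have := hline ε (le_of_lt hε)
        exact (this.mul (by fun_prop)).aestronglyMeasurable
      · have : ∀ᶠ ε : ℝ in 𝓝[>] 0, ε ≤ 1 :=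
          nhdsWithin_le_nhds (eventually_le_nhds one_pos)
        filter_upwards [self_mem_nhdsWithin, this] with ε hε hε1
        refine ae_of_all _ fun t => ?_
        have hε' : (0:ℝ) < ε := hε
        have e2 : (Complex.I * u * t).re = 0 := by simp
        have e3 : (-(lam : ℂ) * t ^ 2).re = -lam * t ^ 2 := by
          rw [← Complex.ofReal_pow]; simp [-Complex.ofReal_pow]
        rw [norm_mul, norm_mul, Complex.norm_exp, Complex.norm_exp, e2, e3, Real.exp_zero, one_mul]
        gcongr
        have := hQb (ε + t * Complex.I) (by simpa using hε'.le) (by simpa using hε1)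
        simpa using this
      · refine ae_of_all _ fun t => ?_
        refine Tendsto.mul_const _ ?_
        have hc := hQc (t * Complex.I) (by simp)
        refine hc.tendsto.comp (tendsto_nhdsWithin_iff.2 ⟨?_, ?_⟩)
        · have : Tendsto (fun ε : ℝ => (ε : ℂ) + t * Complex.I) (𝓝 0) (𝓝 (((0:ℝ) : ℂ) + t * Complex.I)) :=
            Continuous.tendsto (by fun_prop) 0
          simp only [Complex.ofReal_zero, zero_add] at this
          exact this.mono_left nhdsWithin_le_nhds
        · filter_upwards [self_mem_nhdsWithin] with ε hε
          have hε' : (0:ℝ) < ε := hε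
          simpa using hε'.le
    have t2 : Tendsto (fun ε : ℝ => ∫ v in Set.Ioi (0:ℝ), (H v : ℂ) * Complex.exp (-ε * v) *
        Complex.exp (-((u : ℂ) - v) ^ 2 / (4 * lam))) (𝓝[>] 0)
        (𝓝 (∫ v in Set.Ioi (0:ℝ), (H v : ℂ) *
        Complex.exp (-((u : ℂ) - v) ^ 2 / (4 * lam)))) := by
      obtain ⟨C, hC⟩ := hH 1 one_pos
      refine tendsto_integral_filter_of_dominated_convergence _ ?_ ?_
        (int_exp_gauss u lam hlam C).integrableOn ?_
      · exact Eventually.of_forall fun ε => by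
          apply Measurable.aestronglyMeasurable; fun_prop
      · filter_upwards [self_mem_nhdsWithin] with ε hε
        refine (ae_restrict_iff' measurableSet_Ioi).2 (ae_of_all _ fun v hv => ?_)
        have hε' : (0:ℝ) < ε := hε
        have hv' : (0:ℝ) < v := hv
        have e1 : -((u : ℂ) - v) ^ 2 / (4 * lam) = ((-(u - v) ^ 2 / (4 * lam) : ℝ) : ℂ) := by
          push_cast; rfl
        have e2 : (-(ε:ℂ) * v) = ((-ε * v : ℝ) : ℂ) := by push_cast; rfl
        rw [e1, e2, norm_mul, norm_mul, Complex.norm_exp, Complex.norm_exp, Complex.ofReal_re,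
          Complex.ofReal_re, Complex.norm_real, Real.norm_eq_abs]
        refine mul_le_mul_of_nonneg_right ?_ (Real.exp_nonneg _)
        have h1 : Real.exp (-ε * v) ≤ 1 := Real.exp_le_one_iff.2 (by nlinarith)
        have h2 := hC v hv
        rw [one_mul] at h2
        calc _ ≤ |H v| * 1 := by gcongr
          _ ≤ _ := by simpa using h2
      · refine ae_of_all _ fun v => ?_
        refine Tendsto.mul_const _ ?_
        have : Tendsto (fun ε : ℝ => (H v : ℂ) * Complex.exp (-ε * v)) (𝓝 0)
            (𝓝 ((H v : ℂ) * Complex.exp (-((0:ℝ) : ℂ) * v))) :=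
          Continuous.tendsto (by fun_prop) 0
        simp only [Complex.ofReal_zero, neg_zero, zero_mul, Complex.exp_zero, mul_one] at this
        exact this.mono_left nhdsWithin_le_nhds
    refine tendsto_nhds_unique t1 (((t2.const_mul (((π : ℂ) / lam) ^ (1 / 2 : ℂ)))).congr' ?_)
    filter_upwards [self_mem_nhdsWithin] with ε hε
    exact (conv_ident H hHm hH Q hL lam hlam u ε hε).symm
  -- Riemann-Lebesgue
  have hRL := Real.tendsto_integral_exp_smul_cocompact
    (fun t : ℝ => Q (t * Complex.I) * Complex.exp (-(lam : ℂ) * t ^ 2))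
  have hcc : Tendsto (fun u : ℝ => -u / (2 * π)) atTop (cocompact ℝ) := by
    have : Tendsto (fun u : ℝ => -u / (2 * π)) atTop atBot :=
      tendsto_neg_atTop_atBot.atBot_div_const (by positivity)
    exact this.mono_right atBot_le_cocompact
  have h3 := hRL.comp hcc
  have h4 : Tendsto (fun u : ℝ => ((π : ℂ) / lam) ^ (1 / 2 : ℂ) * ∫ v in Set.Ioi (0:ℝ), (H v : ℂ) *
        Complex.exp (-((u : ℂ) - v) ^ 2 / (4 * lam))) atTop (𝓝 0) := by
    refine h3.congr fun u => ?_
    rw [← hid u]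
    refine integral_congr_ae (ae_of_all _ fun t => ?_)
    simp only [Circle.smul_def, Real.fourierChar_apply, smul_eq_mul]
    have : Complex.exp (((2 * π * -(t * (-u / (2 * π))) : ℝ) : ℂ) * Complex.I)
        = Complex.exp (Complex.I * u * t) := by
      congr 1
      have : 2 * π * -(t * (-u / (2 * π))) = u * t := by field_simp
      rw [this]; push_cast; ring
    rw [this]; ring
  have hc0 : ((π : ℂ) / lam) ^ (1 / 2 : ℂ) ≠ 0 := by
    rw [Complex.cpow_ne_zero_iff]
    left
    have := pi_ne_zero
    have := hlam.ne'
    simp [*]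
  have h5 := h4.const_mul (((π : ℂ) / lam) ^ (1 / 2 : ℂ))⁻¹
  simp only [inv_mul_cancel_left₀ hc0, mul_zero] at h5
  have h6 := (Complex.continuous_re.tendsto _).comp h5
  simp only [Complex.zero_re] at h6
  refine h6.congr fun u => ?_
  simp only [Function.comp]
  have : ∀ v : ℝ, (H v : ℂ) * Complex.exp (-((u : ℂ) - v) ^ 2 / (4 * lam)) =
      ((H v * Real.exp (-(u - v) ^ 2 / (4 * lam)) : ℝ) : ℂ) := by
    intro v; push_cast; rfl
  simp_rw [this]
  rw [integral_complex_ofReal, Complex.ofReal_re]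

lemma gauss_fact (δ η : ℝ) (hδ : 0 < δ) (hη : 0 < η) :
    ∃ c > 0, (1 - η) * √(π / c) ≤ ∫ w in (-δ)..δ, Real.exp (-c * w ^ 2) := by
  have h := integrable_exp_neg_mul_sq one_pos
  have t := intervalIntegral_tendsto_integral (l := atTop) (a := fun R : ℝ => -(R * δ))
    (b := fun R : ℝ => R * δ) h
    (tendsto_neg_atTop_atBot.comp (tendsto_id.atTop_mul_const hδ)) (tendsto_id.atTop_mul_const hδ)
  rw [integral_gaussian, div_one] at t
  have hpi : 0 < √π := Real.sqrt_pos.2 pi_pos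
  have ev := t.eventually (lt_mem_nhds (show (1 - η) * √π < √π by nlinarith))
  obtain ⟨R, hR, hR0⟩ := (ev.and (eventually_gt_atTop 0)).exists
  refine ⟨R ^ 2, by positivity, ?_⟩
  have e := intervalIntegral.integral_comp_mul_left (a := -δ) (b := δ)
    (fun w => Real.exp (-1 * w ^ 2)) hR0.ne'
  have e2 : ∀ w : ℝ, Real.exp (-R ^ 2 * w ^ 2) = Real.exp (-1 * (R * w) ^ 2) := by
    intro w; congr 1; ring
  simp_rw [e2]
  rw [e, Real.sqrt_div pi_pos.le, Real.sqrt_sq hR0.le, smul_eq_mul, mul_neg]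
  calc _ = R⁻¹ * ((1 - η) * √π) := by field_simp
    _ ≤ _ := by gcongr

lemma int_gauss_shift (c d : ℝ) (hc : 0 < c) :
    Integrable (fun v : ℝ => Real.exp (-c * (d - v) ^ 2)) := by
  have h := (integrable_exp_neg_mul_sq hc).comp_sub_right d
  convert! h using 4 with v
  ring

lemma integral_gauss_shift (c d : ℝ) :
    ∫ v : ℝ, Real.exp (-c * (d - v) ^ 2) = √(π / c) := by
  rw [← integral_gaussian]
  exact integral_sub_left_eq_self (fun w => Real.exp (-c * w ^ 2)) volume d

lemma integrable_Bg (B : ℝ → ℝ) (hBm : Measurable B) (hB0 : ∀ u, 0 ≤ B u) (C : ℝ)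
    (hloc : ∀ v > 0, B v ≤ C * Real.exp v) (c d : ℝ) (hc : 0 < c) :
    IntegrableOn (fun v : ℝ => B v * Real.exp (-c * (d - v) ^ 2)) (Set.Ioi 0) := by
  have h := (int_gauss_shift c (d + 1 / (2 * c)) hc).const_mul (C * Real.exp (d + 1 / (4 * c)))
  refine Integrable.mono' h.integrableOn (Measurable.aestronglyMeasurable (by fun_prop)) ?_
  refine (ae_restrict_iff' measurableSet_Ioi).2 (ae_of_all _ fun v hv => ?_)
  rw [Real.norm_eq_abs, abs_of_nonneg (mul_nonneg (hB0 v) (Real.exp_nonneg _))]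
  calc _ ≤ C * Real.exp v * Real.exp (-c * (d - v) ^ 2) := by
        gcongr; exact hloc v hv
    _ = _ := by
        rw [mul_assoc, mul_assoc, ← Real.exp_add, ← Real.exp_add]
        congr 2
        field_simp
        ring

lemma upper_bd (B : ℝ → ℝ) (hBm : Measurable B) (hB0 : ∀ u, 0 ≤ B u) (C : ℝ)
    (hloc : ∀ v > 0, B v ≤ C * Real.exp v)
    (hmono : ∀ u w, 0 ≤ w → B u * Real.exp (-w) ≤ B (u + w)) (c δ u : ℝ) (hc : 0 < c)
    (hδ : 0 < δ) (hu : 0 ≤ u) :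
    B u * Real.exp (-(2 * δ)) * ∫ w in (-δ)..δ, Real.exp (-c * w ^ 2) ≤
      ∫ v in Set.Ioi 0, B v * Real.exp (-c * ((u + δ) - v) ^ 2) := by
  have hI := integrable_Bg B hBm hB0 C hloc c (u + δ) hc
  have hsub : Set.Ioc u (u + 2 * δ) ⊆ Set.Ioi 0 := fun x hx => lt_of_le_of_lt hu hx.1
  have e := intervalIntegral.integral_comp_sub_left (a := u) (b := u + 2 * δ)
    (fun w => Real.exp (-c * w ^ 2)) (u + δ)
  rw [show u + δ - (u + 2 * δ) = -δ by ring, show u + δ - u = δ by ring,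
    intervalIntegral.integral_of_le (by linarith)] at e
  rw [← e, ← integral_const_mul]
  calc _ ≤ ∫ v in Set.Ioc u (u + 2 * δ), B v * Real.exp (-c * ((u + δ) - v) ^ 2) := by
        refine setIntegral_mono_on ((int_gauss_shift c _ hc).integrableOn.const_mul _)
          (hI.mono_set hsub) measurableSet_Ioc fun v hv => ?_
        gcongr
        have h1 := hmono u (v - u) (by linarith [hv.1])
        rw [add_sub_cancel] at h1
        refine le_trans ?_ h1
        refine mul_le_mul_of_nonneg_left (Real.exp_le_exp.2 (by linarith [hv.2])) (hB0 u)
    _ ≤ _ := by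
        refine setIntegral_mono_set hI (ae_of_all _ fun v => ?_) hsub.eventuallyLE
        exact mul_nonneg (hB0 v) (Real.exp_nonneg _)

lemma lower_bd (B : ℝ → ℝ) (hBm : Measurable B) (hB0 : ∀ u, 0 ≤ B u) (C : ℝ)
    (hloc : ∀ v > 0, B v ≤ C * Real.exp v)
    (hmono : ∀ u w, 0 ≤ w → B u * Real.exp (-w) ≤ B (u + w)) (M : ℝ) (hM0 : 0 ≤ M)
    (hM : ∀ v > 0, B v ≤ M) (c δ u : ℝ) (hc : 0 < c) (hδ : 0 < δ) :
    ∫ v in Set.Ioi 0, B v * Real.exp (-c * ((u - δ) - v) ^ 2) ≤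
      B u * Real.exp (2 * δ) * √(π / c) +
        M * (√(π / c) - ∫ w in (-δ)..δ, Real.exp (-c * w ^ 2)) := by
  have hI := integrable_Bg B hBm hB0 C hloc c (u - δ) hc
  have hg := int_gauss_shift c (u - δ) hc
  have e := intervalIntegral.integral_comp_sub_left (a := u - 2 * δ) (b := u)
    (fun w => Real.exp (-c * w ^ 2)) (u - δ)
  rw [show u - δ - (u - 2 * δ) = δ by ring, show u - δ - u = -δ by ring,
    intervalIntegral.integral_of_le (by linarith), ← integral_indicator measurableSet_Ioc] at e
  have hgi := hg.indicator (measurableSet_Ioc (a := u - 2 * δ) (b := u))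
  have hsub : Integrable (fun v => Real.exp (-c * (u - δ - v) ^ 2) -
      (Set.Ioc (u - 2 * δ) u).indicator (fun v => Real.exp (-c * (u - δ - v) ^ 2)) v) :=
    hg.sub hgi
  rw [← e, ← integral_gauss_shift c (u - δ), ← integral_sub hg hgi, ← integral_const_mul,
    ← integral_const_mul, ← integral_add (hg.const_mul _) (hsub.const_mul _),
    ← integral_indicator measurableSet_Ioi]
  refine integral_mono (hI.integrable_indicator measurableSet_Ioi)
    ((hg.const_mul _).add (hsub.const_mul _)) fun v => ?_
  simp only [Set.indicator_apply]
  set g := Real.exp (-c * (u - δ - v) ^ 2) with hgdef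
  have hg0 : 0 ≤ g := Real.exp_nonneg _
  have hBu : 0 ≤ B u * Real.exp (2 * δ) * g :=
    mul_nonneg (mul_nonneg (hB0 u) (Real.exp_nonneg _)) hg0
  by_cases hv : v ∈ Set.Ioc (u - 2 * δ) u
  · have hle : B v ≤ B u * Real.exp (2 * δ) := by
      have h1 := hmono v (u - v) (by linarith [hv.2])
      rw [add_sub_cancel] at h1
      have h2 : B v * Real.exp (-(2 * δ)) ≤ B u := by
        refine le_trans ?_ h1
        exact mul_le_mul_of_nonneg_left (Real.exp_le_exp.2 (by linarith [hv.1])) (hB0 v)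
      calc B v = B v * Real.exp (-(2 * δ)) * Real.exp (2 * δ) := by
            rw [mul_assoc, ← Real.exp_add]; simp
        _ ≤ _ := by gcongr
    rw [if_pos hv, sub_self, mul_zero, add_zero]
    split_ifs
    · gcongr
    · exact hBu
  · rw [if_neg hv, sub_zero]
    split_ifs with h
    · have := mul_le_mul_of_nonneg_right (hM v h) hg0
      linarith
    · have := mul_nonneg hM0 hg0
      linarith

lemma taub (B : ℝ → ℝ) (hBm : Measurable B) (hB0 : ∀ u, 0 ≤ B u) (C : ℝ)
    (hloc : ∀ v > 0, B v ≤ C * Real.exp v)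
    (hmono : ∀ u w, 0 ≤ w → B u * Real.exp (-w) ≤ B (u + w)) (A : ℝ)
    (hJ : ∀ c > 0, Tendsto (fun u : ℝ => ∫ v in Set.Ioi 0, B v * Real.exp (-c * (u - v) ^ 2))
      atTop (𝓝 (A * √(π / c)))) :
    Tendsto B atTop (𝓝 A) := by
  -- upper estimate
  have up : ∀ η, 0 < η → η < 1 → ∀ᶠ u in atTop,
      B u ≤ (A + η) * Real.exp (2 * η) / (1 - η) := by
    intro η h0 h1
    obtain ⟨c, hc, hcI⟩ := gauss_fact η η h0 h0
    have hs : 0 < √(π / c) := Real.sqrt_pos.2 (by positivity)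
    have ev := ((hJ c hc).comp (tendsto_atTop_add_const_right atTop η tendsto_id)).eventually
      (gt_mem_nhds (show A * √(π / c) < (A + η) * √(π / c) by nlinarith))
    filter_upwards [ev, eventually_ge_atTop 0] with u hu hu0
    have h2 := upper_bd B hBm hB0 C hloc hmono c η u hc h0 hu0
    simp only [Function.comp, id] at hu
    have h3 : B u * Real.exp (-(2 * η)) * ((1 - η) * √(π / c)) ≤ (A + η) * √(π / c) :=
      le_trans (mul_le_mul_of_nonneg_left hcI (mul_nonneg (hB0 u) (Real.exp_nonneg _)))
        (h2.trans hu.le)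
    have h4 : B u * Real.exp (-(2 * η)) * (1 - η) ≤ A + η := by
      rw [← mul_assoc] at h3
      exact le_of_mul_le_mul_right h3 hs
    rw [le_div_iff₀ (by linarith)]
    calc B u * (1 - η) = B u * Real.exp (-(2 * η)) * (1 - η) * Real.exp (2 * η) := by
          have : Real.exp (-(2 * η)) * Real.exp (2 * η) = 1 := by rw [← Real.exp_add]; simp
          linear_combination (-(B u * (1 - η))) * this
      _ ≤ _ := by gcongr
  -- boundedness
  obtain ⟨M, hM0, hM⟩ : ∃ M, 0 ≤ M ∧ ∀ v > 0, B v ≤ M := by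
    obtain ⟨u0, hu0⟩ := eventually_atTop.1 (up (1/2) (by norm_num) (by norm_num))
    have hC0 : 0 ≤ C := by
      have := (hB0 1).trans (hloc 1 one_pos)
      exact nonneg_of_mul_nonneg_left this (Real.exp_pos _)
    refine ⟨max ((A + 1/2) * Real.exp (2 * (1/2)) / (1 - 1/2)) (C * Real.exp u0),
      le_max_of_le_right (by positivity), fun v hv => ?_⟩
    rcases le_total u0 v with h | h
    · exact le_max_of_le_left (hu0 v h)
    · refine le_max_of_le_right ((hloc v hv).trans ?_)
      gcongr
  -- lower estimate
  have lo : ∀ η, 0 < η → ∀ᶠ u in atTop,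
      (A - η - M * η) * Real.exp (-(2 * η)) ≤ B u := by
    intro η h0
    obtain ⟨c, hc, hcI⟩ := gauss_fact η η h0 h0
    have hs : 0 < √(π / c) := Real.sqrt_pos.2 (by positivity)
    have ev := ((hJ c hc).comp (tendsto_atTop_add_const_right atTop (-η) tendsto_id)).eventually
      (lt_mem_nhds (show (A - η) * √(π / c) < A * √(π / c) by nlinarith))
    filter_upwards [ev] with u hu
    have h2 := lower_bd B hBm hB0 C hloc hmono M hM0 hM c η u hc h0
    simp only [Function.comp, id, ← sub_eq_add_neg] at hu
    have h3 : M * (√(π / c) - ∫ w in (-η)..η, Real.exp (-c * w ^ 2)) ≤ M * (η * √(π / c)) :=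
      mul_le_mul_of_nonneg_left (by linarith) hM0
    have h4 : (A - η - M * η) * √(π / c) ≤ B u * Real.exp (2 * η) * √(π / c) := by
      linarith
    have h5 := le_of_mul_le_mul_right h4 hs
    calc _ ≤ B u * Real.exp (2 * η) * Real.exp (-(2 * η)) := by gcongr
      _ = _ := by rw [mul_assoc, ← Real.exp_add]; simp
  have tU : Tendsto (fun η : ℝ => (A + η) * Real.exp (2 * η) / (1 - η)) (𝓝[>] 0) (𝓝 A) := by
    have : ContinuousAt (fun η : ℝ => (A + η) * Real.exp (2 * η) / (1 - η)) 0 := by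
      refine ContinuousAt.div (by fun_prop) (by fun_prop) (by norm_num)
    have := this.tendsto
    simp at this
    exact this.mono_left nhdsWithin_le_nhds
  have tL : Tendsto (fun η : ℝ => (A - η - M * η) * Real.exp (-(2 * η))) (𝓝[>] 0) (𝓝 A) := by
    have : ContinuousAt (fun η : ℝ => (A - η - M * η) * Real.exp (-(2 * η))) 0 := by fun_prop
    have := this.tendsto
    simp at this
    exact this.mono_left nhdsWithin_le_nhds
  have hlt1 : ∀ᶠ η : ℝ in 𝓝[>] 0, η < 1 := nhdsWithin_le_nhds (gt_mem_nhds one_pos)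
  refine tendsto_order.2 ⟨fun a ha => ?_, fun a ha => ?_⟩
  · obtain ⟨η, hη, hη0⟩ := ((tL.eventually (lt_mem_nhds ha)).and self_mem_nhdsWithin).exists
    filter_upwards [lo η hη0] with u hu
    exact lt_of_lt_of_le hη hu
  · obtain ⟨η, ⟨hη, hη0⟩, hη1⟩ :=
      (((tU.eventually (gt_mem_nhds ha)).and self_mem_nhdsWithin).and hlt1).exists
    filter_upwards [up η hη0 hη1] with u hu
    exact lt_of_le_of_lt hu hη

lemma int_Ioi_gauss (c : ℝ) (hc : 0 < c) :
    Tendsto (fun u : ℝ => ∫ v in Set.Ioi 0, Real.exp (-c * (u - v) ^ 2)) atTop (𝓝 (√(π / c))) := by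
  have h := integrable_exp_neg_mul_sq hc
  have t : Tendsto (fun u : ℝ => ∫ w, (Set.Ioi (-u)).indicator (fun w => Real.exp (-c * w ^ 2)) w)
      atTop (𝓝 (∫ w : ℝ, Real.exp (-c * w ^ 2))) := by
    refine tendsto_integral_filter_of_dominated_convergence _ ?_ ?_ h ?_
    · exact Eventually.of_forall fun u => (h.indicator measurableSet_Ioi).aestronglyMeasurable
    · refine Eventually.of_forall fun u => ae_of_all _ fun w => ?_
      refine (norm_indicator_le_norm_self _ _).trans ?_
      rw [Real.norm_eq_abs, Real.abs_exp]
    · refine ae_of_all _ fun w => ?_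
      refine tendsto_const_nhds.congr' ?_
      filter_upwards [eventually_gt_atTop (-w)] with u hu
      rw [Set.indicator_of_mem]
      simp only [Set.mem_Ioi]; linarith
  rw [integral_gaussian] at t
  refine t.congr fun u => ?_
  rw [← integral_indicator measurableSet_Ioi,
    ← integral_sub_right_eq_self (μ := volume) _ u]
  refine integral_congr_ae (ae_of_all _ fun v => ?_)
  simp only [Set.indicator_apply, Set.mem_Ioi]
  have : (-u < v - u) ↔ 0 < v := by constructor <;> intro h <;> linarith
  simp only [this]
  split_ifs
  · congr 1; ring
  · rfl

lemma ikehara (B : ℝ → ℝ) (hBm : Measurable B) (hB0 : ∀ u, 0 ≤ B u) (A : ℝ)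
    (hloc : ∀ ε > 0, ∃ C, ∀ v > 0, B v ≤ C * Real.exp (ε * v))
    (hmono : ∀ u w, 0 ≤ w → B u * Real.exp (-w) ≤ B (u + w))
    (Q : ℂ → ℂ) (hQc : ContinuousOn Q {z | 0 ≤ z.re}) (K : ℝ) (m : ℕ)
    (hQb : ∀ z : ℂ, 0 ≤ z.re → z.re ≤ 1 → ‖Q z‖ ≤ K * (1 + z.im ^ (2 * m)))
    (hL : ∀ z : ℂ, 0 < z.re →
      ∫ v in Set.Ioi (0:ℝ), ((B v - A : ℝ) : ℂ) * Complex.exp (-z * v) = Q z) :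
    Tendsto B atTop (𝓝 A) := by
  obtain ⟨C, hC⟩ := hloc 1 one_pos
  simp only [one_mul] at hC
  refine taub B hBm hB0 C hC hmono A fun c hc => ?_
  have h1 := conv_tendsto (fun v => B v - A) (by fun_prop) (by
    intro ε hε
    obtain ⟨D, hD⟩ := hloc ε hε
    refine ⟨D + |A|, fun v hv => ?_⟩
    have h1 : 1 ≤ Real.exp (ε * v) := Real.one_le_exp (by positivity)
    have h2 := hD v hv
    calc |B v - A| ≤ |B v| + |A| := abs_sub _ _
      _ ≤ D * Real.exp (ε * v) + |A| * Real.exp (ε * v) := by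
        rw [abs_of_nonneg (hB0 v)]
        gcongr
        exact le_mul_of_one_le_right (abs_nonneg A) h1
      _ = _ := by ring) Q hQc K m hQb hL (1 / (4 * c)) (by positivity)
  have h2 := h1.add ((int_Ioi_gauss c hc).const_mul A)
  rw [zero_add] at h2
  refine h2.congr fun u => ?_
  have e : ∀ v : ℝ, -(u - v) ^ 2 / (4 * (1 / (4 * c))) = -c * (u - v) ^ 2 := by
    intro v; field_simp
  simp_rw [e]
  have i1 := integrable_Bg B hBm hB0 C hC c u hc
  have i2 := ((int_gauss_shift c u hc).const_mul A).integrableOn (s := Set.Ioi 0)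
  rw [← integral_const_mul]
  simp_rw [sub_mul]
  rw [integral_sub i1 i2, sub_add_cancel]

lemma Q_bound (ρ C₀ A C₁ : ℝ) (Dc φ : ℂ → ℂ) (hρ : 0 < ρ) (hC₀ : 0 < C₀)
    (hφ : ∀ s : ℂ, -C₀ ≤ s.re → DifferentiableAt ℂ φ s)
    (hDφ : ∀ s : ℂ, -C₀ ≤ s.re → s ≠ (ρ : ℂ) → Dc s = (A : ℂ) / (s - (ρ : ℂ)) + φ s)
    (h2 : 0 < C₁ ∧ ∃ K y₀ : ℝ, ∀ s : ℂ, -C₀ ≤ s.re → y₀ ≤ |s.im| → ‖Dc s‖ ≤ K * |s.im| ^ C₁)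
    (hQc : ContinuousOn (fun z : ℂ => (φ (ρ + z) - A) / (1 + z)) {z | 0 ≤ z.re}) :
    ∃ (K : ℝ) (m : ℕ), ∀ z : ℂ, 0 ≤ z.re → z.re ≤ 1 →
      ‖(φ (ρ + z) - A) / (1 + z)‖ ≤ K * (1 + z.im ^ (2 * m)) := by
  obtain ⟨hC₁, K, y₀, hK⟩ := h2
  set y := max y₀ 1
  have hcomp : IsCompact (Set.Icc (0:ℝ) 1 ×ℂ Set.Icc (-y) y) := isCompact_Icc.reProdIm isCompact_Icc
  obtain ⟨K2, hK2⟩ := hcomp.exists_bound_of_continuousOn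
    (hQc.mono (fun z hz => (Complex.mem_reProdIm.1 hz).1.1))
  refine ⟨max K2 (|K| + 2 * |A|), ⌈C₁⌉₊, fun z hz0 hz1 => ?_⟩
  have hpow : 0 ≤ z.im ^ (2 * ⌈C₁⌉₊) := by rw [pow_mul]; positivity
  have hpos : 0 ≤ |K| + 2 * |A| := by positivity
  by_cases hy : |z.im| ≤ y
  · have h1 := hK2 z (Complex.mem_reProdIm.2 ⟨⟨hz0, hz1⟩, abs_le.1 hy⟩)
    refine h1.trans ((le_max_left K2 (|K| + 2 * |A|)).trans ?_)
    exact le_mul_of_one_le_right (hpos.trans (le_max_right K2 _)) (by linarith)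
  · push Not at hy
    have hy1 : 1 ≤ |z.im| := (le_max_right y₀ 1).trans hy.le
    have hy0 : y₀ ≤ |z.im| := (le_max_left y₀ 1).trans hy.le
    have hz : 1 ≤ ‖z‖ := hy1.trans (Complex.abs_im_le_norm z)
    have hzne : z ≠ 0 := by
      rintro rfl; simp at hz; linarith
    have hre : -C₀ ≤ ((ρ:ℂ) + z).re := by simp; linarith
    have h1 := hK (ρ + z) hre (by simpa using hy0)
    have h3 := hDφ (ρ + z) hre (by simpa using hzne)
    rw [add_sub_cancel_left] at h3
    have him : ((ρ:ℂ) + z).im = z.im := by simp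
    rw [him] at h1
    have h4 : ‖(A:ℂ) / z‖ ≤ |A| := by
      rw [norm_div, Complex.norm_real, Real.norm_eq_abs]
      exact div_le_self (abs_nonneg _) hz
    have h5 : |z.im| ^ C₁ ≤ z.im ^ (2 * ⌈C₁⌉₊) := by
      calc |z.im| ^ C₁ ≤ |z.im| ^ ((2 * ⌈C₁⌉₊ : ℕ) : ℝ) := by
            apply Real.rpow_le_rpow_of_exponent_le hy1
            push_cast
            have := Nat.le_ceil C₁
            linarith
        _ = _ := by rw [Real.rpow_natCast, pow_mul, sq_abs, ← pow_mul]
    have h6 : ‖φ (ρ + z)‖ ≤ |K| * z.im ^ (2 * ⌈C₁⌉₊) + |A| := by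
      have : φ (ρ + z) = Dc (ρ + z) - A / z := by rw [h3]; ring
      rw [this]
      refine (norm_sub_le _ _).trans (add_le_add (h1.trans ?_) h4)
      calc K * |z.im| ^ C₁ ≤ |K| * |z.im| ^ C₁ := by gcongr; exact le_abs_self K
        _ ≤ _ := by gcongr
    have h7 : 1 ≤ ‖1 + z‖ := by
      have := Complex.abs_im_le_norm (1 + z)
      simp at this
      linarith
    have h8 : ‖φ (ρ + z) - A‖ ≤ |K| * z.im ^ (2 * ⌈C₁⌉₊) + 2 * |A| := by
      refine (norm_sub_le _ _).trans ?_
      rw [Complex.norm_real, Real.norm_eq_abs]; linarith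
    rw [norm_div]
    refine (div_le_self (norm_nonneg _) h7).trans (h8.trans ?_)
    calc _ ≤ (|K| + 2 * |A|) * (1 + z.im ^ (2 * ⌈C₁⌉₊)) := by
          have := abs_nonneg K
          have := mul_nonneg (abs_nonneg A) hpow
          nlinarith
      _ ≤ _ := by gcongr; exact le_max_right _ _

lemma main_asymp (b : ℕ → ℝ) (hb : ∀ k, 0 ≤ b k) (ρ C₀ A C₁ : ℝ) (Dc : ℂ → ℂ)
    (h1 : M1 b ρ C₀ A Dc) (h2 : M2 C₀ C₁ Dc) :
    Tendsto (fun n : ℕ => (∑ k ∈ Finset.Icc 1 n, b k * (k : ℝ) ^ (1 - ρ)) / n) atTop (𝓝 A) := by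
  obtain ⟨hρ, hC₀, -, -, hsum, -, φ, hφ, hDφ⟩ := h1
  set f : ℕ → ℝ := fun k => b k * (k : ℝ) ^ (1 - ρ) with hf
  have hf0 : ∀ k, 0 ≤ f k := fun k => mul_nonneg (hb k) (by positivity)
  set S : ℕ → ℝ := fun n => ∑ k ∈ Finset.Icc 1 n, f k with hS
  have hSmono : Monotone S := by
    intro m n hmn
    exact Finset.sum_le_sum_of_subset_of_nonneg (Finset.Icc_subset_Icc_right hmn)
      fun k _ _ => hf0 k
  have hS0 : ∀ n, 0 ≤ S n := fun n => Finset.sum_nonneg fun k _ => hf0 k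
  -- partial sum bounds
  have hSb : ∀ ε : ℝ, 0 < ε → ∃ C, 0 ≤ C ∧ ∀ n : ℕ, S n ≤ C * (n : ℝ) ^ (1 + ε) := by
    intro ε hε
    have h := (hsum ((ρ + ε : ℝ) : ℂ) (by simpa using hε)).summable.norm
    have e : ∀ k : ℕ, ‖(b (k + 1) : ℂ) * ((k + 1 : ℕ) : ℂ) ^ (-((ρ + ε : ℝ) : ℂ))‖ =
        b (k + 1) * ((k + 1 : ℕ) : ℝ) ^ (-(ρ + ε)) := by
      intro k
      rw [norm_mul, Complex.norm_real, Real.norm_eq_abs, abs_of_nonneg (hb _),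
        Complex.norm_natCast_cpow_of_pos (Nat.succ_pos k)]
      simp
    simp_rw [e] at h
    have hnn : ∀ k : ℕ, 0 ≤ b (k + 1) * ((k + 1 : ℕ) : ℝ) ^ (-(ρ + ε)) := fun k =>
      mul_nonneg (hb _) (by positivity)
    refine ⟨∑' k : ℕ, b (k + 1) * ((k + 1 : ℕ) : ℝ) ^ (-(ρ + ε)), tsum_nonneg hnn, fun n => ?_⟩
    rw [hS]
    simp only
    have hr : ∑ k ∈ Finset.Icc 1 n, f k = ∑ k ∈ Finset.range n, f (k + 1) := by
      rw [Finset.range_eq_Ico, Finset.sum_Ico_add' f 0 n 1]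
      rfl
    rw [hr]
    calc ∑ k ∈ Finset.range n, f (k + 1) ≤
          ∑ k ∈ Finset.range n, b (k + 1) * ((k + 1 : ℕ) : ℝ) ^ (-(ρ + ε)) * (n : ℝ) ^ (1 + ε) := by
          refine Finset.sum_le_sum fun k hk => ?_
          have hkn : k + 1 ≤ n := Finset.mem_range.1 hk
          have hpos : (0:ℝ) < ((k + 1 : ℕ) : ℝ) := by positivity
          simp only [hf]
          rw [show 1 - ρ = -(ρ + ε) + (1 + ε) by ring, Real.rpow_add hpos, ← mul_assoc]
          gcongr
          exact hnn k
      _ ≤ _ := by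
          rw [← Finset.sum_mul]
          gcongr
          exact h.sum_le_tsum _ fun k _ => hnn k
  set B : ℝ → ℝ := fun u => S ⌊Real.exp u⌋₊ * Real.exp (-u) with hB
  have hBm : Measurable B := by
    have : Measurable fun u : ℝ => S ⌊Real.exp u⌋₊ :=
      (measurable_of_countable S).comp (Nat.measurable_floor.comp Real.measurable_exp)
    exact this.mul (by fun_prop)
  have hB0 : ∀ u, 0 ≤ B u := fun u => mul_nonneg (hS0 _) (Real.exp_nonneg _)
  have hloc : ∀ ε > 0, ∃ C, ∀ v > 0, B v ≤ C * Real.exp (ε * v) := by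
    intro ε hε
    obtain ⟨C, hC0, hC⟩ := hSb ε hε
    refine ⟨C, fun v _ => ?_⟩
    have hfl : (⌊Real.exp v⌋₊ : ℝ) ≤ Real.exp v := Nat.floor_le (Real.exp_nonneg _)
    calc B v ≤ C * (Real.exp v) ^ (1 + ε) * Real.exp (-v) := by
          simp only [hB]
          gcongr
          refine (hC _).trans ?_
          gcongr
      _ = _ := by
          rw [← Real.exp_mul, mul_assoc, ← Real.exp_add]
          congr 2; ring
  have hmono : ∀ u w, 0 ≤ w → B u * Real.exp (-w) ≤ B (u + w) := by
    intro u w hw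
    simp only [hB]
    rw [mul_assoc, ← Real.exp_add, ← neg_add]
    gcongr
    apply hSmono
    apply Nat.floor_mono
    gcongr
    linarith
  set Q : ℂ → ℂ := fun z => (φ (ρ + z) - A) / (1 + z) with hQ
  have hQc : ContinuousOn Q {z | 0 ≤ z.re} := by
    intro z hz
    have hz' : 0 ≤ z.re := hz
    apply ContinuousAt.continuousWithinAt
    have c1 : ContinuousAt (fun z : ℂ => φ (ρ + z)) z :=
      ContinuousAt.comp (g := φ) (f := fun z : ℂ => (ρ:ℂ) + z)
        (hφ (ρ + z) (by simp; linarith)).continuousAt (by fun_prop)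
    refine ContinuousAt.div (c1.sub continuousAt_const) (by fun_prop) ?_
    intro h
    have := congrArg Complex.re h
    simp at this
    linarith
  obtain ⟨K, m, hQb⟩ := Q_bound ρ C₀ A C₁ Dc φ hρ hC₀ hφ hDφ h2 hQc
  have hL : ∀ z : ℂ, 0 < z.re →
      ∫ v in Set.Ioi (0:ℝ), ((B v - A : ℝ) : ℂ) * Complex.exp (-z * v) = Q z := by
    intro z hz
    have hz0 : z ≠ 0 := by rintro rfl; simp at hz
    have hz1 : 1 + z ≠ 0 := by
      intro h
      have := congrArg Complex.re h
      simp at this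
      linarith
    -- L-series value
    have hLs : LSeries (fun n => (f n : ℂ)) (1 + z) = Dc (ρ + z) := by
      have h := hsum (ρ + z) (by simpa using hz)
      unfold LSeries
      apply HasSum.tsum_eq
      rw [← hasSum_nat_add_iff' 1]
      simp only [Finset.range_one, Finset.sum_singleton, LSeries.term_zero, sub_zero]
      convert! h using 2 with k
      rw [LSeries.term_of_ne_zero (Nat.succ_ne_zero k), div_eq_mul_inv, ← Complex.cpow_neg]
      have hk : ((k + 1 : ℕ) : ℂ) ≠ 0 := Nat.cast_ne_zero.2 (Nat.succ_ne_zero k)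
      simp only [hf]
      rw [Complex.ofReal_mul, Complex.ofReal_cpow (by positivity), Complex.ofReal_natCast,
        mul_assoc, ← Complex.cpow_add _ _ hk]
      congr 2
      push_cast; ring
    obtain ⟨C, hC0, hC⟩ := hSb (z.re / 2) (by positivity)
    have hint := LSeries_eq_mul_integral_of_nonneg f (r := 1 + z.re / 2) (by positivity)
      (s := 1 + z) (by simp; linarith) (by
        refine IsBigO.of_bound C (Eventually.of_forall fun n => ?_)
        rw [Real.norm_eq_abs, abs_of_nonneg (hS0 n), Real.norm_eq_abs,
          abs_of_nonneg (by positivity)]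
        exact hC n) hf0
    rw [hLs] at hint
    have himg : Real.exp '' Set.Ioi 0 = Set.Ioi 1 := by
      ext x
      simp only [Set.mem_image, Set.mem_Ioi]
      constructor
      · rintro ⟨u, hu, rfl⟩; exact Real.one_lt_exp_iff.2 hu
      · intro hx; exact ⟨Real.log x, Real.log_pos hx, Real.exp_log (by linarith)⟩
    have hchg := integral_image_eq_integral_abs_deriv_smul (s := Set.Ioi (0:ℝ)) (f := Real.exp)
      (f' := Real.exp) measurableSet_Ioi
      (fun x _ => (Real.hasDerivAt_exp x).hasDerivWithinAt) Real.exp_injective.injOn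
      (fun t : ℝ => (∑ k ∈ Finset.Icc 1 ⌊t⌋₊, (f k : ℂ)) * (t : ℂ) ^ (-(1 + z + 1)))
    rw [himg] at hchg
    rw [hchg] at hint
    have hBint : ∫ v in Set.Ioi (0:ℝ), (B v : ℂ) * Complex.exp (-z * v) = Dc (ρ + z) / (1 + z) := by
      rw [hint, mul_div_cancel_left₀ _ hz1]
      refine integral_congr_ae (ae_of_all _ fun u => ?_)
      simp only [hB, hS]
      rw [Real.abs_exp, Complex.real_smul, ← Complex.ofReal_sum, Complex.ofReal_mul,
        Complex.ofReal_exp u, Complex.cpow_def_of_ne_zero (Complex.exp_ne_zero _),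
        ← Complex.ofReal_exp u, ← Complex.ofReal_log (Real.exp_nonneg _), Real.log_exp]
      have : Complex.exp (-z * u) * Complex.exp (-(u:ℂ)) =
          Complex.exp u * Complex.exp (u * (-(1 + z + 1))) := by
        rw [← Complex.exp_add, ← Complex.exp_add]; congr 1; ring
      push_cast
      linear_combination (∑ k ∈ Finset.Icc 1 ⌊Real.exp u⌋₊, (f k : ℂ)) * this
    have hAint : ∫ v in Set.Ioi (0:ℝ), (A : ℂ) * Complex.exp (-z * v) = A / z := by
      rw [integral_const_mul, integral_exp_mul_complex_Ioi (by simpa using hz)]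
      simp
      rfl
    have iA : IntegrableOn (fun v : ℝ => (A : ℂ) * Complex.exp (-z * v)) (Set.Ioi (0:ℝ)) :=
      (integrableOn_exp_mul_complex_Ioi (by simpa using hz) 0).const_mul _
    have iB : IntegrableOn (fun v : ℝ => (B v : ℂ) * Complex.exp (-z * v)) (Set.Ioi (0:ℝ)) := by
      obtain ⟨D, hD⟩ := hloc (z.re / 2) (by positivity)
      refine Integrable.mono' ((integrableOn_exp_mul_Ioi (a := -(z.re / 2)) (by linarith) 0).const_mul D)
        (Measurable.aestronglyMeasurable (by fun_prop)) ?_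
      refine (ae_restrict_iff' measurableSet_Ioi).2 (ae_of_all _ fun v hv => ?_)
      have e1 : (-z * v).re = -z.re * v := by simp
      rw [norm_mul, Complex.norm_real, Real.norm_eq_abs, abs_of_nonneg (hB0 v), Complex.norm_exp, e1]
      calc B v * Real.exp (-z.re * v) ≤ D * Real.exp (z.re / 2 * v) * Real.exp (-z.re * v) := by
            gcongr; exact hD v hv
        _ = _ := by rw [mul_assoc, ← Real.exp_add]; congr 2; ring
    simp only [Complex.ofReal_sub, sub_mul]
    rw [integral_sub iB iA, hBint, hAint, hDφ (ρ + z) (by simp; linarith) (by simpa using hz0),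
      add_sub_cancel_left]
    simp only [hQ]
    field_simp
    ring
  have hlim := ikehara B hBm hB0 A hloc hmono Q hQc K m hQb hL
  have h3 := hlim.comp (Real.tendsto_log_atTop.comp tendsto_natCast_atTop_atTop)
  refine h3.congr' ?_
  filter_upwards [eventually_gt_atTop 0] with n hn
  have hn' : (0:ℝ) < n := Nat.cast_pos.2 hn
  simp only [Function.comp, hB]
  rw [Real.exp_log hn', Nat.floor_natCast, Real.exp_neg, Real.exp_log hn', div_eq_mul_inv]

theorem statement8    (b : ℕ → ℝ) (hb : ∀ k, 0 ≤ b k) (ρ C₀ A C₁ : ℝ) (Dc : ℂ → ℂ)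
    (h1 : M1 b ρ C₀ A Dc) (h2 : M2 C₀ C₁ Dc) :
    ∃ L : ℕ → ℝ, Tendsto L atTop (𝓝 0) ∧ L 1 = b 1 - A ∧
      ∀ k : ℕ, 2 ≤ k →
        b k = (L k - L (k - 1)) * (k : ℝ) ^ ρ + (A + L (k - 1)) * (k : ℝ) ^ (ρ - 1) := by
  have h := main_asymp b hb ρ C₀ A C₁ Dc h1 h2
  refine ⟨fun n => (∑ k ∈ Finset.Icc 1 n, b k * (k : ℝ) ^ (1 - ρ)) / n - A, ?_, ?_, ?_⟩
  · simpa using h.sub_const A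
  · simp
  · intro k hk
    obtain ⟨n, rfl⟩ : ∃ n, k = n + 1 := ⟨k - 1, by omega⟩
    have hn : (0:ℝ) < n := by
      have : 0 < n := by omega
      exact_mod_cast this
    have hn1 : (0:ℝ) < ((n + 1 : ℕ) : ℝ) := by positivity
    rw [Nat.add_sub_cancel]
    beta_reduce
    rw [Finset.sum_Icc_succ_top (by omega)]
    set T := ∑ k ∈ Finset.Icc 1 n, b k * (k : ℝ) ^ (1 - ρ)
    have e1 : ((n + 1 : ℕ) : ℝ) ^ ρ = ((n + 1 : ℕ) : ℝ) * ((n + 1 : ℕ) : ℝ) ^ (ρ - 1) := by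
      rw [← Real.rpow_one_add' hn1.le (by simpa using h1.1.ne')]
      congr 1; ring
    have e2 : ((n + 1 : ℕ) : ℝ) ^ (1 - ρ) * ((n + 1 : ℕ) : ℝ) ^ (ρ - 1) = 1 := by
      rw [← Real.rpow_add hn1]; simp
    rw [e1]
    set X := ((n + 1 : ℕ) : ℝ) ^ (ρ - 1)
    set Y := ((n + 1 : ℕ) : ℝ) ^ (1 - ρ)
    have e3 : ((n + 1 : ℕ) : ℝ) = n + 1 := by push_cast; rfl
    rw [e3] at *
    field_simp
    linear_combination (-(b (n + 1)) * n) * e2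
end
end

section
/- Assume the weight sequence b satisfies conditions (M1) and (M2), let α_n be the unique positive solution of 𝒜_b(e^{−α}) = n, and let δ_n = α_n^{1+ρ/3}/ω(n) where ω(n) → ∞ arbitrarily slowly. Then there exist a constant C′ > 0 and n₀ such that for all n ≥ n₀ and all real u with δ_n/(2π) ≤ |u| < α_n/(2π), one has Σ_{k≥1} b_k e^{−kα_n} sin²(πku) ≥ C′ α_n^{−ρ/3}/ω²(n). -/
open Filter Topology Asymptotics MeasureTheory Real

noncomputable section

/-- The compactly supported kernel `x² (1-x)₊^m`. -/
def gK (m : ℕ) (x : ℝ) : ℝ := x ^ 2 * (max (1 - x) 0) ^ m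

/-- The Mellin transform of `gK`. -/
def hK (m : ℕ) (s : ℂ) : ℂ := (m.factorial : ℂ) / ∏ j ∈ Finset.range (m + 1), (s + 2 + j)

lemma gK_cont (m : ℕ) : Continuous (gK m) := by
  unfold gK; fun_prop

lemma gK_nonneg (m : ℕ) (x : ℝ) : 0 ≤ gK m x := by
  unfold gK; positivity

lemma gK_zero (m : ℕ) (hm : m ≠ 0) (x : ℝ) (hx : 1 ≤ x) : gK m x = 0 := by
  unfold gK; rw [max_eq_right (by linarith)]; simp [hm]

lemma gK_le (m : ℕ) (x : ℝ) (hx : 0 ≤ x) : gK m x ≤ x ^ 2 := by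
  unfold gK
  have : (max (1 - x) 0) ^ m ≤ 1 := pow_le_one₀ (le_max_right _ _) (max_le (by linarith) (by norm_num))
  nlinarith [sq_nonneg x]

lemma gK_integrand (m : ℕ) (s : ℂ) (x : ℝ) (hx : x ∈ Set.Ioc (0:ℝ) 1) :
    (x : ℂ) ^ (s - 1) • ((gK m x : ℝ) : ℂ) =
      (x : ℂ) ^ (s + 2 - 1) * (1 - (x : ℂ)) ^ ((m : ℂ) + 1 - 1) := by
  have hx0 : (x : ℂ) ≠ 0 := by exact_mod_cast hx.1.ne'
  unfold gK
  rw [max_eq_left (by linarith [hx.2]), add_sub_cancel_right, Complex.cpow_natCast,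
    show s + 2 - 1 = (s - 1) + (2 : ℕ) by push_cast; ring, Complex.cpow_add _ _ hx0,
    Complex.cpow_natCast]
  push_cast
  rw [smul_eq_mul]; ring

lemma gK_mellinConv (m : ℕ) (hm : m ≠ 0) (s : ℂ) (hs : 0 < s.re) :
    MellinConvergent (fun x => ((gK m x : ℝ) : ℂ)) s := by
  unfold MellinConvergent
  have h := Complex.betaIntegral_convergent (u := s + 2) (v := m + 1)
    (by simp; linarith) (by simp; positivity)
  rw [intervalIntegrable_iff_integrableOn_Ioc_of_le zero_le_one] at h
  have h2 : IntegrableOn (fun t : ℝ => (t : ℂ) ^ (s - 1) • ((gK m t : ℝ) : ℂ)) (Set.Ioc 0 1) :=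
    h.congr_fun (fun x hx => (gK_integrand m s x hx).symm) measurableSet_Ioc
  refine h2.of_forall_sdiff_eq_zero measurableSet_Ioi ?_
  intro x hx
  have : 1 < x := by
    by_contra hc
    exact hx.2 ⟨hx.1, not_lt.1 hc⟩
  simp [gK_zero m hm x this.le]

lemma gK_mellin (m : ℕ) (hm : m ≠ 0) (s : ℂ) (hs : 0 < s.re) :
    mellin (fun x => ((gK m x : ℝ) : ℂ)) s = hK m s := by
  unfold mellin hK
  rw [← Complex.betaIntegral_eval_nat_add_one_right (u := s + 2) (by simp; linarith) m]
  unfold Complex.betaIntegral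
  rw [intervalIntegral.integral_of_le zero_le_one]
  rw [setIntegral_eq_of_subset_of_forall_sdiff_eq_zero (s := Set.Ioc (0:ℝ) 1) (t := Set.Ioi 0)
    measurableSet_Ioi (fun x hx => hx.1)]
  · exact setIntegral_congr_fun measurableSet_Ioc (fun x hx => gK_integrand m s x hx)
  · intro x hx
    have : 1 < x := by
      by_contra hc
      exact hx.2 ⟨hx.1, not_lt.1 hc⟩
    simp [gK_zero m hm x this.le]

lemma hK_bound (N : ℕ) (s : ℂ) (hs : 0 ≤ s.re) :
    ‖hK (2 * N + 1) s‖ ≤ ((2 * N + 1).factorial : ℝ) * ((1 + s.im ^ 2) ^ (N + 1))⁻¹ := by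
  unfold hK
  rw [norm_div, norm_prod, Complex.norm_natCast, div_eq_mul_inv]
  have h1 : √(1 + s.im ^ 2) ^ (2 * N + 1 + 1) ≤
      ∏ j ∈ Finset.range (2 * N + 1 + 1), ‖s + 2 + (j : ℂ)‖ := by
    calc √(1 + s.im ^ 2) ^ (2 * N + 1 + 1)
        = ∏ j ∈ Finset.range (2 * N + 1 + 1), √(1 + s.im ^ 2) := by simp
      _ ≤ ∏ j ∈ Finset.range (2 * N + 1 + 1), ‖s + 2 + (j : ℂ)‖ := by
        refine Finset.prod_le_prod (fun _ _ => Real.sqrt_nonneg _) (fun j _ => ?_)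
        apply Real.sqrt_le_iff.2 ⟨norm_nonneg _, ?_⟩
        rw [Complex.sq_norm, Complex.normSq_apply]
        have hj : (0:ℝ) ≤ j := Nat.cast_nonneg j
        simp
        nlinarith
  have h2 : √(1 + s.im ^ 2) ^ (2 * N + 1 + 1) = (1 + s.im ^ 2) ^ (N + 1) := by
    rw [show 2 * N + 1 + 1 = 2 * (N + 1) by ring, pow_mul, Real.sq_sqrt (by positivity)]
  rw [h2] at h1
  gcongr

lemma hK_contAt (m : ℕ) (s : ℂ) (hs : 0 ≤ s.re) : ContinuousAt (hK m) s := by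
  unfold hK
  refine ContinuousAt.div (by fun_prop) (by fun_prop) ?_
  rw [Finset.prod_ne_zero_iff]
  intro j _ h
  have := congrArg Complex.re h
  have hj : (0:ℝ) ≤ j := Nat.cast_nonneg j
  simp at this
  linarith

lemma line_cont (σ : ℝ) : Continuous (fun t : ℝ => (σ : ℂ) + t * Complex.I) := by fun_prop

lemma hK_line_cont (m : ℕ) (σ : ℝ) (hs : 0 ≤ σ) :
    Continuous (fun t : ℝ => hK m (σ + t * Complex.I)) := by
  rw [continuous_iff_continuousAt]
  intro t
  exact ContinuousAt.comp (g := hK m) (hK_contAt m _ (by simpa)) (line_cont σ).continuousAt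

lemma hK_line_int (N : ℕ) (σ : ℝ) (hs : 0 ≤ σ) :
    Integrable (fun t : ℝ => hK (2 * N + 1) (σ + t * Complex.I)) := by
  refine Integrable.mono' (integrable_inv_one_add_sq.const_mul ((2 * N + 1).factorial : ℝ))
    (hK_line_cont _ σ hs).aestronglyMeasurable (Eventually.of_forall fun t => ?_)
  refine (hK_bound N _ (by simpa)).trans ?_
  have h : (σ + t * Complex.I : ℂ).im = t := by simp
  rw [h]
  gcongr
  exact le_self_pow₀ (by nlinarith [sq_nonneg t]) (by omega)

/-- Mellin inversion for the kernel. -/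
lemma gK_inv (N : ℕ) (σ : ℝ) (hσ : 0 < σ) (x : ℝ) (hx : 0 < x) :
    ((gK (2 * N + 1) x : ℝ) : ℂ) = (1 / (2 * π) : ℝ) •
      ∫ t : ℝ, (x : ℂ) ^ (-(σ + t * Complex.I)) * hK (2 * N + 1) (σ + t * Complex.I) := by
  have hm : 2 * N + 1 ≠ 0 := by omega
  have hv : ∀ t : ℝ, mellin (fun x => ((gK (2 * N + 1) x : ℝ) : ℂ)) (σ + t * Complex.I) =
      hK (2 * N + 1) (σ + t * Complex.I) := fun t => gK_mellin _ hm _ (by simpa)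
  have h := mellinInv_mellin_eq σ (fun x => ((gK (2 * N + 1) x : ℝ) : ℂ)) hx
    (gK_mellinConv _ hm _ (by simpa)) (by
      unfold Complex.VerticalIntegrable
      simp_rw [hv]
      exact hK_line_int N σ hσ.le)
    (Complex.continuous_ofReal.comp (gK_cont _)).continuousAt
  rw [← h]
  unfold mellinInv
  simp_rw [hv, smul_eq_mul]

lemma div_cpow_aux (x X : ℝ) (hx : 0 < x) (hX : 0 < X) (s : ℂ) :
    ((x / X : ℝ) : ℂ) ^ (-s) = (x : ℂ) ^ (-s) * (X : ℂ) ^ s := by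
  have h1 : (x : ℂ) ≠ 0 := by exact_mod_cast hx.ne'
  have h2 : (X : ℂ) ≠ 0 := by exact_mod_cast hX.ne'
  have h3 : ((x / X : ℝ) : ℂ) ≠ 0 := by exact_mod_cast (div_pos hx hX).ne'
  rw [Complex.cpow_def_of_ne_zero h1, Complex.cpow_def_of_ne_zero h2,
    Complex.cpow_def_of_ne_zero h3, ← Complex.exp_add, ← Complex.ofReal_log hx.le,
    ← Complex.ofReal_log hX.le, ← Complex.ofReal_log (div_pos hx hX).le,
    Real.log_div hx.ne' hX.ne']
  push_cast
  ring_nf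

lemma norm_cpow_line (X σ t : ℝ) (hX : 0 < X) :
    ‖(X : ℂ) ^ ((σ : ℂ) + t * Complex.I)‖ = X ^ σ := by
  rw [Complex.norm_cpow_eq_rpow_re_of_pos hX]; simp

lemma norm_cpow_line_neg (X σ t : ℝ) (hX : 0 < X) :
    ‖(X : ℂ) ^ (-((σ : ℂ) + t * Complex.I))‖ = X ^ (-σ) := by
  rw [Complex.norm_cpow_eq_rpow_re_of_pos hX]; simp

lemma cpow_line_cont (X σ : ℝ) (hX : 0 < X) :
    Continuous (fun t : ℝ => (X : ℂ) ^ ((σ : ℂ) + t * Complex.I)) := by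
  refine Continuous.const_cpow (line_cont σ) (Or.inl (by exact_mod_cast hX.ne'))

lemma XhK_int (N : ℕ) (σ X : ℝ) (hσ : 0 ≤ σ) (hX : 0 < X) :
    Integrable (fun t : ℝ => (X : ℂ) ^ ((σ : ℂ) + t * Complex.I) *
      hK (2 * N + 1) (σ + t * Complex.I)) :=
  (hK_line_int N σ hσ).bdd_mul (c := X ^ σ) (cpow_line_cont X σ hX).aestronglyMeasurable
    (Eventually.of_forall fun t => (norm_cpow_line X σ t hX).le)

lemma sum_id (N : ℕ) (b : ℕ → ℝ) (ρ : ℝ) (hρ : 0 < ρ) (Dc : ℂ → ℂ)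
    (hD : ∀ s : ℂ, ρ < s.re →
      HasSum (fun k : ℕ => (b (k + 1) : ℂ) * ((k + 1 : ℕ) : ℂ) ^ (-s)) (Dc s))
    (σ : ℝ) (hσ : ρ < σ) (X : ℝ) (hX : 0 < X) :
    HasSum (fun k : ℕ => ((b (k + 1) * gK (2 * N + 1) (((k : ℝ) + 1) / X) : ℝ) : ℂ))
      ((1 / (2 * π) : ℝ) • ∫ t : ℝ, Dc (σ + t * Complex.I) *
        ((X : ℂ) ^ ((σ : ℂ) + t * Complex.I) * hK (2 * N + 1) (σ + t * Complex.I))) := by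
  have hσ0 : 0 < σ := hρ.trans hσ
  have hint := XhK_int N σ X hσ0.le hX
  set H : ℝ → ℂ := fun t => (X : ℂ) ^ ((σ : ℂ) + t * Complex.I) *
    hK (2 * N + 1) (σ + t * Complex.I) with hH
  set F : ℕ → ℝ → ℂ := fun k t =>
    (b (k + 1) : ℂ) * ((k + 1 : ℕ) : ℂ) ^ (-((σ : ℂ) + t * Complex.I)) * H t with hF
  have hcont : ∀ k : ℕ, Continuous fun t : ℝ =>
      (b (k + 1) : ℂ) * ((k + 1 : ℕ) : ℂ) ^ (-((σ : ℂ) + t * Complex.I)) := fun k =>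
    continuous_const.mul (Continuous.const_cpow (line_cont σ).neg
      (Or.inl (by exact_mod_cast Nat.succ_ne_zero k)))
  have hnorm : ∀ (k : ℕ) (t : ℝ),
      ‖(b (k + 1) : ℂ) * ((k + 1 : ℕ) : ℂ) ^ (-((σ : ℂ) + t * Complex.I))‖ =
      ‖(b (k + 1) : ℂ) * ((k + 1 : ℕ) : ℂ) ^ (-(σ : ℂ))‖ := by
    intro k t
    have hk : (0:ℝ) < ((k + 1 : ℕ) : ℝ) := by positivity
    have e : ((k + 1 : ℕ) : ℂ) = (((k + 1 : ℕ) : ℝ) : ℂ) := by push_cast; rfl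
    rw [norm_mul, norm_mul, e, norm_cpow_line_neg _ _ _ hk,
      Complex.norm_cpow_eq_rpow_re_of_pos hk]
    simp
  have hFint : ∀ k, Integrable (F k) := fun k =>
    hint.bdd_mul (hcont k).aestronglyMeasurable (Eventually.of_forall fun t => (hnorm k t).le)
  have hsum : Summable fun k => ∫ t, ‖F k t‖ := by
    have h1 := (hD (σ : ℂ) (by simpa)).summable.norm
    have : ∀ k, ∫ t, ‖F k t‖ =
        ‖(b (k + 1) : ℂ) * ((k + 1 : ℕ) : ℂ) ^ (-(σ : ℂ))‖ * ∫ t, ‖H t‖ := by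
      intro k
      rw [← integral_const_mul]
      refine integral_congr_ae (Eventually.of_forall fun t => ?_)
      simp only [hF]
      rw [norm_mul, hnorm]
    simp_rw [this]
    exact h1.mul_right _
  have key := hasSum_integral_of_summable_integral_norm hFint hsum
  have e1 : ∀ t, ∑' k, F k t = Dc (σ + t * Complex.I) * H t := fun t =>
    ((hD (σ + t * Complex.I) (by simpa)).mul_right (H t)).tsum_eq
  simp_rw [e1] at key
  have e2 : ∀ k : ℕ, ((b (k + 1) * gK (2 * N + 1) (((k : ℝ) + 1) / X) : ℝ) : ℂ) =
      (1 / (2 * π) : ℝ) • ∫ t, F k t := by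
    intro k
    have hk : (0:ℝ) < (k : ℝ) + 1 := by positivity
    rw [Complex.ofReal_mul, gK_inv N σ hσ0 _ (div_pos hk hX), mul_smul_comm, ← integral_const_mul]
    congr 2
    ext t
    simp only [hF, hH]
    rw [div_cpow_aux _ _ hk hX]
    push_cast
    ring
  simp_rw [e2]
  exact key.const_smul _

lemma int_id (N : ℕ) (ρ : ℝ) (hρ : 0 < ρ)
    (σ : ℝ) (hσ : ρ < σ) (X : ℝ) (hX : 0 < X) :
    ((∫ x in Set.Ioi (1:ℝ), x ^ (ρ - 1) * gK (2 * N + 1) (x / X) : ℝ) : ℂ) =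
      ((1 / (2 * π) : ℝ) • ∫ t : ℝ, 1 / ((σ : ℂ) + t * Complex.I - ρ) *
        ((X : ℂ) ^ ((σ : ℂ) + t * Complex.I) * hK (2 * N + 1) (σ + t * Complex.I))) := by
  have hσ0 : 0 < σ := hρ.trans hσ
  have hint := XhK_int N σ X hσ0.le hX
  have hHm : Continuous (fun t : ℝ => (X : ℂ) ^ ((σ : ℂ) + t * Complex.I) *
    hK (2 * N + 1) (σ + t * Complex.I)) := (cpow_line_cont X σ hX).mul (hK_line_cont _ σ hσ0.le)
  set H : ℝ → ℂ := fun t => (X : ℂ) ^ ((σ : ℂ) + t * Complex.I) *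
    hK (2 * N + 1) (σ + t * Complex.I) with hH
  set f : ℝ → ℝ → ℂ := fun x t => (x : ℂ) ^ ((ρ : ℂ) - 1 - (σ + t * Complex.I)) * H t with hf
  have hfi : Integrable (Function.uncurry f)
      ((volume.restrict (Set.Ioi (1:ℝ))).prod volume) := by
    have hp : Integrable (fun x : ℝ => x ^ (ρ - 1 - σ)) (volume.restrict (Set.Ioi (1:ℝ))) :=
      integrableOn_Ioi_rpow_of_lt (by linarith) one_pos
    refine Integrable.mono (hp.mul_prod hint.norm) ?_ ?_
    · refine Measurable.aestronglyMeasurable ?_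
      simp only [hf, Function.uncurry_def]
      refine Measurable.mul ?_ (hHm.measurable.comp measurable_snd)
      refine Measurable.pow ?_ ?_
      · exact Complex.measurable_ofReal.comp measurable_fst
      · exact Continuous.measurable (by fun_prop)
    · rw [Measure.restrict_prod_eq_prod_univ]
      refine (ae_restrict_iff' (measurableSet_Ioi.prod MeasurableSet.univ)).2
        (Eventually.of_forall fun z hz => ?_)
      have hz1 : (0:ℝ) < z.1 := lt_trans one_pos hz.1
      change ‖(z.1 : ℂ) ^ ((ρ : ℂ) - 1 - (σ + z.2 * Complex.I)) * H z.2‖ ≤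
        ‖z.1 ^ (ρ - 1 - σ) * ‖H z.2‖‖
      generalize H z.2 = w
      rw [norm_mul, norm_mul, norm_norm, Complex.norm_cpow_eq_rpow_re_of_pos hz1,
        Real.norm_of_nonneg (Real.rpow_nonneg hz1.le _)]
      simp
  have hswap := integral_integral_swap hfi
  have e1 : ∀ t, ∫ x in Set.Ioi (1:ℝ), f x t = 1 / ((σ : ℂ) + t * Complex.I - ρ) * H t := by
    intro t
    simp only [hf]
    rw [integral_mul_const, integral_Ioi_cpow_of_lt (by simp; linarith) one_pos]
    congr 1
    rw [Complex.ofReal_one, Complex.one_cpow, neg_div, ← div_neg]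
    congr 1
    ring
  simp_rw [e1] at hswap
  rw [← hswap, ← integral_smul, ← integral_complex_ofReal]
  refine setIntegral_congr_fun measurableSet_Ioi fun x hx => ?_
  have hx0 : (0:ℝ) < x := lt_trans one_pos hx
  have hxc : (x : ℂ) ≠ 0 := by exact_mod_cast hx0.ne'
  rw [Complex.ofReal_mul, gK_inv N σ hσ0 _ (div_pos hx0 hX), mul_smul_comm, ← integral_const_mul]
  congr 2
  ext t
  simp only [hf, hH]
  rw [div_cpow_aux _ _ hx0 hX, Complex.ofReal_cpow hx0.le, sub_eq_add_neg ((ρ : ℂ) - 1),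
    Complex.cpow_add _ _ hxc]
  push_cast
  ring

lemma phi_bound (ρ C₀ A C₁ : ℝ) (Dc φ : ℂ → ℂ) (hρ : 0 < ρ) (hC₀ : 0 < C₀) (hA : 0 < A)
    (hφd : ∀ s : ℂ, -C₀ ≤ s.re → DifferentiableAt ℂ φ s)
    (hφ : ∀ s : ℂ, -C₀ ≤ s.re → s ≠ (ρ : ℂ) → Dc s = (A : ℂ) / (s - (ρ : ℂ)) + φ s)
    (h2 : M2 C₀ C₁ Dc) :
    ∃ (N : ℕ) (K : ℝ), 0 ≤ K ∧ ∀ s : ℂ, ρ ≤ s.re → s.re ≤ ρ + 1 →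
      ‖φ s‖ ≤ K * (1 + s.im ^ 2) ^ N := by
  obtain ⟨hC₁, K, y₀, hK⟩ := h2
  have hcomp : IsCompact (Set.Icc ρ (ρ + 1) ×ℂ Set.Icc (-(max y₀ 1)) (max y₀ 1)) :=
    isCompact_Icc.reProdIm isCompact_Icc
  have hcont : ContinuousOn φ (Set.Icc ρ (ρ + 1) ×ℂ Set.Icc (-(max y₀ 1)) (max y₀ 1)) := by
    intro s hs
    have h := (Complex.mem_reProdIm.1 hs).1.1
    exact (hφd s (by linarith)).continuousAt.continuousWithinAt
  obtain ⟨M, hM⟩ := hcomp.exists_bound_of_continuousOn hcont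
  refine ⟨⌈C₁⌉₊, |K| + A + |M|, by positivity, fun s h1 h2 => ?_⟩
  have hone : (1:ℝ) ≤ 1 + s.im ^ 2 := by nlinarith [sq_nonneg s.im]
  have hpow : (1:ℝ) ≤ (1 + s.im ^ 2) ^ ⌈C₁⌉₊ := one_le_pow₀ hone
  rcases le_or_gt |s.im| (max y₀ 1) with h | h
  · have hb := hM s (Complex.mem_reProdIm.2 ⟨⟨h1, h2⟩, abs_le.1 h⟩)
    calc ‖φ s‖ ≤ |M| := hb.trans (le_abs_self M)
      _ ≤ (|K| + A + |M|) * 1 := by nlinarith [abs_nonneg K]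
      _ ≤ _ := by gcongr
  · have hy : y₀ ≤ |s.im| := (le_max_left _ _).trans h.le
    have hy1 : 1 ≤ |s.im| := (le_max_right _ _).trans h.le
    have hne : s ≠ (ρ : ℂ) := by
      rintro rfl
      simp at hy1
      linarith
    have hsub : 1 ≤ ‖s - (ρ : ℂ)‖ := by
      refine hy1.trans ?_
      have := Complex.abs_im_le_norm (s - (ρ : ℂ))
      simpa using this
    have e : φ s = Dc s - (A : ℂ) / (s - (ρ : ℂ)) := by
      rw [hφ s (by linarith) hne]; ring
    have hb1 := hK s (by linarith) hy
    have hle : |s.im| ≤ 1 + s.im ^ 2 := by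
      rw [← sq_abs s.im]; nlinarith [sq_nonneg (|s.im|)]
    have hb2 : |s.im| ^ C₁ ≤ (1 + s.im ^ 2) ^ ⌈C₁⌉₊ := by
      calc |s.im| ^ C₁ ≤ (1 + s.im ^ 2) ^ C₁ := Real.rpow_le_rpow (abs_nonneg _) hle hC₁.le
        _ ≤ (1 + s.im ^ 2) ^ ((⌈C₁⌉₊ : ℕ) : ℝ) :=
          Real.rpow_le_rpow_of_exponent_le hone (Nat.le_ceil _)
        _ = _ := Real.rpow_natCast _ _
    have hb3 : ‖(A : ℂ) / (s - (ρ : ℂ))‖ ≤ A := by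
      rw [norm_div, Complex.norm_real, Real.norm_of_nonneg hA.le]
      exact div_le_self hA.le hsub
    have hb4 : K * |s.im| ^ C₁ ≤ |K| * (1 + s.im ^ 2) ^ ⌈C₁⌉₊ :=
      mul_le_mul (le_abs_self K) hb2 (Real.rpow_nonneg (abs_nonneg _) _) (abs_nonneg K)
    rw [e]
    refine (norm_sub_le _ _).trans ?_
    nlinarith [abs_nonneg M]

lemma phiH_bound (N : ℕ) (K ρ : ℝ) (hρ : 0 < ρ) (hKn : 0 ≤ K) (φ : ℂ → ℂ)
    (hb : ∀ s : ℂ, ρ ≤ s.re → s.re ≤ ρ + 1 → ‖φ s‖ ≤ K * (1 + s.im ^ 2) ^ N)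
    (X : ℝ) (hX : 1 ≤ X) (σ : ℝ) (h1 : ρ ≤ σ) (h2 : σ ≤ ρ + 1) (t : ℝ) :
    ‖φ (σ + t * Complex.I) * ((X : ℂ) ^ ((σ : ℂ) + t * Complex.I) *
      hK (2 * N + 1) (σ + t * Complex.I))‖ ≤
      K * X ^ (ρ + 1) * ((2 * N + 1).factorial : ℝ) * (1 + t ^ 2)⁻¹ := by
  have hX0 : 0 < X := by linarith
  rw [norm_mul, norm_mul, norm_cpow_line X σ t hX0]
  have a1 := hb (σ + t * Complex.I) (by simpa) (by simpa)
  have a2 := hK_bound N (σ + t * Complex.I) (by simp; linarith)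
  have a3 : X ^ σ ≤ X ^ (ρ + 1) := Real.rpow_le_rpow_of_exponent_le hX h2
  have him : ((σ : ℂ) + t * Complex.I).im = t := by simp
  rw [him] at a1 a2
  have hp : 0 < 1 + t ^ 2 := by positivity
  calc _ ≤ (K * (1 + t ^ 2) ^ N) * (X ^ (ρ + 1) *
        (((2 * N + 1).factorial : ℝ) * ((1 + t ^ 2) ^ (N + 1))⁻¹)) := by gcongr
    _ = _ := by
      rw [pow_succ]
      field_simp
      ring

lemma phi_line_cont (ρ C₀ : ℝ) (φ : ℂ → ℂ) (hρ : 0 < ρ) (hC₀ : 0 < C₀)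
    (hφd : ∀ s : ℂ, -C₀ ≤ s.re → DifferentiableAt ℂ φ s) (σ : ℝ) (hσ : ρ ≤ σ) :
    Continuous (fun t : ℝ => φ (σ + t * Complex.I)) := by
  rw [continuous_iff_continuousAt]
  intro t
  exact ContinuousAt.comp (g := φ) (hφd _ (by simp; linarith)).continuousAt
    (line_cont σ).continuousAt

lemma diff_id (N : ℕ) (K : ℝ) (b : ℕ → ℝ) (ρ C₀ A : ℝ) (Dc φ : ℂ → ℂ) (hρ : 0 < ρ)
    (hC₀ : 0 < C₀) (hKn : 0 ≤ K)
    (hD : ∀ s : ℂ, ρ < s.re →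
      HasSum (fun k : ℕ => (b (k + 1) : ℂ) * ((k + 1 : ℕ) : ℂ) ^ (-s)) (Dc s))
    (hφd : ∀ s : ℂ, -C₀ ≤ s.re → DifferentiableAt ℂ φ s)
    (hφ : ∀ s : ℂ, -C₀ ≤ s.re → s ≠ (ρ : ℂ) → Dc s = (A : ℂ) / (s - (ρ : ℂ)) + φ s)
    (hb : ∀ s : ℂ, ρ ≤ s.re → s.re ≤ ρ + 1 → ‖φ s‖ ≤ K * (1 + s.im ^ 2) ^ N)
    (X : ℝ) (hX : 1 ≤ X) :
    ((∑' k : ℕ, b (k + 1) * gK (2 * N + 1) (((k : ℝ) + 1) / X) : ℝ) : ℂ) -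
      A * ((∫ x in Set.Ioi (1:ℝ), x ^ (ρ - 1) * gK (2 * N + 1) (x / X) : ℝ) : ℂ) =
    (1 / (2 * π) : ℝ) • ∫ t : ℝ, φ (ρ + t * Complex.I) * ((X : ℂ) ^ ((ρ : ℂ) + t * Complex.I) *
      hK (2 * N + 1) (ρ + t * Complex.I)) := by
  have hX0 : 0 < X := by linarith
  have hmeas : ∀ σ : ℝ, ρ ≤ σ → AEStronglyMeasurable (fun t : ℝ => φ (σ + t * Complex.I) *
      ((X : ℂ) ^ ((σ : ℂ) + t * Complex.I) * hK (2 * N + 1) (σ + t * Complex.I))) volume :=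
    fun σ hσ => ((phi_line_cont ρ C₀ φ hρ hC₀ hφd σ hσ).mul ((cpow_line_cont X σ hX0).mul
      (hK_line_cont _ σ (hρ.le.trans hσ)))).aestronglyMeasurable
  have hbi : Integrable fun t : ℝ =>
      K * X ^ (ρ + 1) * ((2 * N + 1).factorial : ℝ) * (1 + t ^ 2)⁻¹ :=
    integrable_inv_one_add_sq.const_mul _
  -- identity for `σ > ρ`
  have hid : ∀ σ : ℝ, ρ < σ → σ ≤ ρ + 1 →
      (1 / (2 * π) : ℝ) • ∫ t : ℝ, φ (σ + t * Complex.I) *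
        ((X : ℂ) ^ ((σ : ℂ) + t * Complex.I) * hK (2 * N + 1) (σ + t * Complex.I)) =
      ((∑' k : ℕ, b (k + 1) * gK (2 * N + 1) (((k : ℝ) + 1) / X) : ℝ) : ℂ) -
      A * ((∫ x in Set.Ioi (1:ℝ), x ^ (ρ - 1) * gK (2 * N + 1) (x / X) : ℝ) : ℂ) := by
    intro σ h1 h2
    have hσ0 : 0 < σ := hρ.trans h1
    have hs := (sum_id N b ρ hρ Dc hD σ h1 X hX0).tsum_eq
    rw [← Complex.ofReal_tsum] at hs
    have hne : ∀ t : ℝ, (σ : ℂ) + t * Complex.I - ρ ≠ 0 := by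
      intro t h
      have := congrArg Complex.re h
      simp at this
      linarith
    have hint1 : Integrable (fun t : ℝ => φ (σ + t * Complex.I) *
        ((X : ℂ) ^ ((σ : ℂ) + t * Complex.I) * hK (2 * N + 1) (σ + t * Complex.I))) :=
      hbi.mono' (hmeas σ h1.le) (Eventually.of_forall fun t =>
        phiH_bound N K ρ hρ hKn φ hb X hX σ h1.le h2 t)
    have hint2 : Integrable (fun t : ℝ => 1 / ((σ : ℂ) + t * Complex.I - ρ) *
        ((X : ℂ) ^ ((σ : ℂ) + t * Complex.I) * hK (2 * N + 1) (σ + t * Complex.I))) := by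
      refine (XhK_int N σ X hσ0.le hX0).bdd_mul (c := 1 / (σ - ρ)) ?_
        (Eventually.of_forall fun t => ?_)
      · exact (Continuous.div continuous_const (by fun_prop) hne).aestronglyMeasurable
      · rw [norm_div, norm_one]
        have hpos : 0 < σ - ρ := by linarith
        have := Complex.re_le_norm ((σ : ℂ) + t * Complex.I - ρ)
        simp only [Complex.sub_re, Complex.add_re, Complex.ofReal_re, Complex.mul_re, Complex.I_re,
          Complex.ofReal_im, Complex.I_im] at this
        gcongr
        linarith
    rw [hs, int_id N ρ hρ σ h1 X hX0, mul_smul_comm, ← smul_sub, ← integral_const_mul]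
    congr 1
    rw [eq_sub_iff_add_eq, ← integral_add hint1 (hint2.const_mul _)]
    congr 1
    ext t
    have hne' : (σ : ℂ) + t * Complex.I ≠ ρ := fun h => hne t (sub_eq_zero.2 h)
    rw [hφ _ (by simp; linarith) hne']
    ring
  have hlim : Tendsto (fun σ : ℝ => ∫ t : ℝ, φ (σ + t * Complex.I) *
        ((X : ℂ) ^ ((σ : ℂ) + t * Complex.I) * hK (2 * N + 1) (σ + t * Complex.I)))
      (𝓝[>] ρ) (𝓝 (∫ t : ℝ, φ (ρ + t * Complex.I) *
        ((X : ℂ) ^ ((ρ : ℂ) + t * Complex.I) * hK (2 * N + 1) (ρ + t * Complex.I)))) := by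
    have hev : ∀ᶠ σ in 𝓝[>] ρ, ρ < σ ∧ σ < ρ + 1 := Ioo_mem_nhdsGT (by linarith)
    refine tendsto_integral_filter_of_dominated_convergence _
      (hev.mono fun σ h => hmeas σ h.1.le)
      (hev.mono fun σ h => Eventually.of_forall fun t =>
        phiH_bound N K ρ hρ hKn φ hb X hX σ h.1.le h.2.le t) hbi
      (Eventually.of_forall fun t => ?_)
    have hl : Tendsto (fun σ : ℝ => (σ : ℂ) + t * Complex.I) (𝓝[>] ρ)
        (𝓝 ((ρ : ℂ) + t * Complex.I)) := by
      refine Tendsto.mono_left ?_ nhdsWithin_le_nhds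
      exact (Continuous.tendsto (by fun_prop) ρ)
    have c1 : ContinuousAt (fun s : ℂ => φ s * ((X : ℂ) ^ s * hK (2 * N + 1) s))
        ((ρ : ℂ) + t * Complex.I) := by
      refine (hφd _ (by simp; linarith)).continuousAt.mul (ContinuousAt.mul ?_
        (hK_contAt _ _ (by simp; linarith)))
      exact (continuous_id.const_cpow (Or.inl (by exact_mod_cast hX0.ne'))).continuousAt
    exact c1.tendsto.comp hl
  have hlim2 := hlim.const_smul (1 / (2 * π) : ℝ)
  refine tendsto_nhds_unique (Tendsto.congr' ?_ tendsto_const_nhds) hlim2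
  filter_upwards [Ioo_mem_nhdsGT (show ρ < ρ + 1 by linarith)] with σ h
  exact (hid σ h.1 h.2.le).symm

lemma I_int (m : ℕ) (hm : m ≠ 0) (ρ X : ℝ) (hX : 0 < X) :
    IntegrableOn (fun x : ℝ => x ^ (ρ - 1) * gK m (x / X)) (Set.Ioi 1) := by
  have h1 : IntegrableOn (fun x : ℝ => x ^ (ρ - 1) * gK m (x / X)) (Set.Icc 1 X) := by
    refine ContinuousOn.integrableOn_Icc ?_
    refine ContinuousOn.mul ?_ ((gK_cont m).comp (continuous_id.div_const X)).continuousOn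
    exact continuousOn_id.rpow_const fun x hx => Or.inl (by
      have := hx.1
      simp only [id]; linarith)
  refine h1.of_forall_sdiff_eq_zero measurableSet_Ioi fun x hx => ?_
  have hx1 : (1:ℝ) < x := hx.1
  have : X < x := by
    by_contra hc
    exact hx.2 ⟨hx1.le, not_lt.1 hc⟩
  rw [gK_zero m hm _ ((one_le_div hX).2 this.le), mul_zero]

lemma I_lower (m : ℕ) (hm : m ≠ 0) (ρ : ℝ) (hρ : 0 < ρ) (X : ℝ) (hX : 4 ≤ X) :
    ((1 / 4 : ℝ) ^ ρ * (1 / 32) * (1 / 2) ^ m) * X ^ ρ ≤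
      ∫ x in Set.Ioi (1:ℝ), x ^ (ρ - 1) * gK m (x / X) := by
  have hX0 : 0 < X := by linarith
  have hint := I_int m hm ρ X hX0
  have hsub : Set.Ioc (X / 4) (X / 2) ⊆ Set.Ioi (1:ℝ) := fun x hx => by
    have := hx.1
    simp only [Set.mem_Ioi]; linarith
  have h1 : ∫ x in Set.Ioc (X / 4) (X / 2), x ^ (ρ - 1) * gK m (x / X) ≤
      ∫ x in Set.Ioi (1:ℝ), x ^ (ρ - 1) * gK m (x / X) := by
    refine setIntegral_mono_set hint ?_ hsub.eventuallyLE
    refine (ae_restrict_iff' measurableSet_Ioi).2 (Eventually.of_forall fun x hx => ?_)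
    have : (0:ℝ) < x := lt_trans one_pos hx
    exact mul_nonneg (Real.rpow_nonneg this.le _) (gK_nonneg _ _)
  have h2 : ∫ x in Set.Ioc (X / 4) (X / 2), (X / 4) ^ ρ / (X / 2) * ((1 / 16) * (1 / 2) ^ m) ≤
      ∫ x in Set.Ioc (X / 4) (X / 2), x ^ (ρ - 1) * gK m (x / X) := by
    refine setIntegral_mono_on (integrableOn_const (by simp)) (hint.mono_set hsub)
      measurableSet_Ioc fun x hx => ?_
    have hx0 : 0 < x := by linarith [hx.1]
    have q1 : 1 / 4 ≤ x / X := by rw [div_le_div_iff₀ (by norm_num) hX0]; linarith [hx.1]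
    have q2 : x / X ≤ 1 / 2 := by rw [div_le_div_iff₀ hX0 (by norm_num)]; linarith [hx.2]
    have q3 : (1 / 16) * (1 / 2) ^ m ≤ gK m (x / X) := by
      unfold gK
      have : (1:ℝ) / 2 ≤ max (1 - x / X) 0 := le_max_of_le_left (by linarith)
      have q4 : (1:ℝ) / 16 ≤ (x / X) ^ 2 := by nlinarith
      gcongr
    have q5 : (X / 4) ^ ρ / (X / 2) ≤ x ^ (ρ - 1) := by
      rw [Real.rpow_sub_one hx0.ne']
      have := hx.1.le
      have := hx.2
      gcongr
    exact mul_le_mul q5 q3 (by positivity) (by positivity)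
  have h3 : ∫ x in Set.Ioc (X / 4) (X / 2), (X / 4) ^ ρ / (X / 2) * ((1 / 16) * (1 / 2) ^ m) =
      ((1 / 4 : ℝ) ^ ρ * (1 / 32) * (1 / 2) ^ m) * X ^ ρ := by
    rw [setIntegral_const, Measure.real, Real.volume_Ioc, ENNReal.toReal_ofReal (by linarith),
      show X / 4 = (1 / 4) * X by ring, Real.mul_rpow (by norm_num) hX0.le, smul_eq_mul]
    field_simp
    ring
  linarith

lemma main_lower (b : ℕ → ℝ) (ρ C₀ A C₁ : ℝ) (Dc : ℂ → ℂ)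
    (h1 : M1 b ρ C₀ A Dc) (h2 : M2 C₀ C₁ Dc) :
    ∃ (N : ℕ) (c : ℝ), 0 < c ∧ ∀ᶠ X : ℝ in atTop,
      c * X ^ ρ ≤ ∑' k : ℕ, b (k + 1) * gK (2 * N + 1) (((k : ℝ) + 1) / X) := by
  obtain ⟨hρ, hC₀, -, hA, hD, -, φ, hφd, hφ⟩ := h1
  obtain ⟨N, K, hKn, hb⟩ := phi_bound ρ C₀ A C₁ Dc φ hρ hC₀ hA hφd hφ h2
  set c0 : ℝ := (1 / 4 : ℝ) ^ ρ * (1 / 32) * (1 / 2) ^ (2 * N + 1) with hc0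
  have hc0pos : 0 < c0 := by positivity
  refine ⟨N, A * c0 / 2, by positivity, ?_⟩
  set Φ : ℝ → ℂ := fun t => φ (ρ + t * Complex.I) * hK (2 * N + 1) (ρ + t * Complex.I) with hΦ
  have hRL := Real.tendsto_integral_exp_smul_cocompact Φ
  have hw : Tendsto (fun X : ℝ => -Real.log X / (2 * π)) atTop (cocompact ℝ) := by
    have : Tendsto (fun X : ℝ => -Real.log X / (2 * π)) atTop atBot :=
      (tendsto_neg_atTop_atBot.comp Real.tendsto_log_atTop).atBot_div_const (by positivity)
    exact this.mono_right atBot_le_cocompact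
  have hR := (hRL.comp hw).norm
  rw [norm_zero] at hR
  have hsmall := hR.eventually (gt_mem_nhds (show (0:ℝ) < A * c0 / 2 * (2 * π) by positivity))
  filter_upwards [hsmall, eventually_ge_atTop 4] with X hs hX4
  have hX0 : 0 < X := by linarith
  have hXc : (X : ℂ) ≠ 0 := by exact_mod_cast hX0.ne'
  have hid := diff_id N K b ρ C₀ A Dc φ hρ hC₀ hKn hD hφd hφ hb X (by linarith)
  have hI := I_lower (2 * N + 1) (by omega) ρ hρ X hX4
  rw [← hc0] at hI
  set S := ∑' k : ℕ, b (k + 1) * gK (2 * N + 1) (((k : ℝ) + 1) / X)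
  set J := ∫ x in Set.Ioi (1:ℝ), x ^ (ρ - 1) * gK (2 * N + 1) (x / X)
  have e : (∫ t : ℝ, φ (ρ + t * Complex.I) * ((X : ℂ) ^ ((ρ : ℂ) + t * Complex.I) *
      hK (2 * N + 1) (ρ + t * Complex.I))) =
      (X : ℂ) ^ (ρ : ℂ) * ∫ t : ℝ, Real.fourierChar (-(t * (-Real.log X / (2 * π)))) • Φ t := by
    rw [← integral_const_mul]
    congr 1
    ext t
    rw [Circle.smul_def, Real.fourierChar_apply, Complex.cpow_add _ _ hXc,
      Complex.cpow_def_of_ne_zero hXc (t * Complex.I), ← Complex.ofReal_log hX0.le, smul_eq_mul]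
    have : ((2 * π * -(t * (-Real.log X / (2 * π))) : ℝ) : ℂ) * Complex.I =
        Real.log X * (t * Complex.I) := by
      have hπ : π ≠ 0 := Real.pi_ne_zero
      rw [show (2 * π * -(t * (-Real.log X / (2 * π))) : ℝ) = Real.log X * t by field_simp]
      push_cast; ring
    rw [this]
    simp only [hΦ]
    ring
  simp only [Function.comp] at hs
  rw [e] at hid
  have hn : |S - A * J| ≤ X ^ ρ * (A * c0 / 2) := by
    have : ‖((S - A * J : ℝ) : ℂ)‖ = |S - A * J| := by rw [Complex.norm_real, Real.norm_eq_abs]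
    rw [← this]
    push_cast
    rw [hid, norm_smul, norm_mul, Complex.norm_cpow_eq_rpow_re_of_pos hX0, Complex.ofReal_re,
      Real.norm_of_nonneg (by positivity)]
    have hXp : 0 < X ^ ρ := Real.rpow_pos_of_pos hX0 _
    rw [div_mul_eq_mul_div, one_mul, div_le_iff₀ (by positivity), mul_assoc]
    exact mul_le_mul_of_nonneg_left hs.le hXp.le
  have := (abs_le.1 hn).1
  nlinarith [mul_le_mul_of_nonneg_left hI hA.le]

lemma b_growth (b : ℕ → ℝ) (hb : ∀ k, 0 ≤ b k) (ρ : ℝ) (Dc : ℂ → ℂ)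
    (hD : ∀ s : ℂ, ρ < s.re →
      HasSum (fun k : ℕ => (b (k + 1) : ℂ) * ((k + 1 : ℕ) : ℂ) ^ (-s)) (Dc s)) :
    ∃ (M : ℕ) (C : ℝ), 0 ≤ C ∧ ∀ k : ℕ, b (k + 1) ≤ C * ((k : ℝ) + 1) ^ M := by
  set M : ℕ := ⌈ρ⌉₊ + 1 with hM
  have hMρ : ρ < (M : ℝ) := by
    have := Nat.le_ceil ρ
    rw [hM]; push_cast; linarith
  have hs := (hD (M : ℂ) (by simpa)).summable.norm
  refine ⟨M, ∑' k : ℕ, ‖(b (k + 1) : ℂ) * ((k + 1 : ℕ) : ℂ) ^ (-(M : ℂ))‖,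
    tsum_nonneg fun k => norm_nonneg _, fun k => ?_⟩
  have h1 := hs.le_tsum k (fun j _ => norm_nonneg _)
  refine le_trans ?_ (mul_le_mul_of_nonneg_right h1 (by positivity))
  have hk : (0:ℝ) < (k : ℝ) + 1 := by positivity
  rw [Complex.cpow_neg, Complex.cpow_natCast, norm_mul, norm_inv, norm_pow, Complex.norm_natCast,
    Complex.norm_real, Real.norm_of_nonneg (hb _)]
  push_cast
  field_simp
  exact le_rfl

lemma b_summable (b : ℕ → ℝ) (hb : ∀ k, 0 ≤ b k) (M : ℕ) (C : ℝ)
    (hC : ∀ k : ℕ, b (k + 1) ≤ C * ((k : ℝ) + 1) ^ M) (r : ℝ) (h0 : 0 < r) (h1 : r < 1) :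
    Summable fun k : ℕ => b (k + 1) * ((k : ℝ) + 1) * r ^ k := by
  have h := summable_pow_mul_geometric_of_norm_lt_one (M + 1) (r := r)
    (by rw [Real.norm_of_nonneg h0.le]; exact h1)
  have h' := ((summable_nat_add_iff 1).2 h).mul_left (C * r⁻¹)
  refine Summable.of_nonneg_of_le (fun k => ?_) (fun k => ?_) h'
  · have := hb (k + 1); positivity
  · have := hC k
    calc b (k + 1) * ((k : ℝ) + 1) * r ^ k ≤ C * ((k : ℝ) + 1) ^ M * ((k : ℝ) + 1) * r ^ k := by
          gcongr
      _ = _ := by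
        push_cast
        field_simp
        ring

lemma Fb_deriv_bound (b : ℕ → ℝ) (hb : ∀ k, 0 ≤ b k) (M : ℕ) (C : ℝ)
    (hC : ∀ k : ℕ, b (k + 1) ≤ C * ((k : ℝ) + 1) ^ M) (R : ℝ) (h0 : 0 < R) (h1 : R < 1) :
    ∃ B : ℝ, ∀ x : ℝ, 0 < x → x < R → Abf b x ≤ B := by
  have hu := (b_summable b hb M C hC R h0 h1).mul_right (1 / (1 - R))
  have h1R : 0 < 1 - R := by linarith
  refine ⟨∑' k : ℕ, b (k + 1) * ((k : ℝ) + 1) * R ^ k * (1 / (1 - R)), fun x hx0 hxR => ?_⟩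
  have habs : ∀ (n : ℕ) (y : ℝ), y ∈ Set.Ioo (-R) R → |y ^ (n + 1)| ≤ R := by
    intro n y hy
    have hy' : |y| ≤ R := (abs_lt.2 ⟨hy.1, hy.2⟩).le
    rw [abs_pow]
    calc |y| ^ (n + 1) ≤ R ^ (n + 1) := by gcongr
      _ ≤ R := pow_le_of_le_one h0.le h1.le (by omega)
  have hpos : ∀ (n : ℕ) (y : ℝ), y ∈ Set.Ioo (-R) R → 1 - R ≤ 1 - y ^ (n + 1) := fun n y hy => by
    have := le_abs_self (y ^ (n + 1))
    linarith [habs n y hy]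
  have hb' : ∀ (n : ℕ) (y : ℝ), y ∈ Set.Ioo (-R) R →
      ‖b (n + 1) * (-(((n + 1 : ℕ) : ℝ) * y ^ n) / (1 - y ^ (n + 1)))‖ ≤
      b (n + 1) * ((n : ℝ) + 1) * R ^ n * (1 / (1 - R)) := by
    intro n y hy
    have hp := hpos n y hy
    have hy' : |y| ≤ R := (abs_lt.2 ⟨hy.1, hy.2⟩).le
    have := hb (n + 1)
    rw [norm_mul, norm_div, norm_neg, norm_mul, norm_pow, Real.norm_natCast,
      Real.norm_of_nonneg (hb _), Real.norm_of_nonneg (h1R.le.trans hp), Real.norm_eq_abs]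
    push_cast
    calc b (n + 1) * ((((n : ℝ) + 1) * |y| ^ n) / (1 - y ^ (n + 1)))
        ≤ b (n + 1) * ((((n : ℝ) + 1) * R ^ n) / (1 - R)) := by gcongr
      _ = _ := by ring
  have hd := hasDerivAt_tsum_of_isPreconnected (𝕜 := ℝ) (F := ℝ)
    (g := fun (n : ℕ) (y : ℝ) => b (n + 1) * Real.log (1 - y ^ (n + 1)))
    (g' := fun (n : ℕ) (y : ℝ) => b (n + 1) * (-(((n + 1 : ℕ) : ℝ) * y ^ n) / (1 - y ^ (n + 1))))
    (t := Set.Ioo (-R) R) (y₀ := 0) (y := x) hu isOpen_Ioo isPreconnected_Ioo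
    (fun n y hy => by
      have hp := hpos n y hy
      refine HasDerivAt.const_mul _ (HasDerivAt.log ?_ (by linarith))
      simpa using (hasDerivAt_pow (n + 1) y).const_sub 1)
    hb' ⟨by linarith, h0⟩ (by simp) ⟨by linarith, hxR⟩
  have hx1 : x < 1 := hxR.trans h1
  have hder : deriv (Fb b) x =
      -∑' n : ℕ, b (n + 1) * (-(((n + 1 : ℕ) : ℝ) * x ^ n) / (1 - x ^ (n + 1))) := hd.neg.deriv
  have hnb : ‖∑' n : ℕ, b (n + 1) * (-(((n + 1 : ℕ) : ℝ) * x ^ n) / (1 - x ^ (n + 1)))‖ ≤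
      ∑' k : ℕ, b (k + 1) * ((k : ℝ) + 1) * R ^ k * (1 / (1 - R)) :=
    tsum_of_norm_bounded hu.hasSum fun n => hb' n x ⟨by linarith, hxR⟩
  unfold Abf
  have h3 : |deriv (Fb b) x| ≤ ∑' k : ℕ, b (k + 1) * ((k : ℝ) + 1) * R ^ k * (1 / (1 - R)) := by
    rw [hder, abs_neg]; exact hnb
  have h4 := le_abs_self (deriv (Fb b) x)
  nlinarith [abs_nonneg (deriv (Fb b) x)]

lemma alpha_small (b : ℕ → ℝ) (hb : ∀ k, 0 ≤ b k) (M : ℕ) (C : ℝ)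
    (hC : ∀ k : ℕ, b (k + 1) ≤ C * ((k : ℝ) + 1) ^ M) (α : ℕ → ℝ)
    (hα : ∀ᶠ n : ℕ in atTop, 0 < α n ∧ Abf b (Real.exp (-α n)) = n) :
    Tendsto α atTop (𝓝[>] 0) := by
  rw [tendsto_nhdsWithin_iff]
  refine ⟨?_, hα.mono fun n h => h.1⟩
  rw [tendsto_order]
  refine ⟨fun a ha => hα.mono fun n h => ha.trans h.1, fun ε hε => ?_⟩
  obtain ⟨B, hB⟩ := Fb_deriv_bound b hb M C hC (Real.exp (-(ε / 2))) (Real.exp_pos _)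
    (by rw [Real.exp_lt_one_iff]; linarith)
  filter_upwards [hα, eventually_gt_atTop ⌈B⌉₊] with n hn hnB
  by_contra hc
  have h1 := hB (Real.exp (-α n)) (Real.exp_pos _) (Real.exp_lt_exp.2 (by linarith))
  rw [hn.2] at h1
  have h2 : B < n := (Nat.le_ceil B).trans_lt (by exact_mod_cast hnB)
  linarith

theorem statement14    (b : ℕ → ℝ) (hb : ∀ k, 0 ≤ b k) (ρ C₀ A C₁ : ℝ) (Dc : ℂ → ℂ)
    (h1 : M1 b ρ C₀ A Dc) (h2 : M2 C₀ C₁ Dc)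
    (α : ℕ → ℝ) (hα : ∀ᶠ n : ℕ in atTop, 0 < α n ∧ Abf b (Real.exp (-α n)) = n)
    (ω : ℕ → ℝ) (hωpos : ∀ n, 0 < ω n) (hω : Tendsto ω atTop atTop) :
    ∃ C' : ℝ, 0 < C' ∧ ∃ n₀ : ℕ, ∀ n : ℕ, n₀ ≤ n → ∀ u : ℝ,
      α n ^ (1 + ρ / 3) / ω n / (2 * π) ≤ |u| → |u| < α n / (2 * π) →
      C' * α n ^ (-ρ / 3) / ω n ^ 2 ≤
        ∑' k : ℕ, b (k + 1) * Real.exp (-((k : ℝ) + 1) * α n) *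
          Real.sin (π * ((k : ℝ) + 1) * u) ^ 2 := by
  obtain ⟨N, c, hc, hlow⟩ := main_lower b ρ C₀ A C₁ Dc h1 h2
  obtain ⟨hρ, -, -, -, hD, -⟩ := h1
  obtain ⟨M, C, -, hC⟩ := b_growth b hb ρ Dc hD
  have hsm := alpha_small b hb M C hC α hα
  have hX := (tendsto_inv_nhdsGT_zero.comp hsm).eventually hlow
  refine ⟨c * Real.exp (-1) / π ^ 2, by positivity, ?_⟩
  obtain ⟨n₀, hn₀⟩ := eventually_atTop.1 (hX.and hα)
  refine ⟨n₀, fun n hn u hu1 hu2 => ?_⟩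
  obtain ⟨hS, ha, -⟩ := hn₀ n hn
  have hw := hωpos n
  simp only [Function.comp] at hS
  generalize α n = a at *
  generalize ω n = w at *
  have hπ := Real.pi_pos
  set q : ℝ := Real.exp (-1) * (a ^ (ρ / 3) / w / π) ^ 2 with hq
  have hterm : ∀ k : ℕ, q * (b (k + 1) * gK (2 * N + 1) (((k : ℝ) + 1) / a⁻¹)) ≤
      b (k + 1) * Real.exp (-((k : ℝ) + 1) * a) * Real.sin (π * ((k : ℝ) + 1) * u) ^ 2 := by
    intro k
    have hbk := hb (k + 1)
    have hk : (0:ℝ) < (k : ℝ) + 1 := by positivity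
    rw [div_inv_eq_mul]
    rcases le_or_gt 1 (((k : ℝ) + 1) * a) with h | h
    · rw [gK_zero _ (by omega) _ h]
      simp only [mul_zero]
      positivity
    · have g1 := gK_le (2 * N + 1) (((k : ℝ) + 1) * a) (by positivity)
      have e1 : Real.exp (-1) ≤ Real.exp (-((k : ℝ) + 1) * a) :=
        Real.exp_le_exp.2 (by linarith)
      have u0 : 0 ≤ |u| := abs_nonneg u
      have hu2' : |u| * (2 * π) < a := (lt_div_iff₀ (by positivity)).1 hu2
      have hle : π * ((k : ℝ) + 1) * |u| ≤ π / 2 := by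
        have : ((k : ℝ) + 1) * (|u| * (2 * π)) ≤ ((k : ℝ) + 1) * a := by gcongr
        nlinarith [Real.pi_gt_three]
      have s1 := Real.mul_le_sin (x := π * ((k : ℝ) + 1) * |u|) (by positivity) hle
      have s2 : Real.sin (π * ((k : ℝ) + 1) * u) ^ 2 = Real.sin (π * ((k : ℝ) + 1) * |u|) ^ 2 := by
        rcases abs_cases u with ⟨h, -⟩ | ⟨h, -⟩ <;> rw [h]
        rw [mul_neg, Real.sin_neg, neg_sq]
      have s3 : a ^ (ρ / 3) / w / π * (((k : ℝ) + 1) * a) ≤ Real.sin (π * ((k : ℝ) + 1) * |u|) := by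
        refine le_trans ?_ s1
        rw [Real.rpow_add ha, Real.rpow_one] at hu1
        calc a ^ (ρ / 3) / w / π * (((k : ℝ) + 1) * a)
            = 2 * ((k : ℝ) + 1) * (a * a ^ (ρ / 3) / w / (2 * π)) := by field_simp
          _ ≤ 2 * ((k : ℝ) + 1) * |u| := by gcongr
          _ = _ := by field_simp
      rw [s2]
      calc q * (b (k + 1) * gK (2 * N + 1) (((k : ℝ) + 1) * a))
          ≤ q * (b (k + 1) * (((k : ℝ) + 1) * a) ^ 2) := by gcongr
        _ = b (k + 1) * Real.exp (-1) * (a ^ (ρ / 3) / w / π * (((k : ℝ) + 1) * a)) ^ 2 := by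
          rw [hq]; ring
        _ ≤ _ := by gcongr
  have hsum2 : Summable fun k : ℕ =>
      b (k + 1) * Real.exp (-((k : ℝ) + 1) * a) * Real.sin (π * ((k : ℝ) + 1) * u) ^ 2 := by
    have h := b_summable b hb M C hC (Real.exp (-a)) (Real.exp_pos _)
      (by rw [Real.exp_lt_one_iff]; linarith)
    refine Summable.of_nonneg_of_le (fun k => ?_) (fun k => ?_) h
    · have := hb (k + 1); positivity
    · have hbk := hb (k + 1)
      have e1 : Real.exp (-((k : ℝ) + 1) * a) ≤ Real.exp (-a) ^ k := by
        rw [← Real.exp_nat_mul]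
        exact Real.exp_le_exp.2 (by nlinarith)
      have e2 := Real.sin_sq_le_one (π * ((k : ℝ) + 1) * u)
      calc _ ≤ b (k + 1) * Real.exp (-a) ^ k * 1 := by gcongr
        _ = b (k + 1) * 1 * Real.exp (-a) ^ k := by ring
        _ ≤ _ := by
          gcongr
          have : (0:ℝ) ≤ k := Nat.cast_nonneg k
          linarith
  have hsum1 : Summable fun k : ℕ => q * (b (k + 1) * gK (2 * N + 1) (((k : ℝ) + 1) / a⁻¹)) :=
    Summable.of_nonneg_of_le (fun k => by
      have := hb (k + 1)
      have := gK_nonneg (2 * N + 1) (((k : ℝ) + 1) / a⁻¹)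
      positivity) hterm hsum2
  have hfin := hsum1.tsum_le_tsum hterm hsum2
  rw [tsum_mul_left] at hfin
  refine le_trans ?_ ((mul_le_mul_of_nonneg_left hS (show 0 ≤ q by positivity)).trans hfin)
  apply le_of_eq
  have r1 : a⁻¹ ^ ρ = (a ^ (ρ / 3) ^ (1:ℕ))⁻¹ ^ 3 := by
    rw [pow_one, Real.inv_rpow ha.le, inv_pow, ← Real.rpow_natCast, ← Real.rpow_mul ha.le]
    congr 2
    push_cast
    ring
  have r2 : a ^ (-ρ / 3) = (a ^ (ρ / 3))⁻¹ := by rw [neg_div, Real.rpow_neg ha.le]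
  rw [r1, r2, hq, pow_one]
  have := Real.rpow_pos_of_pos ha (ρ / 3)
  field_simp
end
end

section
/- Assume the weight sequence b satisfies conditions (M1), (M2) and (M3), let α_n be the unique positive solution of 𝒜_b(e^{−α}) = n, and let m = m(n) be a sequence of positive integers with m(n) ~ ρ α_n^{−1} log(α_n^{−1}) as n → ∞. Then P(X_n ≤ m) ~ exp{F_{m,b}(e^{−α_n}) − F_b(e^{−α_n})} as n → ∞. -/
open Filter Topology Asymptotics MeasureTheory Real

noncomputable section

/-! ### Elementary bounds -/

theorem rpow_mul_exp_le {κ x β : ℝ} (hκ : 0 < κ) (hx : 0 ≤ x) (hβ : 0 < β) :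
    x ^ κ * Real.exp (-(x * β)) ≤ κ ^ κ * β ^ (-κ) := by
  have h0 : x * β ≤ κ * Real.exp (x * β / κ) := by
    have := Real.add_one_le_exp (x * β / κ)
    have h2 : x * β = κ * (x * β / κ) := by field_simp
    nlinarith
  have h1 : (x * β) ^ κ ≤ κ ^ κ * Real.exp (x * β) := by
    calc (x * β) ^ κ ≤ (κ * Real.exp (x * β / κ)) ^ κ :=
          Real.rpow_le_rpow (by positivity) h0 hκ.le
      _ = κ ^ κ * Real.exp (x * β) := by
          rw [Real.mul_rpow hκ.le (Real.exp_pos _).le, ← Real.exp_mul]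
          congr 2; field_simp
  rw [Real.mul_rpow hx hβ.le] at h1
  rw [Real.rpow_neg hβ.le, Real.exp_neg, ← div_eq_mul_inv, ← div_eq_mul_inv,
    div_le_div_iff₀ (Real.exp_pos _) (by positivity)]
  exact h1

theorem exp_I_third (y : ℝ) :
    ‖Complex.exp (Complex.I * y) - 1 - Complex.I * y + (y : ℂ) ^ 2 / 2‖ ≤ 4 * |y| ^ 3 := by
  have hn : ‖Complex.I * (y : ℂ)‖ = |y| := by simp
  rcases le_or_gt |y| 1 with h | h
  · have := Complex.exp_bound (x := Complex.I * y) (by rw [hn]; exact h) (n := 3) (by norm_num)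
    rw [hn] at this
    have he : Complex.exp (Complex.I * y) - ∑ m ∈ Finset.range 3, (Complex.I * (y : ℂ)) ^ m / (m.factorial : ℂ)
        = Complex.exp (Complex.I * y) - 1 - Complex.I * y + (y : ℂ) ^ 2 / 2 := by
      simp [Finset.sum_range_succ, Nat.factorial, mul_pow]
      ring
    rw [he] at this
    refine this.trans ?_
    have h3 : 0 ≤ |y| ^ 3 := by positivity
    norm_num [Nat.factorial]
    nlinarith
  · have h1 : ‖Complex.exp (Complex.I * y) - 1‖ ≤ |y| := Real.norm_exp_I_mul_ofReal_sub_one_le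
    have h2 : ‖(y : ℂ) ^ 2 / 2‖ = |y| ^ 2 / 2 := by simp
    calc _ ≤ ‖Complex.exp (Complex.I * y) - 1‖ + ‖Complex.I * (y : ℂ)‖ + ‖(y : ℂ) ^ 2 / 2‖ := by
          refine (norm_add_le _ _).trans ?_
          gcongr
          exact norm_sub_le _ _
      _ ≤ |y| + |y| + |y| ^ 2 / 2 := by rw [hn, h2]; gcongr
      _ ≤ 4 * |y| ^ 3 := by nlinarith [sq_nonneg (|y| - 1), mul_pos (sub_pos.2 h) (sub_pos.2 h)]

theorem abs_sin_nat_mul_le (k : ℕ) (x : ℝ) : |Real.sin (k * x)| ≤ k * |Real.sin x| := by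
  induction k with
  | zero => simp
  | succ k ih =>
    push_cast
    rw [add_mul, one_mul, Real.sin_add]
    calc |Real.sin (k * x) * Real.cos x + Real.cos (k * x) * Real.sin x|
        ≤ |Real.sin (k * x)| * |Real.cos x| + |Real.cos (k * x)| * |Real.sin x| := by
          rw [← abs_mul, ← abs_mul]; exact abs_add_le _ _
      _ ≤ |Real.sin (k * x)| * 1 + 1 * |Real.sin x| := by
          gcongr <;> exact Real.abs_cos_le_one _
      _ ≤ _ := by linarith

theorem sin_sq_lower {x : ℝ} (hx : |x| ≤ π / 2) : 4 / π ^ 2 * x ^ 2 ≤ Real.sin x ^ 2 := by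
  have h := Real.mul_le_sin (abs_nonneg x) hx
  have h2 : Real.sin |x| ^ 2 = Real.sin x ^ 2 := by
    rcases abs_choice x with h | h <;> simp [h]
  rw [← h2, ← sq_abs x]
  calc 4 / π ^ 2 * |x| ^ 2 = (2 / π * |x|) ^ 2 := by ring
    _ ≤ _ := by gcongr

/-- termwise tail bound -/
theorem tail_term {a : ℕ → ℝ} (ha : ∀ N, 0 ≤ a N) (ha0 : a 0 = 0) {s η α : ℝ} (hs : 0 < s)
    (hη : 0 < η) (hη1 : η < 1) (hα : 0 < α) (j m N : ℕ) (hN : m ≤ N) :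
    (N : ℝ) ^ j * (a N * Real.exp (-(N * α))) ≤
      (((j + s) ^ (j + s) * (α * η) ^ (-(j + s))) * Real.exp (-(m * α * (1 - η)))) *
        (a N * (N : ℝ) ^ (-s)) := by
  rcases Nat.eq_zero_or_pos N with rfl | hN0
  · simp [ha0]
  have hNp : (0 : ℝ) < N := by exact_mod_cast hN0
  have h1 := rpow_mul_exp_le (κ := j + s) (x := N) (β := α * η) (by positivity) hNp.le (by positivity)
  have h2 : Real.exp (-(N * α * (1 - η))) ≤ Real.exp (-(m * α * (1 - η))) := by
    apply Real.exp_le_exp.2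
    have : (m : ℝ) ≤ N := by exact_mod_cast hN
    have h3 : 0 ≤ α * (1 - η) := mul_nonneg hα.le (by linarith)
    nlinarith
  have h4 : (N : ℝ) ^ j * (a N * Real.exp (-(N * α))) =
      ((N : ℝ) ^ (j + s) * Real.exp (-(N * (α * η))) * Real.exp (-(N * α * (1 - η)))) *
        (a N * (N : ℝ) ^ (-s)) := by
    have e1 : Real.exp (-(N * α)) = Real.exp (-(N * (α * η))) * Real.exp (-(N * α * (1 - η))) := by
      rw [← Real.exp_add]; congr 1; ring
    have e2 : (N : ℝ) ^ (j + s) * (N : ℝ) ^ (-s) = (N : ℝ) ^ j := by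
      rw [← Real.rpow_add hNp, ← Real.rpow_natCast]; congr 1; ring
    rw [e1, ← e2]; ring
  rw [h4]
  have := ha N
  gcongr

theorem summable_pow_exp {a : ℕ → ℝ} (ha : ∀ N, 0 ≤ a N) (ha0 : a 0 = 0) {s α : ℝ} (hs : 0 < s)
    (hsum : Summable fun N : ℕ => a N * (N : ℝ) ^ (-s)) (hα : 0 < α) (j : ℕ) :
    Summable fun N : ℕ => (N : ℝ) ^ j * (a N * Real.exp (-(N * α))) := by
  refine Summable.of_nonneg_of_le (fun N => ?_)
    (fun N => tail_term ha ha0 hs (η := 1 / 2) (by norm_num) (by norm_num) hα j 0 N (Nat.zero_le _))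
    (hsum.mul_left _)
  have := ha N; positivity

def tailS (a : ℕ → ℝ) (α : ℝ) (m j : ℕ) : ℝ :=
  ∑' N : ℕ, if m < N then (N : ℝ) ^ j * (a N * Real.exp (-(N * α))) else 0

theorem summable_tail {a : ℕ → ℝ} (ha : ∀ N, 0 ≤ a N) (ha0 : a 0 = 0) {s α : ℝ} (hs : 0 < s)
    (hsum : Summable fun N : ℕ => a N * (N : ℝ) ^ (-s)) (hα : 0 < α) (m j : ℕ) :
    Summable fun N : ℕ => if m < N then (N : ℝ) ^ j * (a N * Real.exp (-(N * α))) else 0 := by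
  refine Summable.of_nonneg_of_le (fun N => ?_) (fun N => ?_)
    (summable_pow_exp ha ha0 hs hsum hα j)
  · have := ha N; split_ifs <;> positivity
  · have := ha N; split_ifs
    · exact le_rfl
    · positivity

theorem tail_le {a : ℕ → ℝ} (ha : ∀ N, 0 ≤ a N) (ha0 : a 0 = 0) {s η α : ℝ} (hs : 0 < s)
    (hsum : Summable fun N : ℕ => a N * (N : ℝ) ^ (-s))
    (hη : 0 < η) (hη1 : η < 1) (hα : 0 < α) (m j : ℕ) :
    tailS a α m j ≤ (((j + s) ^ (j + s) * (α * η) ^ (-(j + s))) * Real.exp (-(m * α * (1 - η)))) *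
        ∑' N : ℕ, a N * (N : ℝ) ^ (-s) := by
  rw [← tsum_mul_left]
  refine Summable.tsum_le_tsum (fun N => ?_) (summable_tail ha ha0 hs hsum hα m j)
    (hsum.mul_left _)
  split_ifs with h
  · exact tail_term ha ha0 hs hη hη1 hα j m N h.le
  · have := ha N; positivity

theorem full_le {a : ℕ → ℝ} (ha : ∀ N, 0 ≤ a N) (ha0 : a 0 = 0) {s α : ℝ} (hs : 0 < s)
    (hsum : Summable fun N : ℕ => a N * (N : ℝ) ^ (-s)) (hα : 0 < α) (j : ℕ) :
    ∑' N : ℕ, (N : ℝ) ^ j * (a N * Real.exp (-(N * α))) ≤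
      ((j + s) ^ (j + s) * (α * (1 / 2)) ^ (-(j + s))) * ∑' N : ℕ, a N * (N : ℝ) ^ (-s) := by
  rw [← tsum_mul_left]
  refine Summable.tsum_le_tsum (fun N => ?_) (summable_pow_exp ha ha0 hs hsum hα j)
    (hsum.mul_left _)
  have := tail_term ha ha0 hs (η := 1 / 2) (by norm_num) (by norm_num) hα j 0 N (Nat.zero_le _)
  simpa using this

/-! ### The characteristic function at fixed `α` -/

def mom (a : ℕ → ℝ) (α : ℝ) (j : ℕ) : ℝ := ∑' N : ℕ, (N : ℝ) ^ j * (a N * Real.exp (-(N * α)))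

def sinS (a : ℕ → ℝ) (α θ : ℝ) : ℝ :=
  ∑' N : ℕ, a N * Real.exp (-(N * α)) * Real.sin (N * θ / 2) ^ 2

def Ph (c : ℕ → ℝ) (α θ : ℝ) : ℂ :=
  ∑' N : ℕ, ((c N * Real.exp (-(N * α)) : ℝ) : ℂ) *
    (Complex.exp (Complex.I * ((N * θ : ℝ) : ℂ)) - 1)

/-- A convenient bundle: `a` nonnegative, with all exponential moments at `α`. -/
structure Good (a : ℕ → ℝ) (α : ℝ) : Prop where
  nn : ∀ N, 0 ≤ a N
  sm : ∀ j : ℕ, Summable fun N : ℕ => (N : ℝ) ^ j * (a N * Real.exp (-(N * α)))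

theorem Good.sm0 {a : ℕ → ℝ} {α : ℝ} (h : Good a α) :
    Summable fun N : ℕ => a N * Real.exp (-(N * α)) := by simpa using h.sm 0

theorem Good.mono {a c : ℕ → ℝ} {α : ℝ} (h : Good a α) (hc0 : ∀ N, 0 ≤ c N)
    (hc : ∀ N, c N ≤ a N) : Good c α :=
  ⟨hc0, fun j => Summable.of_nonneg_of_le (fun N => by have := hc0 N; positivity)
    (fun N => by have := hc N; gcongr) (h.sm j)⟩

theorem Good.smTail {a : ℕ → ℝ} {α : ℝ} (h : Good a α) (m j : ℕ) :
    Summable fun N : ℕ => if m < N then (N : ℝ) ^ j * (a N * Real.exp (-(N * α))) else 0 := by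
  refine Summable.of_nonneg_of_le (fun N => ?_) (fun N => ?_) (h.sm j)
  · have := h.nn N; split_ifs <;> positivity
  · have := h.nn N; split_ifs
    · exact le_rfl
    · positivity

theorem Good.smSin {a : ℕ → ℝ} {α : ℝ} (h : Good a α) (θ : ℝ) :
    Summable fun N : ℕ => a N * Real.exp (-(N * α)) * Real.sin (N * θ / 2) ^ 2 := by
  refine Summable.of_nonneg_of_le (fun N => ?_) (fun N => ?_) h.sm0
  · have := h.nn N; positivity
  · have := h.nn N
    exact mul_le_of_le_one_right (by positivity) (Real.sin_sq_le_one _)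

theorem Good.normPh {c : ℕ → ℝ} {α : ℝ} (h : Good c α) (θ : ℝ) (N : ℕ) :
    ‖((c N * Real.exp (-(N * α)) : ℝ) : ℂ) *
      (Complex.exp (Complex.I * ((N * θ : ℝ) : ℂ)) - 1)‖ ≤ 2 * (c N * Real.exp (-(N * α))) := by
  have h0 := h.nn N
  rw [norm_mul, Complex.norm_real, Real.norm_of_nonneg (by positivity), mul_comm]
  gcongr
  refine (norm_sub_le _ _).trans ?_
  rw [Complex.norm_exp_I_mul_ofReal]; norm_num

theorem Good.smPh {c : ℕ → ℝ} {α : ℝ} (h : Good c α) (θ : ℝ) :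
    Summable fun N : ℕ => ((c N * Real.exp (-(N * α)) : ℝ) : ℂ) *
      (Complex.exp (Complex.I * ((N * θ : ℝ) : ℂ)) - 1) :=
  Summable.of_norm_bounded (h.sm0.mul_left 2) (h.normPh θ)

theorem Good.contPh {c : ℕ → ℝ} {α : ℝ} (h : Good c α) : Continuous (Ph c α) := by
  refine continuous_tsum (fun N => ?_) (h.sm0.mul_left 2) (fun N θ => h.normPh θ N)
  fun_prop

theorem Good.rePh {c : ℕ → ℝ} {α : ℝ} (h : Good c α) (θ : ℝ) :
    (Ph c α θ).re = -2 * sinS c α θ := by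
  rw [Ph, Complex.re_tsum (h.smPh θ), sinS, ← tsum_mul_left]
  congr 1; ext N
  rw [Complex.re_ofReal_mul, mul_comm Complex.I, Complex.sub_re, Complex.exp_ofReal_mul_I_re]
  have h1 := Real.cos_two_mul (N * θ / 2)
  have h2 := Real.sin_sq_add_cos_sq (N * θ / 2)
  rw [mul_div_cancel₀ _ (two_ne_zero)] at h1
  simp only [Complex.one_re]
  have h3 : Real.cos (N * θ) - 1 = -2 * Real.sin (N * θ / 2) ^ 2 := by linarith
  rw [h3]; ring

theorem Good.normExp {c : ℕ → ℝ} {α : ℝ} (h : Good c α) (θ x : ℝ) :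
    ‖Complex.exp (Ph c α θ - Complex.I * ((x * θ : ℝ) : ℂ))‖ = Real.exp (-2 * sinS c α θ) := by
  rw [Complex.norm_exp, Complex.sub_re, h.rePh]
  simp

theorem Good.expansion {a c : ℕ → ℝ} {α : ℝ} (h : Good a α) (hc0 : ∀ N, 0 ≤ c N)
    (hc : ∀ N, c N ≤ a N) {m : ℕ} (hcm : ∀ N, N ≤ m → c N = a N) (θ : ℝ) :
    ‖Ph c α θ - Complex.I * ((mom a α 1 * θ : ℝ) : ℂ) + ((θ ^ 2 * mom a α 2 / 2 : ℝ) : ℂ)‖ ≤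
      4 * |θ| ^ 3 * mom a α 3 + |θ| * tailS a α m 1 := by
  have hg := h.mono hc0 hc
  have s1 := (Complex.hasSum_ofReal.2 ((h.sm 1).hasSum)).mul_left (Complex.I * (θ : ℂ))
  have s2 := (Complex.hasSum_ofReal.2 ((h.sm 2).hasSum)).mul_left ((θ : ℂ) ^ 2 / 2)
  have s := ((hg.smPh θ).hasSum.sub s1).add s2
  have b := (((h.sm 3).hasSum).mul_left (4 * |θ| ^ 3)).add (((h.smTail m 1).hasSum).mul_left |θ|)
  have key := tsum_of_norm_bounded b (f := fun N : ℕ => ((c N * Real.exp (-(N * α)) : ℝ) : ℂ) *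
      (Complex.exp (Complex.I * ((N * θ : ℝ) : ℂ)) - 1) -
      Complex.I * (θ : ℂ) * (((N : ℝ) ^ 1 * (a N * Real.exp (-(N * α))) : ℝ) : ℂ) +
      (θ : ℂ) ^ 2 / 2 * (((N : ℝ) ^ 2 * (a N * Real.exp (-(N * α))) : ℝ) : ℂ)) ?_
  · rw [s.tsum_eq] at key
    refine le_trans (le_of_eq ?_) key
    congr 1
    rw [Ph, mom, mom]
    push_cast
    ring
  · intro N
    set e := Real.exp (-(N * α)) with he
    have hepos : 0 < e := Real.exp_pos _
    have haN := h.nn N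
    set y : ℝ := N * θ with hy
    have hyabs : |y| = N * |θ| := by rw [hy, abs_mul, Nat.abs_cast]
    have t1 : ‖((a N * e : ℝ) : ℂ) * (Complex.exp (Complex.I * y) - 1 - Complex.I * y + (y : ℂ) ^ 2 / 2)‖
        ≤ 4 * |θ| ^ 3 * ((N : ℝ) ^ 3 * (a N * e)) := by
      rw [norm_mul, Complex.norm_real, Real.norm_of_nonneg (by positivity)]
      calc _ ≤ (a N * e) * (4 * |y| ^ 3) := by gcongr; exact exp_I_third y
        _ = _ := by rw [hyabs]; ring
    have t2 : ‖(((a N - c N) * e : ℝ) : ℂ) * (Complex.exp (Complex.I * y) - 1)‖ ≤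
        |θ| * (if m < N then (N : ℝ) ^ 1 * (a N * e) else 0) := by
      split_ifs with hmN
      · have hd : 0 ≤ a N - c N := sub_nonneg.2 (hc N)
        rw [norm_mul, Complex.norm_real, Real.norm_of_nonneg (by positivity)]
        calc _ ≤ (a N * e) * |y| := by
              gcongr
              · linarith [hc0 N]
              · exact Real.norm_exp_I_mul_ofReal_sub_one_le
          _ = _ := by rw [hyabs]; ring
      · rw [hcm N (not_lt.1 hmN)]; simp
    refine le_trans (le_of_eq ?_) ((norm_sub_le _ _).trans (add_le_add t1 t2))
    congr 1
    rw [hy]; push_cast; ring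

theorem Good.split {a : ℕ → ℝ} {α : ℝ} (h : Good a α) (m : ℕ) :
    mom a α 3 ≤ m * mom a α 2 + tailS a α m 3 := by
  rw [mom, mom, tailS, ← tsum_mul_left, ← Summable.tsum_add ((h.sm 2).mul_left _) (h.smTail m 3)]
  refine Summable.tsum_le_tsum (fun N => ?_) (h.sm 3) (((h.sm 2).mul_left _).add (h.smTail m 3))
  have := h.nn N
  split_ifs with hN
  · have : 0 ≤ (m : ℝ) * ((N : ℝ) ^ 2 * (a N * Real.exp (-(N * α)))) := by positivity
    linarith
  · have hN' : (N : ℝ) ≤ m := by exact_mod_cast not_lt.1 hN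
    have : (N : ℝ) ^ 3 * (a N * Real.exp (-(N * α))) = N * ((N : ℝ) ^ 2 * (a N * Real.exp (-(N * α)))) := by ring
    rw [this, add_zero]; gcongr

theorem Good.near {a c : ℕ → ℝ} {α : ℝ} (h : Good a α) (hc0 : ∀ N, 0 ≤ c N)
    (hc : ∀ N, c N ≤ a N) {m : ℕ} (hcm : ∀ N, N ≤ m → c N = a N) {θ : ℝ} (hθ : m * |θ| ≤ π) :
    θ ^ 2 / π ^ 2 * (mom a α 2 - tailS a α m 2) ≤ sinS c α θ := by
  have hg := h.mono hc0 hc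
  rw [mom, tailS, sinS, ← Summable.tsum_sub (h.sm 2) (h.smTail m 2), ← tsum_mul_left]
  refine Summable.tsum_le_tsum (fun N => ?_) (((h.sm 2).sub (h.smTail m 2)).mul_left _) (hg.smSin θ)
  have h1 := h.nn N
  have h2 := hc0 N
  split_ifs with hN
  · simp only [sub_self, mul_zero]; positivity
  · have hN' : (N : ℝ) ≤ m := by exact_mod_cast not_lt.1 hN
    rw [hcm N (not_lt.1 hN), sub_zero]
    have hx : |(N : ℝ) * θ / 2| ≤ π / 2 := by
      rw [abs_div, abs_mul, Nat.abs_cast, abs_two]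
      gcongr
      exact (mul_le_mul_of_nonneg_right hN' (abs_nonneg _)).trans hθ
    have := sin_sq_lower hx
    calc _ = (a N * Real.exp (-(N * α))) * (4 / π ^ 2 * ((N : ℝ) * θ / 2) ^ 2) := by ring
      _ ≤ _ := by gcongr

theorem Good.far {a c : ℕ → ℝ} {α : ℝ} (h : Good a α) (hc0 : ∀ N, 0 ≤ c N)
    (hc : ∀ N, c N ≤ a N) {m : ℕ} (hcm : ∀ N, N ≤ m → c N = a N) (θ : ℝ) :
    sinS a α θ - tailS a α m 0 ≤ sinS c α θ := by
  have hg := h.mono hc0 hc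
  rw [sinS, tailS, sinS, ← Summable.tsum_sub (h.smSin θ) (h.smTail m 0)]
  refine Summable.tsum_le_tsum (fun N => ?_) ((h.smSin θ).sub (h.smTail m 0)) (hg.smSin θ)
  have h1 := h.nn N
  have h2 := hc0 N
  split_ifs with hN
  · have : a N * Real.exp (-(N * α)) * Real.sin (N * θ / 2) ^ 2 ≤ a N * Real.exp (-(N * α)) :=
      mul_le_of_le_one_right (by positivity) (Real.sin_sq_le_one _)
    have h3 : 0 ≤ c N * Real.exp (-(N * α)) * Real.sin (N * θ / 2) ^ 2 := by positivity
    simp only [pow_zero, one_mul]; linarith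
  · rw [hcm N (not_lt.1 hN), sub_zero]

theorem Good.scale {a : ℕ → ℝ} {α : ℝ} (h : Good a α) (k : ℕ) (θ : ℝ) :
    sinS a α (k * θ) ≤ (k : ℝ) ^ 2 * sinS a α θ := by
  rw [sinS, sinS, ← tsum_mul_left]
  refine Summable.tsum_le_tsum (fun N => ?_) (h.smSin _) ((h.smSin θ).mul_left _)
  have h1 := h.nn N
  have h2 := abs_sin_nat_mul_le k (N * θ / 2)
  have h3 : Real.sin (N * (k * θ) / 2) ^ 2 ≤ (k : ℝ) ^ 2 * Real.sin (N * θ / 2) ^ 2 := by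
    have e : (N : ℝ) * (k * θ) / 2 = k * (N * θ / 2) := by ring
    rw [e, ← sq_abs, ← sq_abs (Real.sin (N * θ / 2)), ← mul_pow]
    gcongr
  calc _ ≤ a N * Real.exp (-(N * α)) * ((k : ℝ) ^ 2 * Real.sin (N * θ / 2) ^ 2) := by gcongr
    _ = _ := by ring

theorem Good.sinS_le {a : ℕ → ℝ} {α : ℝ} (h : Good a α) (θ : ℝ) :
    sinS a α θ ≤ θ ^ 2 / 4 * mom a α 2 := by
  rw [sinS, mom, ← tsum_mul_left]
  refine Summable.tsum_le_tsum (fun N => ?_) (h.smSin _) ((h.sm 2).mul_left _)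
  have h1 := h.nn N
  have h2 : Real.sin (N * θ / 2) ^ 2 ≤ (N * θ / 2) ^ 2 := Real.sin_sq_le_sq
  calc _ ≤ a N * Real.exp (-(N * α)) * (N * θ / 2) ^ 2 := by gcongr
    _ = _ := by ring

/-! ### Deterministic estimates -/

theorem det_sigma {a : ℕ → ℝ} {α y κ : ℝ} (h : Good a α) (hα : 0 < α) (hα2 : 2 * α ≤ π)
    (hκ : 0 < κ) (hy : 1 ≤ y)
    (hM : ∀ θ : ℝ, α < |θ| → |θ| ≤ π → κ ^ 2 * y ^ 16 ≤ sinS a α θ) :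
    κ ^ 2 * y ^ 16 ≤ α ^ 2 * mom a α 2 ∧ κ * y ^ 8 ≤ √(mom a α 2) * α := by
  have h2 : |2 * α| = 2 * α := abs_of_pos (by linarith)
  have h1 := (hM (2 * α) (by rw [h2]; linarith) (by rw [h2]; exact hα2)).trans (h.sinS_le (2 * α))
  have h3 : κ ^ 2 * y ^ 16 ≤ α ^ 2 * mom a α 2 := by
    refine h1.trans (le_of_eq ?_); ring
  refine ⟨h3, ?_⟩
  have hB : 0 ≤ mom a α 2 := by
    by_contra hneg
    push Not at hneg
    have : 0 < κ ^ 2 * y ^ 16 := by positivity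
    nlinarith [mul_pos hα hα]
  have : √(mom a α 2) * α = √(α ^ 2 * mom a α 2) := by
    rw [Real.sqrt_mul (by positivity), Real.sqrt_sq hα.le, mul_comm]
  rw [this]
  apply Real.le_sqrt_of_sq_le
  refine le_trans (le_of_eq ?_) h3
  ring

theorem det_dom {a c : ℕ → ℝ} {α y κ : ℝ} {m : ℕ} (h : Good a α) (hc0 : ∀ N, 0 ≤ c N)
    (hc : ∀ N, c N ≤ a N) (hcm : ∀ N, N ≤ m → c N = a N) (hα : 0 < α) (hα2 : 2 * α ≤ π)
    (hκ : 0 < κ) (hy : 1 ≤ y)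
    (hM : ∀ θ : ℝ, α < |θ| → |θ| ≤ π → κ ^ 2 * y ^ 16 ≤ sinS a α θ)
    (hm : m * α ≤ y) (ht0 : tailS a α m 0 ≤ y) (ht2 : tailS a α m 2 * α ^ 2 ≤ y)
    (hy1 : y ^ 8 + y ≤ κ ^ 2 / 4 * y ^ 12) (hy2 : 2 * y ≤ κ ^ 2 * y ^ 16)
    (hexp : (1 + π ^ 2 * mom a α 2) * Real.exp (-2 * y ^ 8) ≤ 1) {θ : ℝ} (hθ : |θ| ≤ π) (x : ℝ) :
    ‖Complex.exp (Ph c α θ - Complex.I * ((x * θ : ℝ) : ℂ))‖ ≤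
      Real.exp (-(1 / π ^ 2) * (√(mom a α 2) * θ) ^ 2) + (1 + (√(mom a α 2) * θ) ^ 2)⁻¹ := by
  have hg := h.mono hc0 hc
  obtain ⟨hB1, -⟩ := det_sigma h hα hα2 hκ hy hM
  have hB : 0 ≤ mom a α 2 := tsum_nonneg fun N => by have := h.nn N; positivity
  rw [hg.normExp]
  have hsq : (√(mom a α 2) * θ) ^ 2 = mom a α 2 * θ ^ 2 := by rw [mul_pow, Real.sq_sqrt hB]
  rw [hsq]
  have hπ := Real.pi_pos
  rcases le_or_gt (|θ| * y ^ 2) α with hn | hf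
  · have h1 : m * |θ| ≤ π := by
      have e1 : (m : ℝ) * |θ| * (y * α) ≤ 1 * (y * α) := by
        calc (m : ℝ) * |θ| * (y * α) = (m * α) * (|θ| * y) := by ring
          _ ≤ y * (|θ| * y) := by gcongr
          _ = |θ| * y ^ 2 := by ring
          _ ≤ α := hn
          _ ≤ 1 * (y * α) := by nlinarith
      have := le_of_mul_le_mul_right e1 (by positivity)
      linarith [Real.pi_gt_three]
    have h2 := h.near hc0 hc hcm h1
    have h3 : tailS a α m 2 ≤ mom a α 2 / 2 := by
      have : tailS a α m 2 * α ^ 2 ≤ mom a α 2 / 2 * α ^ 2 := by nlinarith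
      exact le_of_mul_le_mul_right this (by positivity)
    have h4 : θ ^ 2 / π ^ 2 * (mom a α 2 / 2) ≤ sinS c α θ := by
      refine le_trans ?_ h2
      gcongr; linarith
    have h5 : Real.exp (-2 * sinS c α θ) ≤ Real.exp (-(1 / π ^ 2) * (mom a α 2 * θ ^ 2)) := by
      apply Real.exp_le_exp.2
      have : θ ^ 2 / π ^ 2 * (mom a α 2 / 2) = (1 / π ^ 2) * (mom a α 2 * θ ^ 2) / 2 := by ring
      linarith
    have : 0 ≤ (1 + mom a α 2 * θ ^ 2)⁻¹ := by positivity
    linarith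
  · have hθ0 : 0 < |θ| := by
      by_contra h0
      have : |θ| = 0 := le_antisymm (not_lt.1 h0) (abs_nonneg _)
      rw [this] at hf; linarith
    set k : ℕ := ⌊α / |θ|⌋₊ + 1 with hk
    have hk1 : α / |θ| < k := by rw [hk]; push_cast; exact Nat.lt_floor_add_one _
    have hk2 : (k : ℝ) ≤ α / |θ| + 1 := by
      rw [hk]; push_cast; gcongr; exact Nat.floor_le (by positivity)
    have hka : |(k : ℝ) * θ| = k * |θ| := by rw [abs_mul, Nat.abs_cast]
    have hk3 : α < |(k : ℝ) * θ| := by rw [hka]; exact (div_lt_iff₀ hθ0).1 hk1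
    have hk4 : |(k : ℝ) * θ| ≤ π := by
      rw [hka]
      rcases le_or_gt |θ| α with hl | hl
      · calc (k : ℝ) * |θ| ≤ (α / |θ| + 1) * |θ| := by gcongr
          _ = α + |θ| := by field_simp
          _ ≤ π := by linarith
      · have : k = 1 := by
          rw [hk, Nat.floor_eq_zero.2]
          rw [div_lt_one hθ0]; exact hl
        rw [this]; simpa using hθ
    have h1 := (hM _ hk3 hk4).trans (h.scale k θ)
    have hky : (k : ℝ) ≤ 2 * y ^ 2 := by
      have : α / |θ| ≤ y ^ 2 := by rw [div_le_iff₀ hθ0]; linarith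
      have : 1 ≤ y ^ 2 := one_le_pow₀ hy
      linarith
    have hs0 : 0 ≤ sinS a α θ := tsum_nonneg fun N => by have := h.nn N; positivity
    have h2 : κ ^ 2 * y ^ 16 ≤ (2 * y ^ 2) ^ 2 * sinS a α θ := by
      refine h1.trans ?_; gcongr
    have h3 : κ ^ 2 / 4 * y ^ 12 ≤ sinS a α θ := by
      have : (κ ^ 2 / 4 * y ^ 12) * (4 * y ^ 4) ≤ sinS a α θ * (4 * y ^ 4) := by nlinarith
      exact le_of_mul_le_mul_right this (by positivity)
    have h4 := h.far hc0 hc hcm θ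
    have h5 : y ^ 8 ≤ sinS c α θ := by linarith
    have h6 : Real.exp (-2 * sinS c α θ) ≤ Real.exp (-2 * y ^ 8) := Real.exp_le_exp.2 (by linarith)
    have h7 : Real.exp (-2 * y ^ 8) ≤ (1 + mom a α 2 * θ ^ 2)⁻¹ := by
      rw [le_inv_comm₀ (Real.exp_pos _) (by positivity), ← one_div, le_div_iff₀ (Real.exp_pos _)]
      refine le_trans ?_ hexp
      have : θ ^ 2 ≤ π ^ 2 := by rw [← sq_abs]; gcongr
      have h8 : mom a α 2 * θ ^ 2 ≤ π ^ 2 * mom a α 2 := by nlinarith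
      gcongr
    have := Real.exp_pos (-(1 / π ^ 2) * (mom a α 2 * θ ^ 2))
    linarith

theorem det_pt {a c : ℕ → ℝ} {α y κ : ℝ} {m : ℕ} (h : Good a α) (hc0 : ∀ N, 0 ≤ c N)
    (hc : ∀ N, c N ≤ a N) (hcm : ∀ N, N ≤ m → c N = a N) (hα : 0 < α) (hα2 : 2 * α ≤ π)
    (hκ : 0 < κ) (hy : 1 ≤ y)
    (hM : ∀ θ : ℝ, α < |θ| → |θ| ≤ π → κ ^ 2 * y ^ 16 ≤ sinS a α θ)
    (hm : m * α ≤ y) (ht1 : tailS a α m 1 * α ^ 1 ≤ y) (ht3 : tailS a α m 3 * α ^ 3 ≤ y) (t : ℝ) :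
    ‖Ph c α (t / √(mom a α 2)) - Complex.I * ((mom a α 1 * (t / √(mom a α 2)) : ℝ) : ℂ)
        + ((t ^ 2 / 2 : ℝ) : ℂ)‖ ≤
      (4 * |t| ^ 3 * (1 / κ + 1 / κ ^ 3) + |t| / κ) * y⁻¹ := by
  obtain ⟨hB1, hs⟩ := det_sigma h hα hα2 hκ hy hM
  have hB : 0 < mom a α 2 := by
    by_contra hneg
    push Not at hneg
    have : 0 < κ ^ 2 * y ^ 16 := by positivity
    nlinarith [mul_pos hα hα]
  set σ := √(mom a α 2) with hσ
  have hσ0 : 0 < σ := Real.sqrt_pos.2 hB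
  have hσ2 : mom a α 2 = σ ^ 2 := (Real.sq_sqrt hB.le).symm
  have h1 := h.expansion hc0 hc hcm (t / σ)
  have e : (t / σ) ^ 2 * mom a α 2 / 2 = t ^ 2 / 2 := by rw [hσ2]; field_simp
  rw [e] at h1
  refine h1.trans ?_
  have h2 := h.split m
  have hp : 1 ≤ y ^ 6 := one_le_pow₀ hy
  have hy0 : 0 < y := by linarith
  -- sigma lower bounds
  have hs' : κ * y ^ 2 ≤ σ * α := le_trans (by gcongr; first | exact hy | norm_num) hs
  have b1 : m / σ ≤ 1 / κ * y⁻¹ := by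
    rw [div_le_iff₀ hσ0, ← mul_le_mul_iff_left₀ hα]
    refine hm.trans ?_
    calc y = 1 / κ * y⁻¹ * (κ * y ^ 2) := by field_simp
      _ ≤ 1 / κ * y⁻¹ * (σ * α) := by gcongr
      _ = _ := by ring
  have b2 : tailS a α m 1 / σ ≤ 1 / κ * y⁻¹ := by
    rw [div_le_iff₀ hσ0, ← mul_le_mul_iff_left₀ hα]
    rw [pow_one] at ht1
    refine ht1.trans ?_
    calc y = 1 / κ * y⁻¹ * (κ * y ^ 2) := by field_simp
      _ ≤ 1 / κ * y⁻¹ * (σ * α) := by gcongr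
      _ = _ := by ring
  have b3 : tailS a α m 3 / σ ^ 3 ≤ 1 / κ ^ 3 * y⁻¹ := by
    rw [div_le_iff₀ (by positivity), ← mul_le_mul_iff_left₀ (by positivity : 0 < α ^ 3)]
    refine ht3.trans ?_
    have hs3 : κ * y ≤ σ * α := le_trans (by gcongr; nlinarith) hs'
    calc y ≤ y ^ 2 := by nlinarith
      _ = 1 / κ ^ 3 * y⁻¹ * (κ * y) ^ 3 := by field_simp
      _ ≤ 1 / κ ^ 3 * y⁻¹ * (σ * α) ^ 3 := by gcongr
      _ = _ := by ring
  have habs : |t / σ| = |t| / σ := by rw [abs_div, abs_of_pos hσ0]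
  rw [habs]
  calc 4 * (|t| / σ) ^ 3 * mom a α 3 + |t| / σ * tailS a α m 1
      ≤ 4 * (|t| / σ) ^ 3 * (m * mom a α 2 + tailS a α m 3) + |t| / σ * tailS a α m 1 := by gcongr
    _ = 4 * |t| ^ 3 * (m / σ + tailS a α m 3 / σ ^ 3) + |t| * (tailS a α m 1 / σ) := by
        rw [hσ2]; field_simp
    _ ≤ 4 * |t| ^ 3 * (1 / κ * y⁻¹ + 1 / κ ^ 3 * y⁻¹) + |t| * (1 / κ * y⁻¹) := by gcongr
    _ = _ := by ring

/-! ### The local limit theorem -/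

theorem clt {a : ℕ → ℝ} {c : ℕ → ℕ → ℝ} {α y : ℕ → ℝ} {m : ℕ → ℕ} {κ : ℝ} (hκ : 0 < κ)
    (hy : Tendsto y atTop atTop)
    (hc0 : ∀ n N, 0 ≤ c n N) (hc : ∀ n N, c n N ≤ a N) (hcm : ∀ n N, N ≤ m n → c n N = a N)
    (hG : ∀ᶠ n in atTop, Good a (α n)) (hα : ∀ᶠ n in atTop, 0 < α n)
    (hα2 : ∀ᶠ n in atTop, 2 * α n ≤ π)
    (hM : ∀ᶠ n in atTop, ∀ θ : ℝ, α n < |θ| → |θ| ≤ π → κ ^ 2 * y n ^ 16 ≤ sinS a (α n) θ)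
    (hm : ∀ᶠ n in atTop, m n * α n ≤ y n)
    (ht : ∀ j : ℕ, ∀ᶠ n in atTop, tailS a (α n) (m n) j * α n ^ j ≤ y n)
    (hexp : ∀ᶠ n in atTop, (1 + π ^ 2 * mom a (α n) 2) * Real.exp (-2 * y n ^ 8) ≤ 1) :
    Tendsto (fun n => (√(mom a (α n) 2) : ℂ) * ∫ θ in (-π)..π,
      Complex.exp (Ph (c n) (α n) θ - Complex.I * ((mom a (α n) 1 * θ : ℝ) : ℂ))) atTop
      (𝓝 ((√(2 * π) : ℝ) : ℂ)) := by
  have hπ := Real.pi_pos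
  have hy1 : ∀ᶠ n in atTop, 1 ≤ y n := hy.eventually_ge_atTop 1
  have hy8 : ∀ᶠ n in atTop, y n ^ 8 + y n ≤ κ ^ 2 / 4 * y n ^ 12 := by
    filter_upwards [hy1, hy.eventually_ge_atTop (8 / κ ^ 2)] with n h1 h2
    rw [div_le_iff₀ (by positivity)] at h2
    have h3 : y n ≤ y n ^ 8 := le_self_pow₀ h1 (by norm_num)
    have h4 : y n ^ 9 ≤ y n ^ 12 := pow_le_pow_right₀ h1 (by norm_num)
    have h5 : 0 ≤ y n ^ 8 := by positivity
    calc y n ^ 8 + y n ≤ 8 / 4 * y n ^ 8 := by linarith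
      _ ≤ (y n * κ ^ 2) / 4 * y n ^ 8 := by gcongr
      _ = κ ^ 2 / 4 * y n ^ 9 := by ring
      _ ≤ _ := by gcongr
  have hy16 : ∀ᶠ n in atTop, 2 * y n ≤ κ ^ 2 * y n ^ 16 := by
    filter_upwards [hy1, hy.eventually_ge_atTop (2 / κ ^ 2)] with n h1 h2
    rw [div_le_iff₀ (by positivity)] at h2
    have h4 : y n ^ 2 ≤ y n ^ 16 := pow_le_pow_right₀ h1 (by norm_num)
    calc 2 * y n ≤ y n * κ ^ 2 * y n := by gcongr
      _ = κ ^ 2 * y n ^ 2 := by ring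
      _ ≤ _ := by gcongr
  set σ : ℕ → ℝ := fun n => √(mom a (α n) 2) with hσ
  set G : ℕ → ℝ → ℂ := fun n θ =>
    Complex.exp (Ph (c n) (α n) θ - Complex.I * ((mom a (α n) 1 * θ : ℝ) : ℂ)) with hGdef
  -- sigma is large
  have hσlow : ∀ᶠ n in atTop, κ * y n ≤ σ n * 2 := by
    filter_upwards [hG, hα, hα2, hM, hy1] with n g1 g2 g3 g4 g5
    have := (det_sigma g1 g2 g3 hκ g5 g4).2
    have h3 : y n ≤ y n ^ 8 := le_self_pow₀ g5 (by norm_num)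
    have h4 : α n ≤ 2 := by linarith [Real.pi_le_four]
    calc κ * y n ≤ κ * y n ^ 8 := by gcongr
      _ ≤ σ n * α n := this
      _ ≤ _ := by gcongr
  have hσtop : Tendsto σ atTop atTop := by
    have : Tendsto (fun n => κ / 2 * y n) atTop atTop := hy.const_mul_atTop (by positivity)
    refine tendsto_atTop_mono' _ ?_ this
    filter_upwards [hσlow] with n hn
    linarith
  have hσ0 : ∀ᶠ n in atTop, 0 < σ n := hσtop.eventually_gt_atTop 0
  let F : ℕ → ℝ → ℂ := fun n =>
    (Set.Ioc (-(π * σ n)) (π * σ n)).indicator (fun t => G n (t / σ n))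
  have hFint : ∀ᶠ n in atTop, (∫ t, F n t) = (σ n : ℂ) * ∫ θ in (-π)..π, G n θ := by
    filter_upwards [hσ0] with n hn
    have h1 := intervalIntegral.integral_comp_div (a := -(π * σ n)) (b := π * σ n) (G n) hn.ne'
    have e1 : -(π * σ n) / σ n = -π := by field_simp
    have e2 : π * σ n / σ n = π := by field_simp
    rw [e1, e2, intervalIntegral.integral_of_le (by nlinarith)] at h1
    rw [integral_indicator measurableSet_Ioc, h1, Complex.real_smul]
  have hlim : Tendsto (fun n => ∫ t, F n t) atTop
      (𝓝 (∫ t : ℝ, ((Real.exp (-(1 / 2) * t ^ 2) : ℝ) : ℂ))) := by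
    refine tendsto_integral_filter_of_dominated_convergence
      (fun t => Real.exp (-(1 / π ^ 2) * t ^ 2) + (1 + t ^ 2)⁻¹) ?_ ?_ ?_ ?_
    · filter_upwards [hG] with n g1
      refine (Continuous.aestronglyMeasurable ?_).indicator measurableSet_Ioc
      have := (g1.mono (hc0 n) (hc n)).contPh
      simp only [hGdef]
      fun_prop
    · filter_upwards [hG, hα, hα2, hM, hy1, hm, ht 0, ht 2, hy8, hy16, hexp, hσ0] with
        n g1 g2 g3 g4 g5 g6 g7 g8 g9 g10 g11 g12
      refine Eventually.of_forall fun t => ?_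
      simp only [F, Set.indicator_apply]
      split_ifs with hmem
      · have hθ : |t / σ n| ≤ π := by
          rw [abs_div, abs_of_pos g12, div_le_iff₀ g12, abs_le]
          exact ⟨hmem.1.le, hmem.2⟩
        have := det_dom g1 (hc0 n) (hc n) (hcm n) g2 g3 hκ g5 g4 g6 (by simpa using g7) g8 g9 g10
          g11 hθ (mom a (α n) 1)
        have e : √(mom a (α n) 2) * (t / σ n) = t := by
          change σ n * (t / σ n) = t
          field_simp
        rw [e] at this
        exact this
      · rw [norm_zero]; positivity
    · exact (integrable_exp_neg_mul_sq (by positivity)).add integrable_inv_one_add_sq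
    · refine Eventually.of_forall fun t => ?_
      have hE : Tendsto (fun n => Ph (c n) (α n) (t / σ n) -
          Complex.I * ((mom a (α n) 1 * (t / σ n) : ℝ) : ℂ) + ((t ^ 2 / 2 : ℝ) : ℂ)) atTop (𝓝 0) := by
        rw [tendsto_zero_iff_norm_tendsto_zero]
        have hz : Tendsto (fun n => (4 * |t| ^ 3 * (1 / κ + 1 / κ ^ 3) + |t| / κ) * (y n)⁻¹)
            atTop (𝓝 0) := by
          have := hy.inv_tendsto_atTop.const_mul (4 * |t| ^ 3 * (1 / κ + 1 / κ ^ 3) + |t| / κ)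
          rwa [mul_zero] at this
        refine squeeze_zero' (Eventually.of_forall fun _ => norm_nonneg _) ?_ hz
        filter_upwards [hG, hα, hα2, hM, hy1, hm, ht 1, ht 3] with n g1 g2 g3 g4 g5 g6 g7 g8
        exact det_pt g1 (hc0 n) (hc n) (hcm n) g2 g3 hκ g5 g4 g6 g7 g8 t
      have hE2 : Tendsto (fun n => G n (t / σ n)) atTop
          (𝓝 ((Real.exp (-(1 / 2) * t ^ 2) : ℝ) : ℂ)) := by
        have := (Complex.continuous_exp.tendsto _).comp (hE.sub_const ((t ^ 2 / 2 : ℝ) : ℂ))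
        have e : Complex.exp (0 - ((t ^ 2 / 2 : ℝ) : ℂ)) = ((Real.exp (-(1 / 2) * t ^ 2) : ℝ) : ℂ) := by
          rw [Complex.ofReal_exp]; congr 1; push_cast; ring
        rw [e] at this
        refine this.congr fun n => ?_
        simp [hGdef]
      refine hE2.congr' ?_
      filter_upwards [hσtop.eventually_gt_atTop |t|, hσ0] with n g1 g2
      have : t ∈ Set.Ioc (-(π * σ n)) (π * σ n) := by
        have h3 : σ n ≤ π * σ n := by nlinarith [Real.pi_gt_three]
        have := abs_lt.1 (g1.trans_le h3)
        exact ⟨this.1, this.2.le⟩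
      simp [F, this]
  rw [integral_complex_ofReal, integral_gaussian] at hlim
  have e : π / (1 / 2) = 2 * π := by ring
  rw [e] at hlim
  exact hlim.congr' hFint

/-- Asymptotic verification of the hypotheses of `clt`. -/
theorem clt' {a : ℕ → ℝ} {c : ℕ → ℕ → ℝ} {α : ℕ → ℝ} {m : ℕ → ℕ} {ρ ε C₂ α₀ : ℝ} (hρ : 0 < ρ)
    (ha : ∀ N, 0 ≤ a N) (ha0 : a 0 = 0)
    (hsum : ∀ s : ℝ, ρ < s → Summable fun N : ℕ => a N * (N : ℝ) ^ (-s))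
    (hε : 0 < ε) (hC₂ : 0 < C₂) (hα₀ : 0 < α₀)
    (hM3 : ∀ x : ℝ, 0 < x → x ≤ α₀ → ∀ θ : ℝ, x < |θ| → |θ| ≤ π → C₂ * x ^ (-ε) ≤ sinS a x θ)
    (hc0 : ∀ n N, 0 ≤ c n N) (hc : ∀ n N, c n N ≤ a N) (hcm : ∀ n N, N ≤ m n → c n N = a N)
    (hα : Tendsto α atTop (𝓝[>] 0))
    (hm : (fun n : ℕ => (m n : ℝ)) ~[atTop] fun n : ℕ => ρ * (α n)⁻¹ * Real.log (α n)⁻¹) :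
    Tendsto (fun n => (√(mom a (α n) 2) : ℂ) * ∫ θ in (-π)..π,
      Complex.exp (Ph (c n) (α n) θ - Complex.I * ((mom a (α n) 1 * θ : ℝ) : ℂ))) atTop
      (𝓝 ((√(2 * π) : ℝ) : ℂ)) := by
  have hα0 : ∀ᶠ n in atTop, 0 < α n := by
    have := hα.eventually (self_mem_nhdsWithin)
    simpa using this
  have hα' : Tendsto α atTop (𝓝 0) := hα.mono_right nhdsWithin_le_nhds
  have hsmall : ∀ x : ℝ, 0 < x → ∀ᶠ n in atTop, α n ≤ x := fun x hx =>
    hα'.eventually_le_const hx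
  have hz : Tendsto (fun n => (α n)⁻¹) atTop atTop := tendsto_inv_nhdsGT_zero.comp hα
  have hlog : Tendsto (fun n => Real.log (α n)⁻¹) atTop atTop := Real.tendsto_log_atTop.comp hz
  set δ : ℝ := ε / 16 with hδ
  have hδ0 : 0 < δ := by positivity
  set y : ℕ → ℝ := fun n => α n ^ (-δ) with hyd
  have hyz : ∀ᶠ n in atTop, y n = (α n)⁻¹ ^ δ := by
    filter_upwards [hα0] with n hn
    simp only [hyd]
    rw [Real.rpow_neg hn.le, Real.inv_rpow hn.le]
  have hy : Tendsto y atTop atTop :=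
    ((tendsto_rpow_atTop hδ0).comp hz).congr' (hyz.mono fun n hn => hn.symm)
  have hs1 : (0 : ℝ) < ρ + 1 := by linarith
  -- m alpha versus log
  obtain ⟨φ, hφ, hmφ⟩ := hm.exists_eq_mul
  have hmα : ∀ᶠ n in atTop, (m n : ℝ) * α n = φ n * (ρ * Real.log (α n)⁻¹) := by
    filter_upwards [hmφ, hα0] with n h1 h2
    rw [h1]; simp only [Pi.mul_apply]; field_simp
  have hlow : ∀ η : ℝ, 0 < η → ∀ᶠ n in atTop,
      (1 - η) * (ρ * Real.log (α n)⁻¹) ≤ m n * α n := by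
    intro η hη
    filter_upwards [hmα, hφ.eventually_const_le (show 1 - η < 1 by linarith),
      hlog.eventually_ge_atTop 0] with n h1 h2 h3
    rw [h1]; gcongr
  have hup : ∀ᶠ n in atTop, (m n : ℝ) * α n ≤ 2 * (ρ * Real.log (α n)⁻¹) := by
    filter_upwards [hmα, hφ.eventually_le_const (show (1 : ℝ) < 2 by norm_num),
      hlog.eventually_ge_atTop 0] with n h1 h2 h3
    rw [h1]; gcongr
  refine clt (κ := √C₂) (y := y) (m := m) (Real.sqrt_pos.2 hC₂) hy hc0 hc hcm ?_ hα0 ?_ ?_ ?_ ?_ ?_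
  · filter_upwards [hα0] with n hn
    exact ⟨ha, fun j => summable_pow_exp ha ha0 hs1 (hsum _ (by linarith)) hn j⟩
  · filter_upwards [hsmall 1 one_pos] with n hn
    linarith [Real.pi_gt_three]
  · filter_upwards [hα0, hsmall α₀ hα₀] with n h1 h2 θ h3 h4
    refine le_trans (le_of_eq ?_) (hM3 _ h1 h2 θ h3 h4)
    rw [Real.sq_sqrt hC₂.le]
    congr 1
    simp only [hyd]
    rw [← Real.rpow_natCast, ← Real.rpow_mul h1.le]
    congr 1; rw [hδ]; push_cast; ring
  · have h1 := (isLittleO_log_rpow_atTop hδ0).comp_tendsto hz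
    have h2 := h1.bound (show 0 < 1 / (2 * ρ) by positivity)
    filter_upwards [h2, hup, hyz, hlog.eventually_ge_atTop 0, hα0] with n g1 g2 g3 g4 g5
    simp only [Function.comp_apply] at g1
    rw [Real.norm_of_nonneg g4, Real.norm_of_nonneg (by positivity), ← g3] at g1
    calc _ ≤ _ := g2
      _ ≤ 2 * (ρ * (1 / (2 * ρ) * y n)) := by gcongr
      _ = y n := by field_simp
  · intro j
    -- choose eta
    obtain ⟨η, hη0, hη1, hηδ⟩ : ∃ η : ℝ, 0 < η ∧ η < 1 ∧ η * (1 + 2 * ρ) < δ := by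
      refine ⟨min (1 / 2) (δ / (2 * (1 + 2 * ρ))), by positivity, ?_, ?_⟩
      · exact (min_le_left _ _).trans_lt (by norm_num)
      · calc _ ≤ δ / (2 * (1 + 2 * ρ)) * (1 + 2 * ρ) := by gcongr; exact min_le_right _ _
          _ = δ / 2 := by field_simp
          _ < δ := by linarith
    set s := ρ + η with hs
    have hs0 : 0 < s := by positivity
    have hss := hsum s (by linarith)
    set S := ∑' N : ℕ, a N * (N : ℝ) ^ (-s) with hS
    set K := (j + s) ^ (j + s) * η ^ (-(j + s)) * S with hK
    set e := δ - η - ρ + ρ * (1 - η) * (1 - η) with he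
    have he0 : 0 < e := by rw [he]; nlinarith [mul_pos hρ (mul_pos hη0 hη0)]
    have hKe : ∀ᶠ n in atTop, K * α n ^ e ≤ 1 := by
      have h1 : Tendsto (fun n => α n ^ e) atTop (𝓝 0) := by
        have := hα'.rpow_const (p := e) (Or.inr he0.le)
        rwa [Real.zero_rpow he0.ne'] at this
      have h2 := h1.const_mul K
      rw [mul_zero] at h2
      exact h2.eventually_le_const one_pos
    have hS0 : 0 ≤ S := tsum_nonneg fun N => by have := ha N; positivity
    filter_upwards [hα0, hKe, hlow η hη0] with n g1 g2 g3
    have h1 := tail_le ha ha0 hs0 hss hη0 hη1 g1 (m n) j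
    have h2 : Real.exp (-(m n * α n * (1 - η))) ≤ α n ^ (ρ * (1 - η) * (1 - η)) := by
      rw [Real.rpow_def_of_pos g1]
      apply Real.exp_le_exp.2
      rw [Real.log_inv] at g3
      have : (1 - η) * (ρ * -Real.log (α n)) * (1 - η) ≤ m n * α n * (1 - η) := by gcongr
      nlinarith
    calc tailS a (α n) (m n) j * α n ^ j
        ≤ ((((j + s) ^ (j + s) * (α n * η) ^ (-(j + s))) * α n ^ (ρ * (1 - η) * (1 - η))) * S)
          * α n ^ j := by
          gcongr
          refine h1.trans ?_
          gcongr
      _ = (K * α n ^ e) * y n := by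
          rw [Real.mul_rpow g1.le hη0.le, hK]
          simp only [hyd]
          have : α n ^ (-(j + s)) * α n ^ (ρ * (1 - η) * (1 - η)) * α n ^ j = α n ^ e * α n ^ (-δ) := by
            rw [← Real.rpow_natCast, ← Real.rpow_add g1, ← Real.rpow_add g1, ← Real.rpow_add g1]
            congr 1; rw [he, hs]; ring
          linear_combination ((j + s) ^ (j + s) * η ^ (-(j + s)) * S) * this
      _ ≤ 1 * y n := by gcongr
      _ = y n := one_mul _
  · set s := ρ + 1 with hs
    have hss := hsum s (by linarith)
    set S := ∑' N : ℕ, a N * (N : ℝ) ^ (-s) with hS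
    set K := ((2 : ℕ) + s) ^ ((2 : ℕ) + s) * (1 / 2 : ℝ) ^ (-((2 : ℕ) + s)) * S with hK
    have hl : Tendsto (fun n => (1 + π ^ 2 * (K * y n ^ (((2 : ℕ) + s) / δ))) * Real.exp (-2 * y n))
        atTop (𝓝 0) := by
      have h1 := (tendsto_rpow_mul_exp_neg_mul_atTop_nhds_zero 0 2 two_pos).comp hy
      have h2 := (tendsto_rpow_mul_exp_neg_mul_atTop_nhds_zero (((2 : ℕ) + s) / δ) 2 two_pos).comp hy
      have h3 := h1.add (h2.const_mul (π ^ 2 * K))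
      simp only [mul_zero, add_zero] at h3
      refine h3.congr fun n => ?_
      simp only [Function.comp_apply, Real.rpow_zero]
      ring
    filter_upwards [hl.eventually_le_const one_pos, hα0, hy.eventually_ge_atTop 1] with n g1 g2 g3
    refine le_trans ?_ g1
    have hB : mom a (α n) 2 ≤ K * y n ^ (((2 : ℕ) + s) / δ) := by
      refine (full_le ha ha0 hs1 hss g2 2).trans (le_of_eq ?_)
      rw [Real.mul_rpow g2.le (by norm_num), hK]
      simp only [hyd]
      rw [← Real.rpow_mul g2.le]
      have : -δ * (((2 : ℕ) + s) / δ) = -((2 : ℕ) + s) := by field_simp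
      rw [this]; ring
    have hB0 : 0 ≤ mom a (α n) 2 := tsum_nonneg fun N => by have := ha N; positivity
    have hy8 : y n ≤ y n ^ 8 := le_self_pow₀ g3 (by norm_num)
    have hE : Real.exp (-2 * y n ^ 8) ≤ Real.exp (-2 * y n) := Real.exp_le_exp.2 (by linarith)
    have hP : 1 + π ^ 2 * mom a (α n) 2 ≤ 1 + π ^ 2 * (K * y n ^ (((2 : ℕ) + s) / δ)) := by
      gcongr
    exact mul_le_mul hP hE (Real.exp_pos _).le (le_trans (by positivity) hP)

/-! ### Power series -/

/-- `a_N = ∑_{kj = N} b_k / j`, the Taylor coefficients of `F_b`. -/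
def aco (b : ℕ → ℝ) (N : ℕ) : ℝ := ∑ q ∈ N.divisorsAntidiagonal, b q.1 * (1 / (q.2 : ℝ))

theorem hasSum_antidiag (g : ℕ → ℕ → ℝ) {S : ℝ}
    (h : HasSum (fun q : ℕ × ℕ => g (q.1 + 1) (q.2 + 1)) S) :
    HasSum (fun n : ℕ => ∑ q ∈ n.divisorsAntidiagonal, g q.1 q.2) S := by
  have h1 : HasSum (fun q : ℕ+ × ℕ+ => g q.1 q.2) S := by
    rw [← (Equiv.prodCongr Equiv.pnatEquivNat Equiv.pnatEquivNat).symm.hasSum_iff]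
    refine Eq.mp (congrArg (fun f => HasSum f S) ?_) h
    funext q
    rfl
  have h2 := (sigmaAntidiagonalEquivProd.hasSum_iff.2 h1).sigma (fun n => hasSum_fintype _)
  rw [← PNat.coe_injective.hasSum_iff]
  · convert h2 using 2 with n
    rw [Function.comp_apply, ← Finset.sum_coe_sort]
    rfl
  · intro x hx
    have : x = 0 := by
      by_contra h0
      exact hx ⟨⟨x, Nat.pos_of_ne_zero h0⟩, rfl⟩
    simp [this]

theorem aco_zero (b : ℕ → ℝ) : aco b 0 = 0 := by simp [aco]

theorem aco_nonneg {b : ℕ → ℝ} (hb : ∀ k, 0 ≤ b k) (N : ℕ) : 0 ≤ aco b N :=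
  Finset.sum_nonneg fun q _ => mul_nonneg (hb _) (by positivity)

theorem le_aco {b : ℕ → ℝ} (hb : ∀ k, 0 ≤ b k) {N : ℕ} (hN : N ≠ 0) : b N ≤ aco b N := by
  have := Finset.single_le_sum (f := fun q : ℕ × ℕ => b q.1 * (1 / (q.2 : ℝ)))
    (s := N.divisorsAntidiagonal) (fun q _ => mul_nonneg (hb _) (by positivity))
    (a := (N, 1)) (by simp [hN])
  simpa [aco] using this

theorem aco_summable {b : ℕ → ℝ} (hb : ∀ k, 0 ≤ b k) {s : ℝ} (hs : 0 < s)
    (hsum : Summable fun k : ℕ => b (k + 1) * ((k + 1 : ℕ) : ℝ) ^ (-s)) :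
    Summable fun N : ℕ => aco b N * (N : ℝ) ^ (-s) := by
  have h1 : Summable fun j : ℕ => ((j + 1 : ℕ) : ℝ) ^ (-(1 + s)) := by
    have := Real.summable_nat_rpow (p := -(1 + s)) |>.2 (by linarith)
    exact (summable_nat_add_iff 1).2 this
  have h2 := hsum.mul_of_nonneg h1 (fun k => mul_nonneg (hb _) (by positivity))
    (fun j => by positivity)
  have h3 := hasSum_antidiag (fun k j => b k * (k : ℝ) ^ (-s) * (j : ℝ) ^ (-(1 + s))) h2.hasSum
  refine h3.summable.congr fun N => ?_
  rw [aco, Finset.sum_mul]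
  refine Finset.sum_congr rfl fun q hq => ?_
  obtain ⟨hq1, hq2⟩ := Nat.mem_divisorsAntidiagonal.1 hq
  have hq3 : 0 < q.2 := Nat.pos_of_ne_zero (by rintro h; simp [h] at hq1; omega)
  have hq4 : (0 : ℝ) < q.2 := by exact_mod_cast hq3
  rw [← hq1]; push_cast
  rw [Real.mul_rpow (by positivity) (by positivity), neg_add, Real.rpow_add hq4, Real.rpow_neg_one]
  ring

theorem exists_exp_ge {x : ℝ} (hx : |x| < 1) : ∃ α : ℝ, 0 < α ∧ |x| ≤ Real.exp (-α) :=
  ⟨1 - |x|, by linarith, by have := Real.add_one_le_exp (-(1 - |x|)); linarith⟩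

theorem b_summable_s15 {b : ℕ → ℝ} (hb : ∀ k, 0 ≤ b k) {s : ℝ} (hs : 0 < s)
    (hsum : Summable fun k : ℕ => b (k + 1) * ((k + 1 : ℕ) : ℝ) ^ (-s)) {x : ℝ} (hx : |x| < 1) :
    Summable fun k : ℕ => b (k + 1) * |x| ^ (k + 1) := by
  obtain ⟨α, hα, hxα⟩ := exists_exp_ge hx
  have h1 : Summable fun N : ℕ => (if N = 0 then 0 else b N) * (N : ℝ) ^ (-s) := by
    rw [← summable_nat_add_iff 1]
    simpa using hsum
  have h2 := summable_pow_exp (a := fun N => if N = 0 then 0 else b N)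
    (fun N => by split_ifs; exacts [le_rfl, hb N]) (by simp) hs h1 hα 0
  rw [← summable_nat_add_iff 1] at h2
  refine Summable.of_nonneg_of_le (fun k => mul_nonneg (hb _) (by positivity)) (fun k => ?_) h2
  have := hb (k + 1)
  simp only [pow_zero, one_mul, Nat.add_eq_zero_iff, one_ne_zero, and_false, if_false]
  gcongr
  calc |x| ^ (k + 1) ≤ Real.exp (-α) ^ (k + 1) := by gcongr
    _ = Real.exp (-(((k + 1 : ℕ) : ℝ) * α)) := by rw [← Real.exp_nat_mul]; congr 1; ring

theorem Fb_hasSum {b : ℕ → ℝ} (hb : ∀ k, 0 ≤ b k) {s : ℝ} (hs : 0 < s)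
    (hsum : Summable fun k : ℕ => b (k + 1) * ((k + 1 : ℕ) : ℝ) ^ (-s)) {x : ℝ} (hx : |x| < 1) :
    HasSum (fun N : ℕ => aco b N * x ^ N) (Fb b x) := by
  have hsm : Summable fun q : ℕ × ℕ =>
      b (q.1 + 1) * (1 / ((q.2 + 1 : ℕ) : ℝ)) * x ^ ((q.1 + 1) * (q.2 + 1)) := by
    have h1 := (b_summable_s15 hb hs hsum hx).mul_of_nonneg
      (summable_geometric_of_lt_one (abs_nonneg x) hx)
      (fun k => mul_nonneg (hb _) (by positivity)) (fun j => by positivity)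
    refine Summable.of_norm_bounded h1 fun q => ?_
    have hb1 := hb (q.1 + 1)
    rw [norm_mul, norm_mul, norm_pow, Real.norm_of_nonneg hb1, Real.norm_of_nonneg (by positivity),
      Real.norm_eq_abs, mul_assoc, mul_assoc]
    refine mul_le_mul_of_nonneg_left ?_ hb1
    calc 1 / ((q.2 + 1 : ℕ) : ℝ) * |x| ^ ((q.1 + 1) * (q.2 + 1))
        ≤ 1 * |x| ^ ((q.1 + 1) * (q.2 + 1)) := by
          gcongr
          rw [div_le_one (by positivity)]
          push_cast; linarith [(Nat.cast_nonneg q.2 : (0 : ℝ) ≤ q.2)]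
      _ ≤ |x| ^ ((q.1 + 1) + q.2) := by
          rw [one_mul]
          exact pow_le_pow_of_le_one (abs_nonneg _) hx.le (by nlinarith [Nat.zero_le (q.1 * q.2)])
      _ = _ := pow_add _ _ _
  have h1 := hasSum_antidiag (fun k j => b k * (1 / (j : ℝ)) * x ^ (k * j)) hsm.hasSum
  have h2 := hsm.hasSum.prod_fiberwise (g := fun k => b (k + 1) * -Real.log (1 - x ^ (k + 1))) ?_
  · have e : Fb b x = ∑' q : ℕ × ℕ,
        b (q.1 + 1) * (1 / ((q.2 + 1 : ℕ) : ℝ)) * x ^ ((q.1 + 1) * (q.2 + 1)) := by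
      rw [← h2.tsum_eq, Fb, ← tsum_neg]
      congr 1; ext k; ring
    rw [e]
    refine h1.congr_fun ?_ |> fun h => h
    intro N
    rw [aco, Finset.sum_mul]
    refine Finset.sum_congr rfl fun q hq => ?_
    rw [(Nat.mem_divisorsAntidiagonal.1 hq).1]
  · intro k
    have hxk : |x ^ (k + 1)| < 1 := by
      rw [abs_pow]; exact pow_lt_one₀ (abs_nonneg _) hx (by omega)
    have := (Real.hasSum_pow_div_log_of_abs_lt_one hxk).mul_left (b (k + 1))
    refine Eq.mp (congrArg (fun f => HasSum f _) ?_) this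
    funext j
    push_cast
    rw [pow_mul]; ring

def btr (b : ℕ → ℝ) (m k : ℕ) : ℝ := if k ≤ m then b k else 0

theorem Fb_btr (b : ℕ → ℝ) (m : ℕ) (x : ℝ) : Fb (btr b m) x = Fmb b m x := by
  rw [Fb, Fmb, tsum_eq_sum (s := Finset.range m)]
  · congr 1
    rw [Finset.range_eq_Ico, Finset.sum_Ico_add' (fun k => btr b m k * Real.log (1 - x ^ k)) 0 m 1]
    refine Finset.sum_congr (by ext; simp) fun k hk => ?_
    rw [btr, if_pos (Finset.mem_Icc.1 hk).2]
  · intro k hk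
    rw [btr, if_neg (by simp at hk; omega), zero_mul]

theorem btr_nonneg {b : ℕ → ℝ} (hb : ∀ k, 0 ≤ b k) (m k : ℕ) : 0 ≤ btr b m k := by
  rw [btr]; split_ifs; exacts [hb k, le_rfl]

theorem btr_le {b : ℕ → ℝ} (hb : ∀ k, 0 ≤ b k) (m k : ℕ) : btr b m k ≤ b k := by
  rw [btr]; split_ifs; exacts [le_rfl, hb k]

theorem aco_btr_le {b : ℕ → ℝ} (hb : ∀ k, 0 ≤ b k) (m N : ℕ) : aco (btr b m) N ≤ aco b N :=
  Finset.sum_le_sum fun q _ => mul_le_mul_of_nonneg_right (btr_le hb m _) (by positivity)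

theorem aco_btr_eq (b : ℕ → ℝ) {m N : ℕ} (hN : N ≤ m) : aco (btr b m) N = aco b N := by
  refine Finset.sum_congr rfl fun q hq => ?_
  obtain ⟨hq1, hq2⟩ := Nat.mem_divisorsAntidiagonal.1 hq
  have : q.1 ≤ N := Nat.le_of_dvd (Nat.pos_of_ne_zero hq2) ⟨q.2, hq1.symm⟩
  rw [btr, if_pos (this.trans hN)]

theorem differentiableOn_ps {d : ℕ → ℝ} (hd : ∀ x : ℝ, |x| < 1 → Summable fun j : ℕ => d j * x ^ j) :
    DifferentiableOn ℂ (fun z : ℂ => ∑' j : ℕ, (d j : ℂ) * z ^ j) (Metric.ball 0 1) := by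
  intro z hz
  have hz1 : ‖z‖ < 1 := by simpa using hz
  obtain ⟨R, hR1, hR2⟩ := exists_between hz1
  have hR0 : 0 ≤ R := (norm_nonneg z).trans hR1.le
  have h1 := (hd R (by rwa [abs_of_nonneg hR0])).abs
  have h2 : DifferentiableOn ℂ (fun z : ℂ => ∑' j : ℕ, (d j : ℂ) * z ^ j) (Metric.ball 0 R) := by
    refine Complex.differentiableOn_tsum_of_summable_norm h1 (fun j => by fun_prop)
      Metric.isOpen_ball fun j w hw => ?_
    have hw1 : ‖w‖ ≤ R := by simpa using (Metric.mem_ball.1 hw).le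
    rw [norm_mul, norm_pow, Complex.norm_real, abs_mul, abs_pow, abs_of_nonneg hR0, Real.norm_eq_abs]
    gcongr
  exact (h2.differentiableAt (Metric.isOpen_ball.mem_nhds (by simpa using hR1))).differentiableWithinAt

theorem ps_identity {c q : ℕ → ℝ} {Fc : ℝ → ℝ}
    (hc : ∀ x : ℝ, |x| < 1 → HasSum (fun N : ℕ => c N * x ^ N) (Fc x))
    (hq : ∀ x : ℝ, |x| < 1 → HasSum (fun N : ℕ => q N * x ^ N) (Real.exp (Fc x))) {z : ℂ}
    (hz : ‖z‖ < 1) :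
    ∑' j : ℕ, (q j : ℂ) * z ^ j = Complex.exp (∑' N : ℕ, (c N : ℂ) * z ^ N) := by
  have h1 := (differentiableOn_ps (fun x hx => (hq x hx).summable)).analyticOnNhd Metric.isOpen_ball
  have h2 := ((differentiableOn_ps (fun x hx => (hc x hx).summable)).cexp).analyticOnNhd
    Metric.isOpen_ball
  refine h1.eqOn_of_preconnected_of_frequently_eq h2 (convex_ball _ _).isPreconnected
    (z₀ := 0) (by simp) ?_ (by simpa using hz)
  have key : ∀ x : ℝ, |x| < 1 → (∑' j : ℕ, (q j : ℂ) * (x : ℂ) ^ j) =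
      Complex.exp (∑' N : ℕ, (c N : ℂ) * (x : ℂ) ^ N) := by
    intro x hx
    have e1 := Complex.hasSum_ofReal.2 (hq x hx)
    have e2 := Complex.hasSum_ofReal.2 (hc x hx)
    push_cast at e1 e2
    rw [e1.tsum_eq, e2.tsum_eq]
  have ht : Tendsto (fun n : ℕ => (((1 : ℝ) / ((n : ℝ) + 1) : ℝ) : ℂ)) atTop (𝓝[≠] 0) := by
    rw [tendsto_nhdsWithin_iff]
    constructor
    · have := (Complex.continuous_ofReal.tendsto 0).comp
        (tendsto_one_div_add_atTop_nhds_zero_nat (𝕜 := ℝ))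
      simpa [Function.comp_def] using this
    · refine Eventually.of_forall fun n => ?_
      simp only [Set.mem_compl_iff, Set.mem_singleton_iff, Complex.ofReal_eq_zero]
      positivity
  refine ht.frequently (Eventually.frequently ?_)
  filter_upwards [eventually_gt_atTop 0] with n hn
  apply key
  rw [abs_of_pos (by positivity), div_lt_one (by positivity)]
  have : (0 : ℝ) < n := by exact_mod_cast hn
  linarith

theorem int_exp (k : ℤ) : ∫ θ in (-π)..π, Complex.exp (Complex.I * k * θ) =
    if k = 0 then (2 * π : ℂ) else 0 := by
  split_ifs with h
  · subst h
    simp; ring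
  · have hk : Complex.I * (k : ℂ) ≠ 0 := mul_ne_zero Complex.I_ne_zero (by exact_mod_cast h)
    rw [integral_exp_mul_complex hk]
    have : Complex.exp (Complex.I * k * (π : ℝ)) = Complex.exp (Complex.I * k * ((-π : ℝ) : ℂ)) := by
      rw [Complex.exp_eq_exp_iff_exists_int]
      exact ⟨k, by push_cast; ring⟩
    rw [this, sub_self, zero_div]

theorem coeff_integral {c q : ℕ → ℝ} {Fc : ℝ → ℝ}
    (hc : ∀ x : ℝ, |x| < 1 → HasSum (fun N : ℕ => c N * x ^ N) (Fc x))
    (hq : ∀ x : ℝ, |x| < 1 → HasSum (fun N : ℕ => q N * x ^ N) (Real.exp (Fc x))) {α : ℝ}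
    (hα : 0 < α) (hg : Good c α) (n : ℕ) :
    ∫ θ in (-π)..π, Complex.exp (Ph c α θ - Complex.I * (((n : ℝ) * θ : ℝ) : ℂ)) =
      ((2 * π * (q n * Real.exp (-α) ^ n * Real.exp (-Fc (Real.exp (-α)))) : ℝ) : ℂ) := by
  set r := Real.exp (-α) with hr
  have hr0 : 0 < r := Real.exp_pos _
  have hr1 : |r| < 1 := by rw [abs_of_pos hr0, hr]; exact Real.exp_lt_one_iff.2 (by linarith)
  have hrN : ∀ N : ℕ, Real.exp (-(N * α)) = r ^ N := fun N => by
    rw [hr, ← Real.exp_nat_mul]; congr 1; ring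
  have hPh : ∀ θ : ℝ, Complex.exp (Ph c α θ) = (∑' j : ℕ, (q j : ℂ) * ((r : ℂ) * Complex.exp (Complex.I * θ)) ^ j)
      * ((Real.exp (-Fc r) : ℝ) : ℂ) := by
    intro θ
    set z := (r : ℂ) * Complex.exp (Complex.I * θ) with hzd
    have hz : ‖z‖ < 1 := by
      rw [hzd, norm_mul, Complex.norm_exp_I_mul_ofReal, mul_one, Complex.norm_real]; exact hr1
    rw [ps_identity hc hq hz, Complex.ofReal_exp, ← Complex.exp_add]
    congr 1
    have e2 := Complex.hasSum_ofReal.2 (hc r hr1)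
    have e1 := (hg.smPh θ).hasSum.add e2
    have e3 : (fun N : ℕ => (c N : ℂ) * z ^ N) = fun N : ℕ => ((c N * Real.exp (-(N * α)) : ℝ) : ℂ) *
      (Complex.exp (Complex.I * ((N * θ : ℝ) : ℂ)) - 1) + ((c N * r ^ N : ℝ) : ℂ) := by
      ext N
      rw [hrN, hzd, mul_pow, ← Complex.exp_nat_mul]
      have : (N : ℂ) * (Complex.I * θ) = Complex.I * ((N * θ : ℝ) : ℂ) := by push_cast; ring
      rw [this]; push_cast; ring
    rw [e3, e1.tsum_eq, Ph]; push_cast; ring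
  have hsm : Summable fun j : ℕ => |q j * r ^ j| := (hq r hr1).summable.abs
  have hF := intervalIntegral.hasSum_integral_of_dominated_convergence (a := -π) (b := π)
    (μ := volume) (F := fun (j : ℕ) (θ : ℝ) => ((q j * r ^ j : ℝ) : ℂ) *
      Complex.exp (Complex.I * (((j : ℤ) - (n : ℤ) : ℤ) : ℂ) * θ))
    (f := fun θ : ℝ => (∑' j : ℕ, (q j : ℂ) * ((r : ℂ) * Complex.exp (Complex.I * θ)) ^ j)
      * Complex.exp (-(Complex.I * (((n : ℝ) * θ : ℝ) : ℂ))))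
    (fun j _ => |q j * r ^ j|)
    (fun j => (by fun_prop : Continuous _).aestronglyMeasurable)
    (fun j => Eventually.of_forall fun θ _ => by
      have : Complex.I * (((j : ℤ) - (n : ℤ) : ℤ) : ℂ) * θ
        = Complex.I * (((((j : ℤ) - (n : ℤ) : ℤ) : ℝ) * θ : ℝ) : ℂ) := by push_cast; ring
      rw [norm_mul, this, Complex.norm_exp_I_mul_ofReal, mul_one, Complex.norm_real,
        Real.norm_eq_abs])
    (Eventually.of_forall fun θ _ => hsm)
    (by simp)
    (Eventually.of_forall fun θ _ => by
      set z := (r : ℂ) * Complex.exp (Complex.I * θ) with hzd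
      have hz : ‖z‖ = r := by
        rw [hzd, norm_mul, Complex.norm_exp_I_mul_ofReal, mul_one, Complex.norm_real,
          Real.norm_of_nonneg hr0.le]
      have hs : Summable fun j : ℕ => (q j : ℂ) * z ^ j := by
        refine Summable.of_norm_bounded hsm fun j => ?_
        rw [norm_mul, norm_pow, hz, Complex.norm_real, Real.norm_eq_abs, abs_mul, abs_pow,
          abs_of_pos hr0]
      have := hs.hasSum.mul_right (Complex.exp (-(Complex.I * (((n : ℝ) * θ : ℝ) : ℂ))))
      refine Eq.mp (congrArg (fun f => HasSum f _) ?_) this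
      funext j
      rw [hzd, mul_pow, ← Complex.exp_nat_mul]
      push_cast
      rw [mul_assoc, mul_assoc, mul_assoc, ← Complex.exp_add]
      congr 3
      ring)
  simp only [intervalIntegral.integral_const_mul, int_exp] at hF
  have hF2 := hF.unique (hasSum_single n (fun j hj => by
    rw [if_neg (by omega), mul_zero]))
  have hI : (fun θ : ℝ => Complex.exp (Ph c α θ - Complex.I * (((n : ℝ) * θ : ℝ) : ℂ))) = fun θ : ℝ =>
      ((Real.exp (-Fc r) : ℝ) : ℂ) * ((∑' j : ℕ, (q j : ℂ) * ((r : ℂ) * Complex.exp (Complex.I * θ)) ^ j)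
      * Complex.exp (-(Complex.I * (((n : ℝ) * θ : ℝ) : ℂ)))) := by
    ext θ
    rw [sub_eq_add_neg, Complex.exp_add, hPh]; ring
  rw [hI, intervalIntegral.integral_const_mul, hF2, sub_self, if_pos rfl]
  push_cast; ring

theorem Abf_eq {b a : ℕ → ℝ} (ha : ∀ N, 0 ≤ a N)
    (hF : ∀ x : ℝ, |x| < 1 → HasSum (fun N : ℕ => a N * x ^ N) (Fb b x))
    (hg : ∀ α : ℝ, 0 < α → Good a α) {α : ℝ} (hα : 0 < α) :
    Abf b (Real.exp (-α)) = mom a α 1 := by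
  set r := Real.exp (-α) with hr
  have hr0 : 0 < r := Real.exp_pos _
  have hrN : ∀ N : ℕ, Real.exp (-(N * α)) = r ^ N := fun N => by
    rw [hr, ← Real.exp_nat_mul]; congr 1; ring
  set R := Real.exp (-(α / 2)) with hR
  have hR0 : 0 < R := Real.exp_pos _
  have hRN : ∀ N : ℕ, Real.exp (-(N * (α / 2))) = R ^ N := fun N => by
    rw [hR, ← Real.exp_nat_mul]; congr 1; ring
  have hrR : r < R := Real.exp_lt_exp.2 (by linarith)
  have hR1 : R < 1 := Real.exp_lt_one_iff.2 (by linarith)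
  have hu : Summable fun N : ℕ => a N * (N * R ^ (N - 1)) := by
    have := ((hg (α / 2) (by linarith)).sm 1).mul_left R⁻¹
    refine this.congr fun N => ?_
    rw [hRN]
    rcases N with _ | N
    · simp
    · simp only [pow_one, Nat.add_sub_cancel, pow_succ]; field_simp
  have hd := hasDerivAt_tsum_of_isPreconnected (g := fun (N : ℕ) (x : ℝ) => a N * x ^ N)
    (g' := fun (N : ℕ) (x : ℝ) => a N * (N * x ^ (N - 1))) (t := Set.Ioo (-R) R) (y₀ := r) (y := r)
    hu isOpen_Ioo isPreconnected_Ioo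
    (fun N x _ => (hasDerivAt_pow N x).const_mul (a N))
    (fun N x hx => by
      have hx1 : |x| ≤ R := (abs_lt.2 hx).le
      have := ha N
      rw [norm_mul, norm_mul, norm_pow, Real.norm_of_nonneg this, Real.norm_natCast, Real.norm_eq_abs]
      gcongr)
    ⟨by linarith, hrR⟩ (hF r (by rw [abs_of_pos hr0]; linarith)).summable ⟨by linarith, hrR⟩
  have he : Fb b =ᶠ[𝓝 r] fun z => ∑' N : ℕ, a N * z ^ N := by
    filter_upwards [isOpen_Ioo.mem_nhds (show r ∈ Set.Ioo (-R) R from ⟨by linarith, hrR⟩)] with x hx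
    exact ((hF x ((abs_lt.2 hx).trans hR1)).tsum_eq).symm
  rw [Abf, (hd.congr_of_eventuallyEq he).deriv, mom, ← tsum_mul_left]
  congr 1; ext N
  rw [hrN]
  rcases N with _ | N
  · simp
  · simp only [pow_one, Nat.add_sub_cancel, pow_succ]; ring

/-! ### The theorem -/

theorem M1_summable {b : ℕ → ℝ} (hb : ∀ k, 0 ≤ b k) {ρ C₀ A : ℝ} {Dc : ℂ → ℂ}
    (h1 : M1 b ρ C₀ A Dc) {s : ℝ} (hs : ρ < s) :
    Summable fun k : ℕ => b (k + 1) * ((k + 1 : ℕ) : ℝ) ^ (-s) := by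
  have h := (h1.2.2.2.2.1 (s : ℂ) (by simpa using hs)).summable.norm
  refine h.congr fun k => ?_
  rw [norm_mul, Complex.norm_real, Real.norm_of_nonneg (hb _),
    Complex.norm_natCast_cpow_of_pos (by omega)]
  simp

theorem M3_aco {b : ℕ → ℝ} (hb : ∀ k, 0 ≤ b k) {x θ : ℝ} (hg : Good (aco b) x) :
    ∑' k : ℕ, b (k + 1) * Real.exp (-((k : ℝ) + 1) * x) *
      Real.sin (π * ((k : ℝ) + 1) * (θ / (2 * π))) ^ 2 ≤ sinS (aco b) x θ := by
  have hs := hg.smSin θ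
  have hs1 := (summable_nat_add_iff 1).2 hs
  rw [sinS, hs.tsum_eq_zero_add]
  have h0 : aco b 0 * Real.exp (-(((0 : ℕ) : ℝ) * x)) * Real.sin (((0 : ℕ) : ℝ) * θ / 2) ^ 2 = 0 := by
    rw [aco_zero]; ring
  rw [h0, zero_add]
  have hle : ∀ k : ℕ, b (k + 1) * Real.exp (-((k : ℝ) + 1) * x) *
      Real.sin (π * ((k : ℝ) + 1) * (θ / (2 * π))) ^ 2 ≤
      aco b (k + 1) * Real.exp (-(((k + 1 : ℕ) : ℝ) * x)) *
        Real.sin (((k + 1 : ℕ) : ℝ) * θ / 2) ^ 2 := by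
    intro k
    have e1 : π * ((k : ℝ) + 1) * (θ / (2 * π)) = ((k + 1 : ℕ) : ℝ) * θ / 2 := by
      push_cast; field_simp
    have e2 : -((k : ℝ) + 1) * x = -(((k + 1 : ℕ) : ℝ) * x) := by push_cast; ring
    rw [e1, e2]
    have := le_aco hb (N := k + 1) (by omega)
    gcongr
  refine Summable.tsum_le_tsum hle ?_ hs1
  refine Summable.of_nonneg_of_le (fun k => ?_) hle hs1
  have := hb (k + 1)
  positivity

theorem statement15    (b : ℕ → ℝ) (hb : ∀ k, 0 ≤ b k) (ρ C₀ A C₁ : ℝ) (Dc : ℂ → ℂ)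
    (h1 : M1 b ρ C₀ A Dc) (h2 : M2 C₀ C₁ Dc) (h3 : M3 b)
    (α : ℕ → ℝ) (hα : ∀ᶠ n : ℕ in atTop, 0 < α n ∧ Abf b (Real.exp (-α n)) = n)
    (m : ℕ → ℕ)
    (hm : (fun n : ℕ => (m n : ℝ)) ~[atTop] fun n : ℕ => ρ * (α n)⁻¹ * Real.log (α n)⁻¹)
    (p : ℕ → ℝ) (hp : ∀ x : ℝ, |x| < 1 → HasSum (fun n : ℕ => p n * x ^ n) (fb b x))
    (pm : ℕ → ℕ → ℝ)
    (hpm : ∀ m' : ℕ, ∀ x : ℝ, |x| < 1 → HasSum (fun n : ℕ => pm m' n * x ^ n) (fmb b m' x)) :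
    (fun n : ℕ => pm (m n) n / p n) ~[atTop] fun n : ℕ =>
      Real.exp (Fmb b (m n) (Real.exp (-α n)) - Fb b (Real.exp (-α n))) := by
  have hρ : 0 < ρ := h1.1
  obtain ⟨ε, C₂, hε, hC₂, α₀, hα₀, hM3⟩ := h3
  have hbs : ∀ s : ℝ, ρ < s → Summable fun k : ℕ => b (k + 1) * ((k + 1 : ℕ) : ℝ) ^ (-s) :=
    fun s hs => M1_summable hb h1 hs
  have ha : ∀ N, 0 ≤ aco b N := aco_nonneg hb
  have ha0 : aco b 0 = 0 := aco_zero b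
  have hsum : ∀ s : ℝ, ρ < s → Summable fun N : ℕ => aco b N * (N : ℝ) ^ (-s) :=
    fun s hs => aco_summable hb (hρ.trans hs) (hbs s hs)
  have hs1 : (0 : ℝ) < ρ + 1 := by linarith
  have hb1 := hbs (ρ + 1) (by linarith)
  have hg : ∀ x : ℝ, 0 < x → Good (aco b) x := fun x hx =>
    ⟨ha, fun j => summable_pow_exp ha ha0 hs1 (hsum _ (by linarith)) hx j⟩
  have hF : ∀ x : ℝ, |x| < 1 → HasSum (fun N : ℕ => aco b N * x ^ N) (Fb b x) :=
    fun x hx => Fb_hasSum hb hs1 hb1 hx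
  have hFm : ∀ m' : ℕ, ∀ x : ℝ, |x| < 1 →
      HasSum (fun N : ℕ => aco (btr b m') N * x ^ N) (Fmb b m' x) := by
    intro m' x hx
    rw [← Fb_btr]
    refine Fb_hasSum (btr_nonneg hb m') hs1 ?_ hx
    refine Summable.of_nonneg_of_le (fun k => mul_nonneg (btr_nonneg hb m' _) (by positivity))
      (fun k => ?_) hb1
    exact mul_le_mul_of_nonneg_right (btr_le hb m' _) (by positivity)
  have hmom : ∀ᶠ n : ℕ in atTop, 0 < α n ∧ mom (aco b) (α n) 1 = n := by
    filter_upwards [hα] with n hn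
    exact ⟨hn.1, by rw [← Abf_eq ha hF hg hn.1, hn.2]⟩
  have hαt : Tendsto α atTop (𝓝[>] 0) := by
    rw [tendsto_nhdsWithin_iff]
    refine ⟨?_, hmom.mono fun n hn => hn.1⟩
    refine tendsto_order.2 ⟨fun x hx => hmom.mono fun n hn => hx.trans hn.1, fun x hx => ?_⟩
    filter_upwards [hmom, tendsto_natCast_atTop_atTop.eventually_gt_atTop (mom (aco b) x 1)]
      with n hn hn2
    by_contra hlt
    push Not at hlt
    have : mom (aco b) (α n) 1 ≤ mom (aco b) x 1 := by
      refine Summable.tsum_le_tsum (fun N => ?_) ((hg _ hn.1).sm 1) ((hg x hx).sm 1)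
      have := ha N
      gcongr
    linarith [hn.2]
  have hM3' : ∀ x : ℝ, 0 < x → x ≤ α₀ → ∀ θ : ℝ, x < |θ| → |θ| ≤ π →
      C₂ * x ^ (-ε) ≤ sinS (aco b) x θ := by
    intro x hx hx0 θ h4 h5
    have hπ : (0 : ℝ) < 2 * π := by positivity
    have e : |θ / (2 * π)| = |θ| / (2 * π) := by rw [abs_div, abs_of_pos hπ]
    refine (hM3 x hx hx0 (θ / (2 * π)) ?_ ?_).trans (M3_aco hb (hg x hx))
    · rw [e]; gcongr
    · rw [e, div_le_iff₀ hπ]; linarith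
  have c1 := clt' (c := fun _ => aco b) hρ ha ha0 hsum hε hC₂ hα₀ hM3' (fun _ => ha)
    (fun _ _ => le_rfl) (fun _ _ _ => rfl) hαt hm
  have c2 := clt' (c := fun n => aco (btr b (m n))) hρ ha ha0 hsum hε hC₂ hα₀ hM3'
    (fun n => aco_nonneg (btr_nonneg hb _)) (fun n => aco_btr_le hb _)
    (fun n N hN => aco_btr_eq b hN) hαt hm
  set σ : ℕ → ℝ := fun n => √(mom (aco b) (α n) 2) with hσ
  set r : ℕ → ℝ := fun n => Real.exp (-α n) with hr
  set R : ℕ → ℝ := fun n => σ n * (2 * π * (p n * r n ^ n * Real.exp (-Fb b (r n)))) with hR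
  set Rm : ℕ → ℝ := fun n => σ n * (2 * π * (pm (m n) n * r n ^ n *
    Real.exp (-Fmb b (m n) (r n)))) with hRm
  have hre : ∀ {f : ℕ → ℂ} {g : ℕ → ℝ}, Tendsto f atTop (𝓝 ((√(2 * π) : ℝ) : ℂ)) →
      (∀ᶠ n in atTop, f n = ((g n : ℝ) : ℂ)) → Tendsto g atTop (𝓝 (√(2 * π))) := by
    intro f g hf hfg
    have := (Complex.continuous_re.tendsto _).comp hf
    rw [Complex.ofReal_re] at this
    refine this.congr' ?_
    filter_upwards [hfg] with n hn
    simp [hn]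
  have t1 : Tendsto R atTop (𝓝 (√(2 * π))) := by
    refine hre c1 ?_
    filter_upwards [hmom] with n hn
    rw [hn.2, coeff_integral hF hp hn.1 (hg _ hn.1) n, ← Complex.ofReal_mul]
  have t2 : Tendsto Rm atTop (𝓝 (√(2 * π))) := by
    refine hre c2 ?_
    filter_upwards [hmom] with n hn
    rw [hn.2, coeff_integral (hFm (m n)) (hpm (m n)) hn.1
      ((hg _ hn.1).mono (aco_nonneg (btr_nonneg hb _)) (aco_btr_le hb _)) n, ← Complex.ofReal_mul]
  have hpos : (0 : ℝ) < √(2 * π) := Real.sqrt_pos.2 (by positivity)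
  have t3 := t2.div t1 hpos.ne'
  rw [div_self hpos.ne'] at t3
  have hne : ∀ᶠ n in atTop, R n ≠ 0 := t1.eventually_ne hpos.ne'
  refine isEquivalent_of_tendsto_one ?_
  refine t3.congr' ?_
  filter_upwards [hne] with n hn
  have hσ0 : σ n ≠ 0 := fun h => hn (by simp [hR, h])
  have hp0 : p n ≠ 0 := fun h => hn (by simp [hR, h])
  have hr0 : r n ^ n ≠ 0 := pow_ne_zero _ (Real.exp_pos _).ne'
  have hx1 := (Real.exp_pos (Fb b (r n))).ne'
  have hx2 := (Real.exp_pos (Fmb b (m n) (r n))).ne'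
  have hπ := Real.pi_pos.ne'
  simp only [Pi.div_apply, hR, hRm]
  rw [Real.exp_neg, Real.exp_neg, Real.exp_sub]
  field_simp
  simp only [hr]
  ring
end
end
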